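/- arXiv:1704.06891 — 5 statements merged into one kernel-verified Lean document; each statement's English description precedes it below -/
import Mathlib

section
/- Fix an integer p ≥ 2. For τ in the upper half-plane ℍ and x ∈ ℝ write q^x := e^{2πiτx}. Define F(τ) := Σ_{m₁,m₂ ≥ 1, m₁ ≡ m₂ (mod 3)} min(m₁,m₂) · q^{(p/3)(m₁²+m₂²+m₁m₂) − m₁ − m₂ + 1/p} (1 − q^{m₁})(1 − q^{m₂})(1 − q^{m₁+m₂}) (the series converges absolutely). Then for every τ ∈ ℍ one has F(τ) = (2/p)·F₁(pτ) + 2·F₂(pτ), where F₁ and F₂ are evaluated with q^x := e^{2πi(pτ)x}. -/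
open Complex MeasureTheory Real Filter Topology

noncomputable section

/-- `q^x := e^{2πiτx}` -/
def qpow (τ : ℂ) (x : ℝ) : ℂ := Complex.exp (2 * Real.pi * Complex.I * τ * x)

/-- The quadratic form `Q(x₁,x₂) = 3x₁² + 3x₁x₂ + x₂²`. -/
def Qf (x₁ x₂ : ℝ) : ℝ := 3 * x₁ ^ 2 + 3 * x₁ * x₂ + x₂ ^ 2

/-- The six-element (multi)set `𝒮`, listed in order. -/
def Sfull (p : ℕ) : Fin 6 → ℝ × ℝ :=
  ![(1 - 1 / (p : ℝ), 2 / (p : ℝ)), (1 / (p : ℝ), 1 - 2 / (p : ℝ)), (1, 1 / (p : ℝ)),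
    (0, 1 - 1 / (p : ℝ)), (1 / (p : ℝ), 1 - 1 / (p : ℝ)), (1 - 1 / (p : ℝ), 1 / (p : ℝ))]

/-- `ε(α)`: `-2` on the first two elements of `𝒮`, `1` on the rest. -/
def epsF : Fin 6 → ℝ := ![-2, -2, 1, 1, 1, 1]

/-- `η(α)`: `1` on the elements of `𝒮*` (indices 0, 3, 4), `-1` on the rest. -/
def etaF : Fin 6 → ℝ := ![1, -1, -1, 1, 1, -1]

/-- `F₁(τ) = Σ_{α∈𝒮} ε(α) Σ_{n∈α+ℕ₀²} q^{Q(n)} + (1/2) Σ_{m∈ℤ} sgn(m+1/p) q^{(m+1/p)²}`. -/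
def Fone (p : ℕ) (τ : ℂ) : ℂ :=
  (∑ i : Fin 6, (epsF i : ℂ) *
      ∑' n : ℕ × ℕ, qpow τ (Qf ((Sfull p i).1 + n.1) ((Sfull p i).2 + n.2)))
    + (1 / 2) * ∑' m : ℤ, (Real.sign ((m : ℝ) + 1 / p) : ℂ) * qpow τ (((m : ℝ) + 1 / p) ^ 2)

/-- `F₂(τ) = Σ_{α∈𝒮} η(α) Σ_{n∈α+ℕ₀²} n₂ q^{Q(n)} − (1/2) Σ_{m∈ℤ} |m+1/p| q^{(m+1/p)²}`. -/
def Ftwo (p : ℕ) (τ : ℂ) : ℂ :=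
  (∑ i : Fin 6, (etaF i : ℂ) *
      ∑' n : ℕ × ℕ, (((Sfull p i).2 + n.2 : ℝ) : ℂ) *
        qpow τ (Qf ((Sfull p i).1 + n.1) ((Sfull p i).2 + n.2)))
    - (1 / 2) * ∑' m : ℤ, ((|(m : ℝ) + 1 / p| : ℝ) : ℂ) * qpow τ (((m : ℝ) + 1 / p) ^ 2)

/-- The `sl₃` false theta function
`F(τ) = Σ_{m₁,m₂≥1, m₁≡m₂ (3)} min(m₁,m₂) q^{(p/3)(m₁²+m₂²+m₁m₂)−m₁−m₂+1/p}
(1−q^{m₁})(1−q^{m₂})(1−q^{m₁+m₂})`. -/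
def Ffull (p : ℕ) (τ : ℂ) : ℂ :=
  ∑' m : ℕ × ℕ,
    if (m.1 + 1) % 3 = (m.2 + 1) % 3 then
      ((min (m.1 + 1) (m.2 + 1) : ℕ) : ℂ) *
        qpow τ ((p / 3) * (((m.1 : ℝ) + 1) ^ 2 + ((m.2 : ℝ) + 1) ^ 2
            + ((m.1 : ℝ) + 1) * ((m.2 : ℝ) + 1)) - ((m.1 : ℝ) + 1) - ((m.2 : ℝ) + 1) + 1 / p) *
        (1 - qpow τ ((m.1 : ℝ) + 1)) * (1 - qpow τ ((m.2 : ℝ) + 1)) *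
        (1 - qpow τ (((m.1 : ℝ) + 1) + ((m.2 : ℝ) + 1)))
    else 0

lemma qpow_add (τ : ℂ) (x y : ℝ) : qpow τ (x + y) = qpow τ x * qpow τ y := by
  simp only [qpow, ← Complex.exp_add]
  congr 1
  push_cast
  ring

lemma qpow_natCast_mul (p : ℕ) (τ : ℂ) (x : ℝ) : qpow (p * τ) x = qpow τ (p * x) := by
  simp only [qpow]
  congr 1
  push_cast
  ring

lemma norm_qpow (τ : ℂ) (x : ℝ) : ‖qpow τ x‖ = Real.exp (-(2 * π * τ.im) * x) := by
  rw [qpow, Complex.norm_exp]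
  congr 1
  simp [Complex.mul_re, Complex.mul_im]

lemma add_sub_four_le_Qf (x y : ℝ) : x + y - 4 ≤ Qf x y := by
  unfold Qf
  nlinarith [sq_nonneg (x - 4), sq_nonneg (y - 4), sq_nonneg (23 * x + 12 * y), sq_nonneg y]

lemma summable_add_natCast_mul_qpow_Qf {τ : ℂ} (hτ : 0 < τ.im) (k : ℂ) (s t : ℝ) :
    Summable fun n : ℕ × ℕ => (k + n.2) * qpow τ (Qf (s + n.1) (t + n.2)) := by
  set c := 2 * π * τ.im with hc
  have hc0 : 0 < c := by positivity
  have h0 : Summable fun n : ℕ => Real.exp (-c * n) := by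
    simpa using Real.summable_pow_mul_exp_neg_nat_mul 0 hc0
  have h1 : Summable fun n : ℕ => (‖k‖ + n) * Real.exp (-c * n) := by
    have h := (h0.mul_left ‖k‖).add (Real.summable_pow_mul_exp_neg_nat_mul 1 hc0)
    simpa [add_mul] using h
  have h2 := (h0.mul_of_nonneg h1 (fun n => by positivity) (fun n => by positivity)).mul_left
    (Real.exp (-c * (s + t - 4)))
  refine Summable.of_norm_bounded h2 fun n => ?_
  rw [norm_mul, norm_qpow, ← hc]
  have hk : ‖k + n.2‖ ≤ ‖k‖ + n.2 := (norm_add_le _ _).trans (by simp)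
  have hexp : Real.exp (-c * Qf (s + n.1) (t + n.2))
      ≤ Real.exp (-c * (s + t - 4)) * Real.exp (-c * n.1) * Real.exp (-c * n.2) := by
    rw [← Real.exp_add, ← Real.exp_add, Real.exp_le_exp]
    have := mul_le_mul_of_nonneg_left (add_sub_four_le_Qf (s + n.1) (t + n.2)) hc0.le
    linarith
  calc ‖k + n.2‖ * Real.exp (-c * Qf (s + n.1) (t + n.2))
      ≤ (‖k‖ + n.2) *
        (Real.exp (-c * (s + t - 4)) * Real.exp (-c * n.1) * Real.exp (-c * n.2)) := by
        gcongr
    _ = _ := by ring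

lemma summable_qpow_Qf {τ : ℂ} (hτ : 0 < τ.im) (s t : ℝ) :
    Summable fun n : ℕ × ℕ => qpow τ (Qf (s + n.1) (t + n.2)) := by
  refine ((summable_add_natCast_mul_qpow_Qf hτ 1 s t).sub
    (summable_add_natCast_mul_qpow_Qf hτ 0 s t)).congr fun n => ?_
  ring

lemma summable_add_natCast_mul_qpow_Qf_row {τ : ℂ} (hτ : 0 < τ.im) (k : ℂ) (s t : ℝ) :
    Summable fun n : ℕ => (k + n) * qpow τ (Qf s (t + n)) := by
  simpa [Function.comp_def] using (summable_add_natCast_mul_qpow_Qf hτ k s t).comp_injective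
    (Prod.mk_right_injective (0 : ℕ))

lemma summable_qpow_Qf_row {τ : ℂ} (hτ : 0 < τ.im) (s t : ℝ) :
    Summable fun n : ℕ => qpow τ (Qf s (t + n)) := by
  simpa [Function.comp_def] using (summable_qpow_Qf hτ s t).comp_injective
    (Prod.mk_right_injective (0 : ℕ))

/-- The term `(n₂ + 1) q^{Q(s + n₁, t + n₂ + 1)}`. -/
def coneTerm (τ : ℂ) (s t : ℝ) (n : ℕ × ℕ) : ℂ :=
  (1 + n.2) * qpow τ (Qf (s + n.1) (t + 1 + n.2))

/-- The sum of `coneTerm τ s t` over the quadrant. -/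
def coneSum (τ : ℂ) (s t : ℝ) : ℂ := ∑' n : ℕ × ℕ, coneTerm τ s t n

/-- The sum of `coneTerm τ s t` over the boundary ray `n₁ = 0`. -/
def raySum (τ : ℂ) (s t : ℝ) : ℂ := ∑' n : ℕ, (1 + n) * qpow τ (Qf s (t + 1 + n))

lemma summable_coneTerm {τ : ℂ} (hτ : 0 < τ.im) (s t : ℝ) : Summable (coneTerm τ s t) :=
  summable_add_natCast_mul_qpow_Qf hτ 1 s (t + 1)

lemma coneSum_eq_raySum_add {τ : ℂ} (hτ : 0 < τ.im) (s t : ℝ) :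
    coneSum τ s t = raySum τ s t + coneSum τ (s + 1) t := by
  have h := summable_coneTerm hτ s t
  rw [coneSum, h.tsum_prod, h.prod.tsum_eq_zero_add, coneSum,
    (summable_coneTerm hτ (s + 1) t).tsum_prod, raySum]
  congr 1
  · simp [coneTerm]
  · refine tsum_congr fun a => tsum_congr fun b => ?_
    simp only [coneTerm]
    push_cast
    ring_nf

lemma coneSum_eq_tsum (τ : ℂ) (s t : ℝ) :
    coneSum τ s t = ∑' n : ℕ × ℕ, (n.2 : ℂ) * qpow τ (Qf (s + n.1) (t + n.2)) := by
  have hinj : Function.Injective fun n : ℕ × ℕ => (n.1, n.2 + 1) := by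
    rintro ⟨a, b⟩ ⟨c, d⟩ h
    simpa using h
  rw [← hinj.tsum_eq, coneSum]
  · refine tsum_congr fun n => ?_
    simp only [coneTerm]
    push_cast
    ring_nf
  · rintro ⟨a, _ | b⟩ h
    · simp at h
    · exact ⟨(a, b), rfl⟩

lemma raySum_eq_tsum (τ : ℂ) (s t : ℝ) :
    raySum τ s t = ∑' n : ℕ, (n : ℂ) * qpow τ (Qf s (t + n)) := by
  rw [← (add_left_injective 1).tsum_eq, raySum]
  · refine tsum_congr fun n => ?_
    push_cast
    ring_nf
  · rintro (_ | b) h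
    · simp at h
    · exact ⟨b, rfl⟩

lemma raySum_neg {τ : ℂ} {s t s' t' : ℝ} (hs : s' = -s) (ht : t' = t + 3 * s) :
    raySum τ s t = raySum τ s' t' := by
  refine tsum_congr fun n => ?_
  congr 2
  subst hs ht
  simp only [Qf]
  ring

lemma tsum_add_mul_qpow_Qf {τ : ℂ} (hτ : 0 < τ.im) (k : ℂ) (s t : ℝ) :
    ∑' n : ℕ × ℕ, ((t + n.2 : ℝ) : ℂ) * qpow τ (Qf (s + n.1) (t + n.2))
      = (∑' n : ℕ × ℕ, (k + n.2) * qpow τ (Qf (s + n.1) (t + n.2)))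
        + (t - k) * ∑' n : ℕ × ℕ, qpow τ (Qf (s + n.1) (t + n.2)) := by
  rw [← tsum_mul_left, ← (summable_add_natCast_mul_qpow_Qf hτ k s t).tsum_add
    ((summable_qpow_Qf hτ s t).mul_left _)]
  refine tsum_congr fun n => ?_
  push_cast
  ring

lemma tsum_eq_add_of_symm_of_support_mod_three {f : ℕ × ℕ → ℂ} (hsymm : ∀ a b, f (a, b) = f (b, a))
    (hf : Function.support f ⊆ {m | m.1 % 3 = m.2 % 3})
    (h : Summable fun n : ℕ × ℕ => f (n.2 + 3 * n.1, n.2))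
    (h' : Summable fun n : ℕ × ℕ => f (n.2 + 3 * (n.1 + 1), n.2)) :
    ∑' m, f m = (∑' n : ℕ × ℕ, f (n.2 + 3 * n.1, n.2))
      + ∑' n : ℕ × ℕ, f (n.2 + 3 * (n.1 + 1), n.2) := by
  let φ : (ℕ × ℕ) ⊕ (ℕ × ℕ) → ℕ × ℕ :=
    Sum.elim (fun n => (n.2 + 3 * n.1, n.2)) (fun n => (n.2, n.2 + 3 * (n.1 + 1)))
  have hφ : Function.Injective φ := by
    rintro (⟨a, b⟩ | ⟨a, b⟩) (⟨c, d⟩ | ⟨c, d⟩) h <;>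
      simp only [φ, Sum.elim_inl, Sum.elim_inr, Prod.mk.injEq, Sum.inl.injEq, Sum.inr.injEq,
        reduceCtorEq] at h ⊢ <;> omega
  rw [← hφ.tsum_eq]
  · refine (HasSum.sum ?_ ?_).tsum_eq
    · exact h.hasSum
    · simpa [Function.comp_def, φ, hsymm _ (_ + 3 * _)] using h'.hasSum
  · rintro ⟨a, b⟩ hab
    have hmod : a % 3 = b % 3 := hf hab
    rcases le_total b a with hle | hle
    · refine ⟨Sum.inl ((a - b) / 3, b), ?_⟩
      simp only [φ, Sum.elim_inl, Prod.mk.injEq, and_true]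
      omega
    · rcases hle.eq_or_lt with rfl | hlt
      · exact ⟨Sum.inl (0, a), by simp [φ]⟩
      · refine ⟨Sum.inr ((b - a) / 3 - 1, a), ?_⟩
        simp only [φ, Sum.elim_inr, Prod.mk.injEq, true_and]
        omega

/-- The summand of `Ffull`. -/
def fullTerm (p : ℕ) (τ : ℂ) (m : ℕ × ℕ) : ℂ :=
  if (m.1 + 1) % 3 = (m.2 + 1) % 3 then
    ((min (m.1 + 1) (m.2 + 1) : ℕ) : ℂ) *
      qpow τ ((p / 3) * (((m.1 : ℝ) + 1) ^ 2 + ((m.2 : ℝ) + 1) ^ 2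
          + ((m.1 : ℝ) + 1) * ((m.2 : ℝ) + 1)) - ((m.1 : ℝ) + 1) - ((m.2 : ℝ) + 1) + 1 / p) *
      (1 - qpow τ ((m.1 : ℝ) + 1)) * (1 - qpow τ ((m.2 : ℝ) + 1)) *
      (1 - qpow τ (((m.1 : ℝ) + 1) + ((m.2 : ℝ) + 1)))
  else 0

lemma fullTerm_swap (p : ℕ) (τ : ℂ) (a b : ℕ) : fullTerm p τ (a, b) = fullTerm p τ (b, a) := by
  simp only [fullTerm]
  rw [min_comm (b + 1)]
  refine if_congr eq_comm ?_ rfl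
  ring_nf

lemma fullTerm_cone {p : ℕ} (hp : p ≠ 0) (τ : ℂ) (n : ℕ × ℕ) (a : ℕ) (r : ℝ)
    (ha : (a : ℝ) = r + n.1) :
    fullTerm p τ (n.2 + 3 * a, n.2) =
      coneTerm (p * τ) (r - 1 / p) (2 / p) n - coneTerm (p * τ) (r + 1 / p) (-2 / p) n
      - coneTerm (p * τ) r (1 / p) n + coneTerm (p * τ) r (-1 / p) n
      + coneTerm (p * τ) (r + 1 / p) (-1 / p) n - coneTerm (p * τ) (r - 1 / p) (1 / p) n := by
  have hp' : (p : ℝ) ≠ 0 := by exact_mod_cast hp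
  have hmod : (n.2 + 3 * a + 1) % 3 = (n.2 + 1) % 3 := by omega
  have hmin : min (n.2 + 3 * a + 1) (n.2 + 1) = n.2 + 1 := by omega
  simp only [fullTerm, coneTerm, qpow_natCast_mul, hmod, hmin, if_true]
  obtain ⟨b, hb⟩ : ∃ b : ℝ, b = n.2 := ⟨_, rfl⟩
  push_cast
  simp only [← hb, ha]
  set e : ℝ := (p / 3) * ((b + 3 * (r + n.1) + 1) ^ 2 + (b + 1) ^ 2
    + (b + 3 * (r + n.1) + 1) * (b + 1)) - (b + 3 * (r + n.1) + 1) - (b + 1) + 1 / p with he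
  set u : ℝ := b + 3 * (r + n.1) + 1 with hu
  set v : ℝ := b + 1 with hv
  have e₀ : p * Qf (r - 1 / p + n.1) (2 / p + 1 + b) = e + v + v + u := by
    rw [he, hu, hv, Qf]; field_simp; ring
  have e₁ : p * Qf (r + 1 / p + n.1) (-2 / p + 1 + b) = e + u := by
    rw [he, hu, Qf]; field_simp; ring
  have e₂ : p * Qf (r + n.1) (1 / p + 1 + b) = e + u + u + v + v := by
    rw [he, hu, hv, Qf]; field_simp; ring
  have e₃ : p * Qf (r + n.1) (-1 / p + 1 + b) = e := by
    rw [he, Qf]; field_simp; ring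
  have e₄ : p * Qf (r + 1 / p + n.1) (-1 / p + 1 + b) = e + u + u + v := by
    rw [he, hu, hv, Qf]; field_simp; ring
  have e₅ : p * Qf (r - 1 / p + n.1) (1 / p + 1 + b) = e + v := by
    rw [he, hv, Qf]; field_simp; ring
  simp only [e₀, e₁, e₂, e₃, e₄, e₅, qpow_add]
  ring

lemma hasSum_fullTerm_cone {p : ℕ} (hp : p ≠ 0) {τ : ℂ} (hτ : 0 < ((p : ℂ) * τ).im) (k : ℕ) :
    HasSum (fun n : ℕ × ℕ => fullTerm p τ (n.2 + 3 * (n.1 + k), n.2))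
      (coneSum (p * τ) (k - 1 / p) (2 / p) - coneSum (p * τ) (k + 1 / p) (-2 / p)
      - coneSum (p * τ) k (1 / p) + coneSum (p * τ) k (-1 / p)
      + coneSum (p * τ) (k + 1 / p) (-1 / p) - coneSum (p * τ) (k - 1 / p) (1 / p)) := by
  have h (s t : ℝ) := (summable_coneTerm hτ s t).hasSum
  have hsum := (((((h (k - 1 / p) (2 / p)).sub (h (k + 1 / p) (-2 / p))).sub
    (h k (1 / p))).add (h k (-1 / p))).add (h (k + 1 / p) (-1 / p))).sub (h (k - 1 / p) (1 / p))
  refine hsum.congr_fun fun n => ?_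
  exact fullTerm_cone hp τ n (n.1 + k) k (by push_cast; ring)

lemma Ffull_eq_coneSum {p : ℕ} (hp : p ≠ 0) {τ : ℂ} (hτ : 0 < ((p : ℂ) * τ).im) :
    Ffull p τ =
      2 * (coneSum (p * τ) (1 - 1 / p) (2 / p) - coneSum (p * τ) (1 / p) (-2 / p)
      - coneSum (p * τ) 1 (1 / p) + coneSum (p * τ) 0 (-1 / p)
      + coneSum (p * τ) (1 / p) (-1 / p) - coneSum (p * τ) (1 - 1 / p) (1 / p))
      - raySum (p * τ) 0 (1 / p) - raySum (p * τ) 0 (-1 / p) := by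
  have h0 := hasSum_fullTerm_cone hp hτ 0
  have h1 := hasSum_fullTerm_cone hp hτ 1
  simp only [add_zero, Nat.cast_zero, Nat.cast_one, zero_add, zero_sub] at h0 h1
  have hsupp : Function.support (fullTerm p τ) ⊆ {m | m.1 % 3 = m.2 % 3} := by
    intro m hm
    by_contra hne
    refine hm (if_neg fun h => hne ?_)
    simp only [Set.mem_ofPred_eq]
    omega
  have hsplit : Ffull p τ = _ := tsum_eq_add_of_symm_of_support_mod_three (f := fullTerm p τ)
    (fullTerm_swap p τ) hsupp h0.summable h1.summable
  rw [hsplit, h0.tsum_eq, h1.tsum_eq]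
  have c (s t : ℝ) := coneSum_eq_raySum_add hτ s t
  rw [c (-(1 / p)) (2 / p), c (-(1 / p)) (1 / p), c 0 (1 / p), c 0 (-1 / p), c (1 / p) (-2 / p),
    c (1 / p) (-1 / p),
    raySum_neg (τ := p * τ) (s := -(1 / p)) (t := 2 / p) (s' := 1 / p) (t' := -1 / p)
      (by ring) (by ring),
    raySum_neg (τ := p * τ) (s := -(1 / p)) (t := 1 / p) (s' := 1 / p) (t' := -2 / p)
      (by ring) (by ring)]
  ring_nf

lemma sign_abs_tsum_eq_raySum {p : ℕ} (hp : 2 ≤ p) {τ : ℂ} (hτ : 0 < τ.im) :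
    (1 / (p : ℂ)) * (∑' m : ℤ, (Real.sign ((m : ℝ) + 1 / p) : ℂ) * qpow τ (((m : ℝ) + 1 / p) ^ 2))
      - ∑' m : ℤ, ((|(m : ℝ) + 1 / p| : ℝ) : ℂ) * qpow τ (((m : ℝ) + 1 / p) ^ 2)
    = -raySum τ 0 (1 / p) - raySum τ 0 (-1 / p) := by
  have hp0 : (0 : ℝ) < 1 / p := by positivity
  have hp1 : (1 : ℝ) / p < 1 := by
    rw [div_lt_one (by positivity)]
    exact_mod_cast hp
  have hpos (n : ℕ) : (0 : ℝ) < ((n : ℤ) : ℝ) + 1 / p := by positivity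
  have hneg (n : ℕ) : ((-((n : ℤ) + 1) : ℤ) : ℝ) + 1 / p < 0 := by
    push_cast
    have : (0 : ℝ) ≤ n := n.cast_nonneg
    linarith
  have qpos (n : ℕ) : qpow τ ((((n : ℤ) : ℝ) + 1 / p) ^ 2) = qpow τ (Qf 0 (1 / p + n)) := by
    congr 1
    simp only [Qf]
    push_cast
    ring
  have qneg (n : ℕ) : qpow τ ((((-((n : ℤ) + 1) : ℤ) : ℝ) + 1 / p) ^ 2)
      = qpow τ (Qf 0 (-1 / p + 1 + n)) := by
    congr 1
    simp only [Qf]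
    push_cast
    ring
  have hs (t : ℝ) := (summable_qpow_Qf_row hτ 0 t).hasSum
  have hw (k : ℂ) (t : ℝ) := (summable_add_natCast_mul_qpow_Qf_row hτ k 0 t).hasSum
  have hsign : HasSum
      (fun m : ℤ => (Real.sign ((m : ℝ) + 1 / p) : ℂ) * qpow τ (((m : ℝ) + 1 / p) ^ 2)) _ :=
    HasSum.of_nat_of_neg_add_one
      ((hs (1 / p)).congr_fun fun n => by
        rw [Real.sign_of_pos (hpos n), qpos, Complex.ofReal_one, one_mul])
      ((hs (-1 / p + 1)).neg.congr_fun fun n => by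
        rw [Real.sign_of_neg (hneg n), qneg, Complex.ofReal_neg, Complex.ofReal_one, neg_one_mul])
  have habs : HasSum
      (fun m : ℤ => ((|(m : ℝ) + 1 / p| : ℝ) : ℂ) * qpow τ (((m : ℝ) + 1 / p) ^ 2)) _ :=
    HasSum.of_nat_of_neg_add_one
      (((hw 0 (1 / p)).add ((hs (1 / p)).mul_left (1 / (p : ℂ)))).congr_fun fun n => by
        rw [abs_of_pos (hpos n), qpos]
        push_cast
        ring)
      (((hw 1 (-1 / p + 1)).sub ((hs (-1 / p + 1)).mul_left (1 / (p : ℂ)))).congr_fun fun n => by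
        rw [abs_of_neg (hneg n), qneg]
        push_cast
        ring)
  rw [hsign.tsum_eq, habs.tsum_eq, raySum_eq_tsum τ 0 (1 / p), raySum]
  simp only [zero_add]
  ring

/-- For `p ≥ 2` and `τ` in the upper half-plane, `F(τ) = (2/p)·F₁(pτ) + 2·F₂(pτ)`. -/
theorem falseTheta_decomposition (p : ℕ) (hp : 2 ≤ p) (τ : ℂ) (hτ : 0 < τ.im) :
    Ffull p τ = (2 / (p : ℂ)) * Fone p ((p : ℂ) * τ) + 2 * Ftwo p ((p : ℂ) * τ) := by
  have hp0 : p ≠ 0 := by omega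
  have hτ' : 0 < ((p : ℂ) * τ).im := by
    rw [← Complex.ofReal_natCast, Complex.im_ofReal_mul]
    positivity
  rw [Ffull_eq_coneSum hp0 hτ']
  have hbdry := sign_abs_tsum_eq_raySum hp hτ'
  have w (k : ℂ) (s t : ℝ) := tsum_add_mul_qpow_Qf hτ' k s t
  have c₀ (s t : ℝ) := coneSum_eq_tsum (p * τ) s t
  have c₁ (s t t' : ℝ) (h : t + 1 = t') : coneSum (p * τ) s t =
      ∑' n : ℕ × ℕ, (1 + n.2) * qpow (p * τ) (Qf (s + n.1) (t' + n.2)) := by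
    subst h
    rfl
  simp only [Fone, Ftwo, Fin.sum_univ_six, Sfull, epsF, etaF, Matrix.cons_val]
  rw [w 0 (1 - 1 / p) (2 / p), w 1 (1 / p) (1 - 2 / p), w 0 1 (1 / p), w 1 0 (1 - 1 / p),
    w 1 (1 / p) (1 - 1 / p), w 0 (1 - 1 / p) (1 / p), c₀ (1 - 1 / p) (2 / p),
    c₀ (1 - 1 / p) (1 / p), c₀ 1 (1 / p), c₁ (1 / p) (-2 / p) (1 - 2 / p) (by ring),
    c₁ 0 (-1 / p) (1 - 1 / p) (by ring), c₁ (1 / p) (-1 / p) (1 - 1 / p) (by ring)]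
  simp only [zero_add] at hbdry ⊢
  push_cast at hbdry ⊢
  linear_combination -hbdry

end
end

section
/- Fix an integer p ≥ 2. For every h ∈ ℤ and k ∈ ℕ with k > 0 and gcd(h,k) = 1, the radial limit lim_{t→0⁺} F₁(e^{2πi h/k − t}) exists, i.e. the function t ↦ Σ_{α∈𝒮} ε(α) Σ_{n∈α+ℕ₀²} e^{(2πi h/k − t)·Q(n)} + (1/2) Σ_{m∈ℤ} sgn(m+1/p) e^{(2πi h/k − t)·(m+1/p)²} tends to a finite complex limit as t → 0⁺. -/
open Complex MeasureTheory Real Filter Topology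

noncomputable section

/-- `F₁` evaluated at `q = e^z`, i.e.
`Σ_{α∈𝒮} ε(α) Σ_{n∈α+ℕ₀²} e^{z·Q(n)} + (1/2) Σ_{m∈ℤ} sgn(m+1/p) e^{z·(m+1/p)²}`. -/
def FoneZ (p : ℕ) (z : ℂ) : ℂ :=
  (∑ i : Fin 6, (epsF i : ℂ) *
      ∑' n : ℕ × ℕ,
        Complex.exp (z * (Qf ((Sfull p i).1 + n.1) ((Sfull p i).2 + n.2) : ℝ)))
    + (1 / 2) * ∑' m : ℤ,
        (Real.sign ((m : ℝ) + 1 / p) : ℂ) * Complex.exp (z * ((((m : ℝ) + 1 / p) ^ 2 : ℝ) : ℂ))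

theorem tsum_nat_prod_swap {E : Type*} [AddCommMonoid E] [TopologicalSpace E] (g : ℕ × ℕ → E) :
    ∑' n, g n = ∑' n : ℕ × ℕ, g (n.2, n.1) :=
  ((Equiv.prodComm ℕ ℕ).tsum_eq g).symm

section DoubleSums

variable {E : Type*} [NormedAddCommGroup E] [CompleteSpace E]

theorem tsum_nat_prod_eq_add {g : ℕ × ℕ → E} (hg : Summable g) {β : Type*}
    (i : β → ℕ × ℕ) (j : ℕ × ℕ → ℕ × ℕ) (hi : Function.Injective i) (hj : Function.Injective j)
    (hij : ∀ x y, i x ≠ j y) (hs : ∀ n, (∃ x, i x = n) ∨ ∃ y, j y = n) :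
    ∑' n, g n = ∑' x, g (i x) + ∑' y, g (j y) := by
  have hb : Function.Bijective (Sum.elim i j) := by
    refine ⟨hi.sumElim hj hij, fun n => ?_⟩
    rcases hs n with ⟨x, hx⟩ | ⟨y, hy⟩
    · exact ⟨Sum.inl x, hx⟩
    · exact ⟨Sum.inr y, hy⟩
  rw [← (Equiv.ofBijective _ hb).tsum_eq g]
  exact Summable.tsum_sum (f := fun x => g (Sum.elim i j x)) (hg.comp_injective hi)
    (hg.comp_injective hj)

theorem tsum_nat_prod_split {g : ℕ × ℕ → E} (hg : Summable g) :
    ∑' n, g n = ∑' n : ℕ × ℕ, g (n.1, n.1 + n.2) + ∑' n : ℕ × ℕ, g (n.1 + n.2 + 1, n.1) := by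
  refine tsum_nat_prod_eq_add hg (fun n : ℕ × ℕ => (n.1, n.1 + n.2)) (fun n => (n.1 + n.2 + 1, n.1))
    ?_ ?_ ?_ ?_
  · rintro ⟨a, b⟩ ⟨c, d⟩ h
    simp only [Prod.mk.injEq] at h ⊢
    omega
  · rintro ⟨a, b⟩ ⟨c, d⟩ h
    simp only [Prod.mk.injEq] at h ⊢
    omega
  · rintro ⟨a, b⟩ ⟨c, d⟩ h
    simp only [Prod.mk.injEq] at h
    omega
  · rintro ⟨a, b⟩
    rcases le_or_gt a b with h | h
    · exact Or.inl ⟨(a, b - a), by simp; omega⟩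
    · exact Or.inr ⟨(b, a - b - 1), by simp; omega⟩

theorem tsum_nat_prod_fst {g : ℕ × ℕ → E} (hg : Summable g) :
    ∑' n, g n = ∑' n : ℕ, g (0, n) + ∑' n : ℕ × ℕ, g (n.1 + 1, n.2) := by
  refine tsum_nat_prod_eq_add hg (fun n : ℕ => (0, n)) (fun n => (n.1 + 1, n.2)) ?_ ?_ ?_ ?_
  · intro a b h
    simpa using h
  · rintro ⟨a, b⟩ ⟨c, d⟩ h
    simpa using h
  · rintro a ⟨c, d⟩ h
    simp at h
  · rintro ⟨_ | a, b⟩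
    · exact Or.inl ⟨b, rfl⟩
    · exact Or.inr ⟨(a, b), rfl⟩

theorem tsum_nat_prod_snd {g : ℕ × ℕ → E} (hg : Summable g) :
    ∑' n, g n = ∑' n : ℕ, g (n, 0) + ∑' n : ℕ × ℕ, g (n.1, n.2 + 1) := by
  refine tsum_nat_prod_eq_add hg (fun n : ℕ => (n, 0)) (fun n => (n.1, n.2 + 1)) ?_ ?_ ?_ ?_
  · intro a b h
    simpa using h
  · rintro ⟨a, b⟩ ⟨c, d⟩ h
    simpa using h
  · rintro a ⟨c, d⟩ h
    simp at h
  · rintro ⟨a, _ | b⟩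
    · exact Or.inl ⟨a, rfl⟩
    · exact Or.inr ⟨(a, b), rfl⟩

theorem tsum_nat_prod_diag {g : ℕ × ℕ → E} (hg : Summable g) :
    ∑' n, g n = ∑' m : ℕ, g (m, m) + ∑' n : ℕ × ℕ, g (n.1, n.1 + n.2 + 1) +
      ∑' n : ℕ × ℕ, g (n.1 + n.2 + 1, n.1) := by
  have hi : Function.Injective fun n : ℕ × ℕ => (n.1, n.1 + n.2) := by
    rintro ⟨a, b⟩ ⟨c, d⟩ h
    simp only [Prod.mk.injEq] at h ⊢
    omega
  rw [tsum_nat_prod_split hg, tsum_nat_prod_snd (g := fun n => g (n.1, n.1 + n.2)) (hg.comp_injective hi)]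
  rfl

theorem tsum_nat_prod_residues {g : ℕ × ℕ → E} (hg : Summable g) (N : ℕ) [NeZero N] :
    ∑' n, g n = ∑ r : Fin N × Fin N, ∑' j : ℕ × ℕ, g (j.1 * N + r.1, j.2 * N + r.2) := by
  let e : (Fin N × Fin N) × (ℕ × ℕ) ≃ ℕ × ℕ :=
    ((Equiv.prodComm _ _).trans (Equiv.prodProdProdComm ℕ ℕ (Fin N) (Fin N))).trans
      (Equiv.prodCongr (Nat.divModEquiv N).symm (Nat.divModEquiv N).symm)
  rw [← e.tsum_eq g, Summable.tsum_prod (f := fun c => g (e c)) (hg.comp_injective e.injective),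
    tsum_fintype]
  rfl

end DoubleSums

def eisForm (s x y : ℝ) : ℝ := x ^ 2 + s * x * y + y ^ 2

theorem eisForm_ge {s x y : ℝ} (hs : |s| ≤ 1) (hx : 0 ≤ x) (hy : 0 ≤ y) :
    (x ^ 2 + y ^ 2) / 2 ≤ eisForm s x y := by
  have := (abs_le.1 hs).1
  have h := mul_nonneg hx hy
  unfold eisForm
  nlinarith [sq_nonneg (x - y), mul_le_mul_of_nonneg_right this h]

theorem eisForm_comm (s x y : ℝ) : eisForm s x y = eisForm s y x := by
  unfold eisForm; ring

theorem eisForm_smul (s c x y : ℝ) : eisForm s (c * x) (c * y) = c ^ 2 * eisForm s x y := by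
  unfold eisForm; ring

theorem abs_exp_neg_taylor_two (w : ℝ) :
    |rexp (-w) - (1 - w + w ^ 2 / 2)| ≤ |w| ^ 3 * rexp |w| := by
  have := Complex.norm_exp_sub_sum_le_norm_mul_exp (-(w : ℂ)) 3
  rw [norm_neg, Complex.norm_real, Real.norm_eq_abs] at this
  refine le_trans (le_of_eq ?_) this
  rw [← Real.norm_eq_abs, ← Complex.norm_real]
  congr 1
  simp [Finset.sum_range_succ, Nat.factorial]
  ring

theorem abs_exp_neg_taylor_one (w : ℝ) :
    |rexp (-w) - (1 - w)| ≤ |w| ^ 2 * rexp |w| := by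
  have := Complex.norm_exp_sub_sum_le_norm_mul_exp (-(w : ℂ)) 2
  rw [norm_neg, Complex.norm_real, Real.norm_eq_abs] at this
  refine le_trans (le_of_eq ?_) this
  rw [← Real.norm_eq_abs, ← Complex.norm_real]
  congr 1
  simp [Finset.sum_range_succ]
  ring

set_option maxHeartbeats 1000000 in
theorem eisForm_quadratic_expansion {s τ X Y a b : ℝ} (hs : |s| ≤ 1) (h0 : 0 < τ) (h1 : τ ≤ 1)
    (hX : 0 ≤ X) (hY : 0 ≤ Y) (ha : 0 ≤ a) (ha2 : a ≤ 2) (hb : 0 ≤ b) (hb2 : b ≤ 2) :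
    |rexp (-eisForm s (X + τ * a) (Y + τ * b)) -
        rexp (-eisForm s X Y) * (1 - τ * (a * (2 * X + s * Y) + b * (2 * Y + s * X))
          - τ ^ 2 * eisForm s a b
          + (τ * (a * (2 * X + s * Y) + b * (2 * Y + s * X))) ^ 2 / 2)| ≤
      20000 * rexp 6 * rexp 994 * τ ^ 3 * (rexp (-X) * rexp (-Y)) := by
  obtain ⟨hs1, hs2⟩ := abs_le.1 hs
  set l := a * (2 * X + s * Y) + b * (2 * Y + s * X) with hl
  set c := eisForm s a b with hc
  set Z := X + Y + 1 with hZ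
  have hZ1 : 1 ≤ Z := by linarith
  have hlZ : |l| ≤ 8 * Z := by
    have h1 : |2 * X + s * Y| ≤ 2 * Z := by
      rw [abs_le]; constructor <;> nlinarith
    have h2 : |2 * Y + s * X| ≤ 2 * Z := by
      rw [abs_le]; constructor <;> nlinarith
    calc |l| ≤ |a * (2 * X + s * Y)| + |b * (2 * Y + s * X)| := abs_add_le _ _
      _ = a * |2 * X + s * Y| + b * |2 * Y + s * X| := by
        rw [abs_mul, abs_mul, abs_of_nonneg ha, abs_of_nonneg hb]
      _ ≤ 2 * (2 * Z) + 2 * (2 * Z) := by gcongr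
      _ = 8 * Z := by ring
  have hcb : |c| ≤ 12 := by
    have hab := mul_nonneg ha hb
    have : a * b ≤ 4 := by nlinarith
    rw [abs_le, hc]; unfold eisForm; constructor <;> nlinarith
  set w := τ * l + τ ^ 2 * c with hw
  have hτl : |τ * l| ≤ 8 * (τ * Z) := by
    rw [abs_mul, abs_of_pos h0]; nlinarith
  have hτc : |τ ^ 2 * c| ≤ 12 * τ ^ 2 := by
    rw [abs_mul, abs_of_pos (by positivity)]; nlinarith [sq_nonneg τ]
  have hwb : |w| ≤ 20 * (τ * Z) := by
    have : τ ^ 2 ≤ τ * Z := by nlinarith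
    linarith [abs_add_le (τ * l) (τ ^ 2 * c)]
  have hwb' : |w| ≤ 20 * Z := by nlinarith
  have hZ3 : Z ^ 3 ≤ 6 * rexp Z := by
    have := Real.pow_div_factorial_le_exp Z (by linarith) 3
    norm_num [Nat.factorial] at this
    linarith
  have hmain : |rexp (-w) - (1 - τ * l - τ ^ 2 * c + (τ * l) ^ 2 / 2)| ≤
      20000 * τ ^ 3 * (Z ^ 3 * rexp (20 * Z)) := by
    have e1 : rexp (-w) - (1 - τ * l - τ ^ 2 * c + (τ * l) ^ 2 / 2) =
      (rexp (-w) - (1 - w + w ^ 2 / 2)) + ((τ * l) * (τ ^ 2 * c) + (τ ^ 2 * c) ^ 2 / 2) := by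
      rw [hw]; ring
    have e2 : |(τ * l) * (τ ^ 2 * c)| ≤ 96 * τ ^ 3 * Z := by
      rw [abs_mul]
      calc |τ * l| * |τ ^ 2 * c| ≤ (8 * (τ * Z)) * (12 * τ ^ 2) := by gcongr
        _ = _ := by ring
    have e3 : |(τ ^ 2 * c) ^ 2 / 2| ≤ 72 * τ ^ 3 := by
      rw [abs_div, abs_pow, abs_two]
      calc |τ ^ 2 * c| ^ 2 / 2 ≤ (12 * τ ^ 2) ^ 2 / 2 := by gcongr
        _ = 72 * τ ^ 3 * τ := by ring
        _ ≤ 72 * τ ^ 3 := by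
          have : 0 ≤ 72 * τ ^ 3 := by positivity
          nlinarith
    have e4 : |w| ^ 3 * rexp |w| ≤ 8000 * τ ^ 3 * (Z ^ 3 * rexp (20 * Z)) := by
      calc |w| ^ 3 * rexp |w| ≤ (20 * (τ * Z)) ^ 3 * rexp (20 * Z) := by gcongr
        _ = _ := by ring
    have e5 : Z ≤ Z ^ 3 * rexp (20 * Z) := by
      have h1 : 1 ≤ rexp (20 * Z) := Real.one_le_exp (by linarith)
      have h2 : Z ≤ Z ^ 3 := le_self_pow₀ hZ1 (by norm_num)
      nlinarith
    have e6 : 0 < τ ^ 3 := by positivity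
    rw [e1]
    have t1 := abs_add_le (rexp (-w) - (1 - w + w ^ 2 / 2))
      ((τ * l) * (τ ^ 2 * c) + (τ ^ 2 * c) ^ 2 / 2)
    have t2 := abs_add_le ((τ * l) * (τ ^ 2 * c)) ((τ ^ 2 * c) ^ 2 / 2)
    have t3 := abs_exp_neg_taylor_two w
    have f1 := mul_le_mul_of_nonneg_left e5 e6.le
    have f2 := mul_le_mul_of_nonneg_left hZ1 e6.le
    generalize Z ^ 3 * rexp (20 * Z) = W at *
    linarith
  have hexp : rexp (-eisForm s (X + τ * a) (Y + τ * b)) = rexp (-eisForm s X Y) * rexp (-w) := by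
    rw [← Real.exp_add]
    congr 1
    rw [hw, hl, hc]; unfold eisForm; ring
  have hE : rexp (-eisForm s X Y + Z + 20 * Z) ≤ rexp (994 + -X + -Y) := by
    apply Real.exp_le_exp.2
    have h1 := eisForm_ge hs hX hY
    have h2 := sq_nonneg (X - 22)
    have h3 := sq_nonneg (Y - 22)
    rw [hZ]
    clear_value c l Z w
    linarith
  have h6 : (6 : ℝ) ≤ rexp 6 := by linarith [Real.add_one_le_exp (6 : ℝ)]
  rw [Real.exp_add (994 + -X) (-Y), Real.exp_add 994 (-X), Real.exp_add (_ + Z) (20 * Z),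
    Real.exp_add (-eisForm s X Y) Z] at hE
  rw [hexp, ← mul_sub, abs_mul, abs_of_pos (Real.exp_pos _)]
  have hτ3 : 0 < τ ^ 3 := by positivity
  calc rexp (-eisForm s X Y) * |rexp (-w) - (1 - τ * l - τ ^ 2 * c + (τ * l) ^ 2 / 2)|
      ≤ rexp (-eisForm s X Y) * (20000 * τ ^ 3 * ((6 * rexp Z) * rexp (20 * Z))) := by
        refine mul_le_mul_of_nonneg_left (hmain.trans ?_) (Real.exp_pos _).le
        gcongr
    _ = 20000 * τ ^ 3 * (6 * (rexp (-eisForm s X Y) * rexp Z * rexp (20 * Z))) := by ring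
    _ ≤ 20000 * τ ^ 3 * (rexp 6 * (rexp 994 * rexp (-X) * rexp (-Y))) :=
        mul_le_mul_of_nonneg_left (mul_le_mul h6 hE (by positivity) (by positivity))
          (by positivity)
    _ = 20000 * rexp 6 * rexp 994 * τ ^ 3 * (rexp (-X) * rexp (-Y)) := by ring

theorem hasSum_exp_neg_mul_nat {τ : ℝ} (h0 : 0 < τ) :
    HasSum (fun n : ℕ => rexp (-(τ * n))) (1 - rexp (-τ))⁻¹ := by
  have h := hasSum_geometric_of_lt_one (Real.exp_pos (-τ)).le (by simpa using h0)
  refine h.congr_fun fun n => ?_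
  rw [← Real.exp_nat_mul]
  congr 1; ring

theorem inv_one_sub_exp_neg_le {τ : ℝ} (h0 : 0 < τ) (h1 : τ ≤ 1) :
    (1 - rexp (-τ))⁻¹ ≤ 2 / τ := by
  have h : rexp (-τ) ≤ 1 - τ / 2 := by
    have h2 := Real.add_one_le_exp τ
    rw [Real.exp_neg, inv_le_comm₀ (Real.exp_pos _) (by linarith)]
    refine le_trans ?_ h2
    rw [inv_le_iff_one_le_mul₀ (by linarith)]
    nlinarith
  rw [← inv_div]
  apply inv_anti₀ (by positivity)
  linarith

theorem hasSum_exp_neg_mul_nat_prod {τ : ℝ} (h0 : 0 < τ) :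
    HasSum (fun n : ℕ × ℕ => rexp (-(τ * n.1)) * rexp (-(τ * n.2)))
      ((1 - rexp (-τ))⁻¹ * (1 - rexp (-τ))⁻¹) := by
  have h := hasSum_exp_neg_mul_nat h0
  exact h.mul h (h.summable.mul_of_nonneg h.summable (fun _ => (Real.exp_pos _).le)
    (fun _ => (Real.exp_pos _).le))

def quadrantTheta (s τ a b : ℝ) : ℝ :=
  ∑' n : ℕ × ℕ, rexp (-eisForm s (τ * n.1 + τ * a) (τ * n.2 + τ * b))

def lineTheta (τ : ℝ) : ℝ := ∑' n : ℕ, rexp (-(τ * n) ^ 2)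

theorem summable_quadrantTheta {s τ a b : ℝ} (hs : |s| ≤ 1) (h0 : 0 < τ) (ha : 0 ≤ a)
    (hb : 0 ≤ b) :
    Summable fun n : ℕ × ℕ => rexp (-eisForm s (τ * n.1 + τ * a) (τ * n.2 + τ * b)) := by
  refine Summable.of_nonneg_of_le (fun _ => (Real.exp_pos _).le) (fun n => ?_)
    ((hasSum_exp_neg_mul_nat_prod h0).summable.mul_left (rexp 1))
  rw [← Real.exp_add, ← Real.exp_add]
  apply Real.exp_le_exp.2
  have h1 : 0 ≤ τ * (n.1 : ℝ) := by positivity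
  have h2 : 0 ≤ τ * (n.2 : ℝ) := by positivity
  have h3 : 0 ≤ τ * a := by positivity
  have h4 : 0 ≤ τ * b := by positivity
  have := eisForm_ge hs (add_nonneg h1 h3) (add_nonneg h2 h4)
  nlinarith [sq_nonneg (τ * (n.1 : ℝ) + τ * a - 1), sq_nonneg (τ * (n.2 : ℝ) + τ * b - 1)]

theorem summable_lineTheta {τ : ℝ} (h0 : 0 < τ) : Summable fun n : ℕ => rexp (-(τ * n) ^ 2) := by
  refine Summable.of_nonneg_of_le (fun _ => (Real.exp_pos _).le) (fun n => ?_)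
    ((hasSum_exp_neg_mul_nat h0).summable.mul_left (rexp 1))
  rw [← Real.exp_add]
  apply Real.exp_le_exp.2
  nlinarith [sq_nonneg (τ * (n : ℝ) - 1)]

theorem quadrantTheta_comm (s τ a b : ℝ) : quadrantTheta s τ a b = quadrantTheta s τ b a := by
  unfold quadrantTheta
  rw [tsum_nat_prod_swap]
  simp_rw [eisForm_comm s]

theorem quadrantTheta_add_one {s τ a b : ℝ} (hs : |s| ≤ 1) (h0 : 0 < τ) (ha : 0 ≤ a)
    (hb : 0 ≤ b) :
    quadrantTheta s τ (a + 1) b =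
      quadrantTheta s τ a b - ∑' n : ℕ, rexp (-eisForm s (τ * a) (τ * n + τ * b)) := by
  unfold quadrantTheta
  rw [tsum_nat_prod_fst (summable_quadrantTheta hs h0 ha hb), eq_sub_iff_add_eq, add_comm]
  congr 1
  · simp
  · refine tsum_congr fun n => ?_
    push_cast
    ring_nf

theorem quadrantTheta_one_zero {s τ : ℝ} (hs : |s| ≤ 1) (h0 : 0 < τ) :
    quadrantTheta s τ 1 0 = quadrantTheta s τ 0 0 - lineTheta τ := by
  have := quadrantTheta_add_one hs h0 le_rfl (le_refl (0 : ℝ))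
  simpa [eisForm, lineTheta] using this

theorem lineTheta_tail {τ : ℝ} (h0 : 0 < τ) :
    ∑' n : ℕ, rexp (-(τ * (n + 1 : ℕ)) ^ 2) = lineTheta τ - 1 := by
  unfold lineTheta
  rw [(summable_lineTheta h0).tsum_eq_zero_add]
  simp

theorem quadrantTheta_one_one {s τ : ℝ} (hs : |s| ≤ 1) (h0 : 0 < τ) :
    quadrantTheta s τ 1 1 = quadrantTheta s τ 0 0 - 2 * lineTheta τ + 1 := by
  have := quadrantTheta_add_one hs h0 le_rfl (zero_le_one (α := ℝ))
  rw [quadrantTheta_comm s τ 0 1, quadrantTheta_one_zero hs h0, zero_add] at this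
  rw [this]
  have h : ∑' n : ℕ, rexp (-eisForm s (τ * 0) (τ * n + τ * 1)) = lineTheta τ - 1 := by
    rw [← lineTheta_tail h0]
    refine tsum_congr fun n => ?_
    unfold eisForm
    push_cast
    ring_nf
  rw [h]; ring

/-- The sum over the lattice points of the closed positive quadrant for `x² - xy + y²`, against
the one for `x² + xy + y²`. -/
theorem quadrantTheta_neg_one {τ : ℝ} (h0 : 0 < τ) :
    quadrantTheta (-1) τ 0 0 = 2 * quadrantTheta 1 τ 0 0 - lineTheta τ := by
  have h := tsum_nat_prod_diag (summable_quadrantTheta (s := -1) (a := 0) (b := 0)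
    (by norm_num) h0 le_rfl le_rfl)
  have h' := tsum_nat_prod_snd (summable_quadrantTheta (s := 1) (a := 0) (b := 0)
    (by norm_num) h0 le_rfl le_rfl)
  have e1 : ∀ n : ℕ × ℕ, eisForm (-1) (τ * (n.1 : ℕ) + τ * 0) (τ * (n.1 + n.2 + 1 : ℕ) + τ * 0) =
      eisForm 1 (τ * (n.1 : ℕ) + τ * 0) (τ * (n.2 + 1 : ℕ) + τ * 0) := by
    intro n; unfold eisForm; push_cast; ring
  have e2 : ∀ n : ℕ × ℕ, eisForm (-1) (τ * (n.1 + n.2 + 1 : ℕ) + τ * 0) (τ * (n.1 : ℕ) + τ * 0) =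
      eisForm 1 (τ * (n.1 : ℕ) + τ * 0) (τ * (n.2 + 1 : ℕ) + τ * 0) := by
    intro n; unfold eisForm; push_cast; ring
  have e3 : ∀ n : ℕ, eisForm (-1) (τ * n + τ * 0) (τ * n + τ * 0) = (τ * n) ^ 2 := by
    intro n; unfold eisForm; ring
  have e4 : ∀ n : ℕ, eisForm 1 (τ * n + τ * 0) (τ * (0 : ℕ) + τ * 0) = (τ * n) ^ 2 := by
    intro n; unfold eisForm; push_cast; ring
  simp only [e1, e2, e3] at h
  simp only [e4] at h'
  unfold quadrantTheta lineTheta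
  rw [h, h']
  ring

/-- The difference of the sums over the first two rows of the quadrant. -/
theorem tendsto_row_difference {s : ℝ} (hs : |s| ≤ 1) :
    Tendsto (fun τ => quadrantTheta s τ 2 0 - 2 * quadrantTheta s τ 1 0 + quadrantTheta s τ 0 0)
      (𝓝[>] 0) (𝓝 (s / 2)) := by
  obtain ⟨hs1, hs2⟩ := abs_le.1 hs
  have key : ∀ τ : ℝ, 0 < τ → τ ≤ 1 →
      |(quadrantTheta s τ 2 0 - 2 * quadrantTheta s τ 1 0 + quadrantTheta s τ 0 0) - s / 2| ≤
        (20 * rexp 20) * τ := by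
    intro τ h0 h1
    have ht : ∀ n : ℕ, |rexp (-(eisForm s τ (τ * n))) - rexp (-(τ * n) ^ 2)
        - s / 2 * (rexp (-(τ * (n + 1 : ℕ)) ^ 2) - rexp (-(τ * n) ^ 2))| ≤
          10 * rexp 20 * τ ^ 2 * rexp (-(τ * n)) := by
      intro n
      set X := τ * (n : ℝ) with hX
      have hX0 : 0 ≤ X := by positivity
      set v := τ * (τ + s * X) with hv
      set w := τ * (τ + 2 * X) with hw
      have hvb : |v| ≤ 2 * τ * (1 + X) := by
        rw [hv, abs_mul, abs_of_pos h0, mul_comm 2 τ, mul_assoc]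
        refine mul_le_mul_of_nonneg_left ?_ h0.le
        rw [abs_le]; constructor <;> nlinarith
      have hwb : |w| ≤ 2 * τ * (1 + X) := by
        rw [hw, abs_mul, abs_of_pos h0, mul_comm 2 τ, mul_assoc]
        refine mul_le_mul_of_nonneg_left ?_ h0.le
        rw [abs_le]; constructor <;> nlinarith
      have taylor : ∀ u : ℝ, |u| ≤ 2 * τ * (1 + X) →
          |rexp (-u) - (1 - u)| ≤ 4 * τ ^ 2 * rexp (4 * (1 + X)) := by
        intro u hu
        refine (abs_exp_neg_taylor_one u).trans ?_
        have hu' : |u| ≤ 2 * (1 + X) := by nlinarith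
        have hq : (1 + X) ^ 2 ≤ rexp (2 * (1 + X)) := by
          have h := Real.add_one_le_exp (1 + X)
          rw [two_mul, Real.exp_add, ← sq]
          gcongr
          linarith
        calc |u| ^ 2 * rexp |u| ≤ (2 * τ * (1 + X)) ^ 2 * rexp (2 * (1 + X)) := by gcongr
          _ = 4 * τ ^ 2 * ((1 + X) ^ 2 * rexp (2 * (1 + X))) := by ring
          _ ≤ 4 * τ ^ 2 * (rexp (2 * (1 + X)) * rexp (2 * (1 + X))) := by gcongr
          _ = 4 * τ ^ 2 * rexp (4 * (1 + X)) := by rw [← Real.exp_add]; ring_nf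
      have tv := taylor v hvb
      have tw := taylor w hwb
      have e1 : rexp (-(eisForm s τ X)) = rexp (-X ^ 2) * rexp (-v) := by
        rw [← Real.exp_add, hv]; unfold eisForm; ring_nf
      have e2 : rexp (-(τ * (n + 1 : ℕ)) ^ 2) = rexp (-X ^ 2) * rexp (-w) := by
        rw [← Real.exp_add, hw, hX]; push_cast; ring_nf
      have e3 : |rexp (-v) - 1 - s / 2 * (rexp (-w) - 1)| ≤ 10 * τ ^ 2 * rexp (4 * (1 + X)) := by
        have e : rexp (-v) - 1 - s / 2 * (rexp (-w) - 1) = (rexp (-v) - (1 - v))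
            - s / 2 * (rexp (-w) - (1 - w)) + τ ^ 2 * (s / 2 - 1) := by
          rw [hv, hw]; ring
        have t3 : |τ ^ 2 * (s / 2 - 1)| ≤ 2 * τ ^ 2 * rexp (4 * (1 + X)) := by
          have h1 : 1 ≤ rexp (4 * (1 + X)) := Real.one_le_exp (by linarith)
          have h2 : |s / 2 - 1| ≤ 2 := by rw [abs_le]; constructor <;> linarith
          rw [abs_mul, abs_of_pos (by positivity)]
          calc τ ^ 2 * |s / 2 - 1| ≤ τ ^ 2 * (2 * 1) := by gcongr; linarith
            _ ≤ τ ^ 2 * (2 * rexp (4 * (1 + X))) := by gcongr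
            _ = _ := by ring
        have t2 : |s / 2 * (rexp (-w) - (1 - w))| ≤ 4 * τ ^ 2 * rexp (4 * (1 + X)) := by
          have : |s / 2| ≤ 1 := by rw [abs_le]; constructor <;> linarith
          rw [abs_mul]
          nlinarith [abs_nonneg (rexp (-w) - (1 - w))]
        rw [e]
        have a1 := abs_add_le ((rexp (-v) - (1 - v)) - s / 2 * (rexp (-w) - (1 - w)))
          (τ ^ 2 * (s / 2 - 1))
        have a2 := abs_sub (rexp (-v) - (1 - v)) (s / 2 * (rexp (-w) - (1 - w)))
        linarith
      have e4 : rexp (-X ^ 2) * rexp (4 * (1 + X)) ≤ rexp 20 * rexp (-X) := by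
        rw [← Real.exp_add, ← Real.exp_add]
        apply Real.exp_le_exp.2
        nlinarith [sq_nonneg (2 * X - 5)]
      rw [e1, e2, show rexp (-X ^ 2) * rexp (-v) - rexp (-X ^ 2)
        - s / 2 * (rexp (-X ^ 2) * rexp (-w) - rexp (-X ^ 2)) =
        rexp (-X ^ 2) * (rexp (-v) - 1 - s / 2 * (rexp (-w) - 1)) by ring, abs_mul,
        abs_of_pos (Real.exp_pos _)]
      calc _ ≤ rexp (-X ^ 2) * (10 * τ ^ 2 * rexp (4 * (1 + X))) := by gcongr
        _ = 10 * τ ^ 2 * (rexp (-X ^ 2) * rexp (4 * (1 + X))) := by ring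
        _ ≤ 10 * τ ^ 2 * (rexp 20 * rexp (-X)) := by gcongr
        _ = _ := by ring
    have hl := summable_lineTheta h0
    have hl1 : Summable fun n : ℕ => rexp (-(τ * (n + 1 : ℕ)) ^ 2) :=
      (summable_nat_add_iff (f := fun n : ℕ => rexp (-(τ * n) ^ 2)) 1).2 hl
    have hr : Summable fun n : ℕ => rexp (-(eisForm s τ (τ * n))) := by
      refine ((summable_quadrantTheta (a := 1) (b := 0) hs h0 zero_le_one le_rfl).comp_injective
        (i := fun n : ℕ => (0, n)) (fun a b h => by simpa using h)).congr fun n => ?_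
      simp
    have hsum : ∑' n : ℕ, (rexp (-(eisForm s τ (τ * n))) - rexp (-(τ * n) ^ 2)
        - s / 2 * (rexp (-(τ * (n + 1 : ℕ)) ^ 2) - rexp (-(τ * n) ^ 2))) =
        -((quadrantTheta s τ 2 0 - 2 * quadrantTheta s τ 1 0 + quadrantTheta s τ 0 0) - s / 2) := by
      rw [((hr.sub hl)).tsum_sub ((hl1.sub hl).mul_left _), hr.tsum_sub hl, tsum_mul_left,
        hl1.tsum_sub hl, lineTheta_tail h0]
      have e := quadrantTheta_add_one hs h0 zero_le_one (le_refl (0 : ℝ))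
      rw [show (1 : ℝ) + 1 = 2 by norm_num] at e
      rw [e, quadrantTheta_one_zero hs h0]
      simp only [mul_one, mul_zero, add_zero]
      unfold lineTheta
      ring
    have hb := tsum_of_norm_bounded ((hasSum_exp_neg_mul_nat h0).mul_left (10 * rexp 20 * τ ^ 2))
      (fun n => (Real.norm_eq_abs _).trans_le (ht n))
    rw [hsum, Real.norm_eq_abs, abs_neg] at hb
    refine hb.trans ?_
    calc 10 * rexp 20 * τ ^ 2 * (1 - rexp (-τ))⁻¹ ≤ 10 * rexp 20 * τ ^ 2 * (2 / τ) := by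
          gcongr; exact inv_one_sub_exp_neg_le h0 h1
      _ = 20 * rexp 20 * τ := by field_simp; ring
  rw [tendsto_iff_norm_sub_tendsto_zero]
  have h0 : Tendsto (fun τ : ℝ => (20 * rexp 20) * τ) (𝓝[>] 0) (𝓝 0) := by
    have : Tendsto (fun τ : ℝ => (20 * rexp 20) * τ) (𝓝 0) (𝓝 ((20 * rexp 20) * 0)) :=
      tendsto_id.const_mul _
    rw [mul_zero] at this
    exact this.mono_left nhdsWithin_le_nhds
  refine squeeze_zero' (Eventually.of_forall fun _ => norm_nonneg _) ?_ h0
  filter_upwards [Ioc_mem_nhdsGT (zero_lt_one (α := ℝ))] with τ hτ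
  exact key τ hτ.1 hτ.2

def interpolate (F : ℝ → ℝ → ℝ) (a b : ℝ) : ℝ :=
  F 0 0 + a * (F 1 0 - F 0 0) + b * (F 0 1 - F 0 0)
    + (a ^ 2 - a) / 2 * (F 2 0 - 2 * F 1 0 + F 0 0)
    + (b ^ 2 - b) / 2 * (F 0 2 - 2 * F 0 1 + F 0 0)
    + a * b * (F 1 1 - F 1 0 - F 0 1 + F 0 0)

theorem abs_sub_interpolate_le {F G : ℝ → ℝ → ℝ} {ε a b : ℝ}
    (hG : ∀ x y, G x y = interpolate G x y)
    (hFG : ∀ x y, 0 ≤ x → x ≤ 2 → 0 ≤ y → y ≤ 2 → |F x y - G x y| ≤ ε)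
    (ha : 0 ≤ a) (ha1 : a ≤ 1) (hb : 0 ≤ b) (hb1 : b ≤ 1) :
    |F a b - interpolate F a b| ≤ 20 * ε := by
  have hmul : ∀ c x M : ℝ, |c| ≤ 1 → |x| ≤ M → |c * x| ≤ M := by
    intro c x M hc hx
    rw [abs_mul]
    calc |c| * |x| ≤ 1 * M := mul_le_mul hc hx (abs_nonneg _) zero_le_one
      _ = M := one_mul M
  have d := hFG a b ha (by linarith) hb (by linarith)
  have d00 := hFG 0 0 (by norm_num) (by norm_num) (by norm_num) (by norm_num)
  have d10 := hFG 1 0 (by norm_num) (by norm_num) (by norm_num) (by norm_num)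
  have d01 := hFG 0 1 (by norm_num) (by norm_num) (by norm_num) (by norm_num)
  have d20 := hFG 2 0 (by norm_num) (by norm_num) (by norm_num) (by norm_num)
  have d02 := hFG 0 2 (by norm_num) (by norm_num) (by norm_num) (by norm_num)
  have d11 := hFG 1 1 (by norm_num) (by norm_num) (by norm_num) (by norm_num)
  have key : F a b - interpolate F a b = (F a b - G a b) - interpolate (fun x y => F x y - G x y) a b := by
    rw [hG a b]; unfold interpolate; ring
  rw [key]
  unfold interpolate
  beta_reduce
  generalize F a b - G a b = u at *
  generalize F 0 0 - G 0 0 = u00 at *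
  generalize F 1 0 - G 1 0 = u10 at *
  generalize F 0 1 - G 0 1 = u01 at *
  generalize F 2 0 - G 2 0 = u20 at *
  generalize F 0 2 - G 0 2 = u02 at *
  generalize F 1 1 - G 1 1 = u11 at *
  rw [abs_le] at d d00 d10 d01 d20 d02 d11
  have t1 := abs_le.1 (hmul a (u10 - u00) (2 * ε) (by rw [abs_le]; constructor <;> linarith)
    (by rw [abs_le]; constructor <;> linarith))
  have t2 := abs_le.1 (hmul b (u01 - u00) (2 * ε) (by rw [abs_le]; constructor <;> linarith)
    (by rw [abs_le]; constructor <;> linarith))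
  have t3 := abs_le.1 (hmul ((a ^ 2 - a) / 2) (u20 - 2 * u10 + u00) (4 * ε)
    (by rw [abs_le]; constructor <;> nlinarith) (by rw [abs_le]; constructor <;> linarith))
  have t4 := abs_le.1 (hmul ((b ^ 2 - b) / 2) (u02 - 2 * u01 + u00) (4 * ε)
    (by rw [abs_le]; constructor <;> nlinarith) (by rw [abs_le]; constructor <;> linarith))
  have t5 := abs_le.1 (hmul (a * b) (u11 - u10 - u01 + u00) (4 * ε)
    (by rw [abs_le]; constructor <;> nlinarith) (by rw [abs_le]; constructor <;> linarith))
  rw [abs_le]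
  constructor <;> linarith

theorem hasSum_interpolate {ι : Type*} {F : ι → ℝ → ℝ → ℝ} {S : ℝ → ℝ → ℝ}
    (h : ∀ x y, 0 ≤ x → 0 ≤ y → HasSum (fun i => F i x y) (S x y)) (a b : ℝ) :
    HasSum (fun i => interpolate (F i) a b) (interpolate S a b) := by
  have h00 := h 0 0 le_rfl le_rfl
  have h10 := h 1 0 zero_le_one le_rfl
  have h01 := h 0 1 le_rfl zero_le_one
  have h20 := h 2 0 zero_le_two le_rfl
  have h02 := h 0 2 le_rfl zero_le_two
  have h11 := h 1 1 zero_le_one zero_le_one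
  unfold interpolate
  exact ((((h00.add ((h10.sub h00).mul_left a)).add ((h01.sub h00).mul_left b)).add
    (((h20.sub (h10.mul_left 2)).add h00).mul_left _)).add
    (((h02.sub (h01.mul_left 2)).add h00).mul_left _)).add
    ((((h11.sub h10).sub h01).add h00).mul_left _)

theorem abs_quadrantTheta_sub_interpolate_le {s τ a b : ℝ} (hs : |s| ≤ 1) (h0 : 0 < τ)
    (h1 : τ ≤ 1) (ha : 0 ≤ a) (ha1 : a ≤ 1) (hb : 0 ≤ b) (hb1 : b ≤ 1) :
    |quadrantTheta s τ a b - interpolate (quadrantTheta s τ) a b| ≤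
      1600000 * rexp 6 * rexp 994 * τ := by
  have hS : ∀ x y : ℝ, 0 ≤ x → 0 ≤ y →
      HasSum (fun n : ℕ × ℕ => rexp (-eisForm s (τ * n.1 + τ * x) (τ * n.2 + τ * y)))
        (quadrantTheta s τ x y) :=
    fun x y hx hy => (summable_quadrantTheta hs h0 hx hy).hasSum
  have hd := (hS a b ha hb).sub (hasSum_interpolate hS a b)
  have hterm : ∀ n : ℕ × ℕ, |rexp (-eisForm s (τ * n.1 + τ * a) (τ * n.2 + τ * b)) -
      interpolate (fun x y => rexp (-eisForm s (τ * n.1 + τ * x) (τ * n.2 + τ * y))) a b| ≤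
      20 * (20000 * rexp 6 * rexp 994 * τ ^ 3) * (rexp (-(τ * n.1)) * rexp (-(τ * n.2))) := by
    intro n
    rw [mul_assoc]
    set X := τ * (n.1 : ℝ)
    set Y := τ * (n.2 : ℝ)
    refine abs_sub_interpolate_le (F := fun x y => rexp (-eisForm s (X + τ * x) (Y + τ * y)))
      (G := fun x y => rexp (-eisForm s X Y) *
        (1 - τ * (x * (2 * X + s * Y) + y * (2 * Y + s * X)) - τ ^ 2 * eisForm s x y
          + (τ * (x * (2 * X + s * Y) + y * (2 * Y + s * X))) ^ 2 / 2)) ?_ ?_ ha ha1 hb hb1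
    · intro x y
      generalize rexp (-eisForm s X Y) = E
      unfold interpolate eisForm
      ring
    · intro x y hx hx2 hy hy2
      exact eisForm_quadratic_expansion hs h0 h1 (by positivity) (by positivity) hx hx2 hy hy2
  have hb := tsum_of_norm_bounded ((hasSum_exp_neg_mul_nat_prod h0).mul_left
    (20 * (20000 * rexp 6 * rexp 994 * τ ^ 3))) (fun n => (Real.norm_eq_abs _).trans_le (hterm n))
  rw [hd.tsum_eq, Real.norm_eq_abs] at hb
  refine hb.trans ?_
  have hi := inv_one_sub_exp_neg_le h0 h1
  have hi0 : 0 ≤ (1 - rexp (-τ))⁻¹ := by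
    rw [inv_nonneg, sub_nonneg]
    exact (Real.exp_le_one_iff.2 (by linarith))
  have h4 : (1 - rexp (-τ))⁻¹ * (1 - rexp (-τ))⁻¹ ≤ 2 / τ * (2 / τ) :=
    mul_le_mul hi hi hi0 (by positivity)
  calc 20 * (20000 * rexp 6 * rexp 994 * τ ^ 3) * ((1 - rexp (-τ))⁻¹ * (1 - rexp (-τ))⁻¹)
      ≤ 20 * (20000 * rexp 6 * rexp 994 * τ ^ 3) * (2 / τ * (2 / τ)) :=
        mul_le_mul_of_nonneg_left h4 (by positivity)
    _ = 1600000 * rexp 6 * rexp 994 * τ := by field_simp; ring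

theorem tendsto_quadrantTheta {s a b : ℝ} (hs : |s| ≤ 1) (ha : 0 ≤ a) (ha1 : a ≤ 1)
    (hb : 0 ≤ b) (hb1 : b ≤ 1) :
    Tendsto (fun τ => quadrantTheta s τ a b - quadrantTheta s τ 0 0 + (a + b) * lineTheta τ)
      (𝓝[>] 0) (𝓝 (((a ^ 2 - a) / 2 + (b ^ 2 - b) / 2) * (s / 2) + a * b)) := by
  set K := 1600000 * rexp 6 * rexp 994
  have hK : Tendsto (fun τ : ℝ => K * τ) (𝓝[>] 0) (𝓝 0) := by
    have : Tendsto (fun τ : ℝ => K * τ) (𝓝 0) (𝓝 (K * 0)) := tendsto_id.const_mul _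
    rw [mul_zero] at this
    exact this.mono_left nhdsWithin_le_nhds
  have hE : Tendsto (fun τ => quadrantTheta s τ a b - interpolate (quadrantTheta s τ) a b)
      (𝓝[>] 0) (𝓝 0) := by
    refine squeeze_zero_norm' ?_ hK
    filter_upwards [Ioc_mem_nhdsGT (zero_lt_one (α := ℝ))] with τ hτ
    exact abs_quadrantTheta_sub_interpolate_le hs hτ.1 hτ.2 ha ha1 hb hb1
  have hD := ((tendsto_row_difference hs).const_mul
    ((a ^ 2 - a) / 2 + (b ^ 2 - b) / 2)).add_const (a * b)
  have := hE.add hD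
  rw [zero_add] at this
  refine this.congr' ?_
  filter_upwards [self_mem_nhdsWithin] with τ hτ
  have e1 := quadrantTheta_one_zero hs hτ
  have e2 := quadrantTheta_one_one hs hτ
  unfold interpolate
  rw [quadrantTheta_comm s τ 0 1, quadrantTheta_comm s τ 0 2, e2, e1]
  ring

/-- Near `τ = 0`, the sum over a coset of the four-quadrant sum behind `F₁` converges. -/
theorem exists_tendsto_four_quadrants {a b : ℝ} (ha : 0 ≤ a) (ha1 : a ≤ 1) (hb : 0 ≤ b)
    (hb1 : b ≤ 1) :
    ∃ L : ℝ, Tendsto (fun τ => -quadrantTheta 1 τ a b - quadrantTheta 1 τ (1 - a) (1 - b)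
      + 1 / 2 * quadrantTheta (-1) τ a (1 - b) + 1 / 2 * quadrantTheta (-1) τ (1 - a) b)
      (𝓝[>] 0) (𝓝 L) := by
  have hp : |(1 : ℝ)| ≤ 1 := by norm_num
  have hm : |(-1 : ℝ)| ≤ 1 := by norm_num
  have ha' : 0 ≤ 1 - a := by linarith
  have ha1' : 1 - a ≤ 1 := by linarith
  have hb' : 0 ≤ 1 - b := by linarith
  have hb1' : 1 - b ≤ 1 := by linarith
  refine ⟨_, ((((tendsto_quadrantTheta hp ha ha1 hb hb1).neg.sub
    (tendsto_quadrantTheta hp ha' ha1' hb' hb1')).add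
    ((tendsto_quadrantTheta hm ha ha1 hb' hb1').const_mul (1 / 2))).add
    ((tendsto_quadrantTheta hm ha' ha1' hb hb1).const_mul (1 / 2))).congr' ?_⟩
  filter_upwards [self_mem_nhdsWithin] with τ hτ
  rw [quadrantTheta_neg_one hτ]
  ring

def quadrantSum (s : ℝ) (z : ℂ) (a b : ℝ) : ℂ :=
  ∑' n : ℕ × ℕ, cexp (z * (eisForm s (n.1 + a) (n.2 + b) : ℝ))

theorem norm_cexp_mul_ofReal (z : ℂ) (x : ℝ) : ‖cexp (z * x)‖ = rexp (z.re * x) := by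
  rw [Complex.norm_exp]; simp

theorem summable_cexp_mul {z : ℂ} (hz : z.re < 0) {x : ℕ × ℕ → ℝ}
    (hx : ∀ n, ((n.1 : ℝ) + n.2) / 2 ≤ x n) : Summable fun n => cexp (z * x n) := by
  have hτ : 0 < -z.re / 2 := by linarith
  refine Summable.of_norm_bounded (hasSum_exp_neg_mul_nat_prod hτ).summable fun n => ?_
  rw [norm_cexp_mul_ofReal, ← Real.exp_add]
  apply Real.exp_le_exp.2
  nlinarith [hx n]

theorem le_eisForm_nat_add {s a b : ℝ} (hs : |s| ≤ 1) (ha : 0 ≤ a) (hb : 0 ≤ b) (n : ℕ × ℕ) :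
    ((n.1 : ℝ) + n.2) / 2 ≤ eisForm s (n.1 + a) (n.2 + b) := by
  have hsq : ∀ m : ℕ, (m : ℝ) ≤ (m : ℝ) ^ 2 := fun m => by
    exact_mod_cast Nat.le_self_pow two_ne_zero m
  have h1 := hsq n.1
  have h2 := hsq n.2
  have h3 : (0 : ℝ) ≤ n.1 := Nat.cast_nonneg _
  have h4 : (0 : ℝ) ≤ n.2 := Nat.cast_nonneg _
  have h5 : (n.1 : ℝ) ^ 2 ≤ (n.1 + a) ^ 2 := by gcongr; linarith
  have h6 : (n.2 : ℝ) ^ 2 ≤ (n.2 + b) ^ 2 := by gcongr; linarith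
  have := eisForm_ge hs (add_nonneg h3 ha) (add_nonneg h4 hb)
  linarith

theorem summable_quadrantSum {s a b : ℝ} {z : ℂ} (hz : z.re < 0) (hs : |s| ≤ 1) (ha : 0 ≤ a)
    (hb : 0 ≤ b) :
    Summable fun n : ℕ × ℕ => cexp (z * (eisForm s (n.1 + a) (n.2 + b) : ℝ)) :=
  summable_cexp_mul hz (le_eisForm_nat_add hs ha hb)

theorem quadrantSum_comm (s : ℝ) (z : ℂ) (a b : ℝ) : quadrantSum s z a b = quadrantSum s z b a := by
  unfold quadrantSum
  rw [tsum_nat_prod_swap]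
  simp_rw [eisForm_comm s]

theorem quadrantSum_one_eq {z : ℂ} (hz : z.re < 0) {a b : ℝ} (ha : 0 ≤ a) (hb : 0 ≤ b) :
    quadrantSum 1 z a b = ∑' n : ℕ × ℕ, cexp (z * (Qf (a + n.1) (b - a + n.2) : ℝ)) +
      ∑' n : ℕ × ℕ, cexp (z * (Qf (b + n.1) (1 + a - b + n.2) : ℝ)) := by
  unfold quadrantSum
  rw [tsum_nat_prod_split (summable_quadrantSum hz (by norm_num) ha hb)]
  congr 1
  · refine tsum_congr fun n => ?_
    congr 3
    unfold eisForm Qf; push_cast; ring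
  · refine tsum_congr fun n => ?_
    congr 3
    unfold eisForm Qf; push_cast; ring

theorem quadrantSum_neg_one_eq {z : ℂ} (hz : z.re < 0) {a : ℝ} (ha : 0 ≤ a) :
    quadrantSum (-1) z a a = ∑' n : ℕ, cexp (z * (((n : ℝ) + a) ^ 2 : ℝ)) +
      2 * quadrantSum 1 z a 1 := by
  have e1 : ∀ n : ℕ × ℕ, eisForm (-1) ((n.1 : ℕ) + a) ((n.1 + n.2 + 1 : ℕ) + a) =
      eisForm 1 ((n.1 : ℕ) + a) ((n.2 : ℕ) + 1) := by
    intro n; unfold eisForm; push_cast; ring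
  have e2 : ∀ n : ℕ × ℕ, eisForm (-1) ((n.1 + n.2 + 1 : ℕ) + a) ((n.1 : ℕ) + a) =
      eisForm 1 ((n.1 : ℕ) + a) ((n.2 : ℕ) + 1) := by
    intro n; unfold eisForm; push_cast; ring
  have e3 : ∀ n : ℕ, eisForm (-1) (n + a) (n + a) = (n + a) ^ 2 := by
    intro n; unfold eisForm; ring
  have h := tsum_nat_prod_diag (summable_quadrantSum (s := -1) hz (by norm_num) ha ha)
  simp only [e1, e2, e3] at h
  unfold quadrantSum
  rw [h]
  ring

theorem tsum_Qf_zero_fst {z : ℂ} (hz : z.re < 0) {b : ℝ} (hb : 0 ≤ b) :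
    ∑' n : ℕ × ℕ, cexp (z * (Qf (0 + n.1) (b + n.2) : ℝ)) =
      ∑' n : ℕ, cexp (z * (((n : ℝ) + b) ^ 2 : ℝ)) +
        ∑' n : ℕ × ℕ, cexp (z * (Qf (1 + n.1) (b + n.2) : ℝ)) := by
  have hs : Summable fun n : ℕ × ℕ => cexp (z * (Qf (0 + n.1) (b + n.2) : ℝ)) := by
    refine summable_cexp_mul hz fun n => ?_
    refine (le_eisForm_nat_add (s := 1) (a := 0) (by norm_num) le_rfl hb n).trans ?_
    have h3 : (0 : ℝ) ≤ n.1 := Nat.cast_nonneg _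
    have h4 : (0 : ℝ) ≤ n.2 := Nat.cast_nonneg _
    unfold eisForm Qf
    nlinarith [mul_nonneg h3 h4, mul_nonneg h3 hb]
  rw [tsum_nat_prod_fst hs]
  congr 1
  · refine tsum_congr fun n => ?_
    congr 3
    unfold Qf; push_cast; ring
  · refine tsum_congr fun n => ?_
    congr 3
    unfold Qf; push_cast; ring

theorem summable_cexp_sq {z : ℂ} (hz : z.re < 0) {a : ℝ} (ha : 0 ≤ a) :
    Summable fun n : ℕ => cexp (z * (((n : ℝ) + a) ^ 2 : ℝ)) := by
  refine ((summable_quadrantSum (s := 0) (b := 0) hz (by norm_num) ha le_rfl).comp_injective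
    (i := fun n : ℕ => (n, 0)) (fun a b h => by simpa using h)).congr fun n => ?_
  simp [eisForm]

theorem tsum_sign_mul_cexp {z : ℂ} (hz : z.re < 0) {a : ℝ} (ha : 0 < a) (ha1 : a < 1) :
    ∑' m : ℤ, (Real.sign ((m : ℝ) + a) : ℂ) * cexp (z * ((((m : ℝ) + a) ^ 2 : ℝ) : ℂ)) =
      ∑' n : ℕ, cexp (z * (((n : ℝ) + a) ^ 2 : ℝ)) -
        ∑' n : ℕ, cexp (z * (((n : ℝ) + (1 - a)) ^ 2 : ℝ)) := by
  have e1 : ∀ n : ℕ, (Real.sign ((((n : ℤ) : ℝ)) + a) : ℂ) *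
      cexp (z * (((((n : ℤ) : ℝ) + a) ^ 2 : ℝ) : ℂ)) = cexp (z * (((n : ℝ) + a) ^ 2 : ℝ)) := by
    intro n
    rw [Real.sign_of_pos (by positivity)]
    simp
  have e2 : ∀ n : ℕ, (Real.sign ((((-((n : ℤ) + 1) : ℤ)) : ℝ) + a) : ℂ) *
      cexp (z * ((((((-((n : ℤ) + 1) : ℤ)) : ℝ) + a) ^ 2 : ℝ) : ℂ)) =
        -cexp (z * (((n : ℝ) + (1 - a)) ^ 2 : ℝ)) := by
    intro n
    have hn : (0 : ℝ) ≤ n := Nat.cast_nonneg n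
    rw [Real.sign_of_neg (by push_cast; linarith),
      show (((-((n : ℤ) + 1) : ℤ) : ℝ) + a) ^ 2 = ((n : ℝ) + (1 - a)) ^ 2 by push_cast; ring]
    push_cast; ring
  have h1 := (summable_cexp_sq hz ha.le).hasSum
  have h2 := (summable_cexp_sq hz (sub_nonneg.2 ha1.le)).hasSum.neg
  rw [sub_eq_add_neg]
  refine (HasSum.of_nat_of_neg_add_one ?_ ?_).tsum_eq
  · simpa only [e1] using h1
  · simpa only [e2] using h2

theorem FoneZ_eq_quadrantSum {p : ℕ} (hp : 2 ≤ p) {z : ℂ} (hz : z.re < 0) :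
    FoneZ p z = -quadrantSum 1 z (1 / p) (1 - 1 / p) - quadrantSum 1 z (1 - 1 / p) (1 / p)
      + 1 / 2 * quadrantSum (-1) z (1 / p) (1 / p)
      + 1 / 2 * quadrantSum (-1) z (1 - 1 / p) (1 - 1 / p) := by
  have hp' : (2 : ℝ) ≤ p := by exact_mod_cast hp
  have h1 : (0 : ℝ) < 1 / p := by positivity
  have h2 : (1 : ℝ) / p < 1 := by rw [div_lt_one (by linarith)]; linarith
  have h3 : (0 : ℝ) ≤ 1 - 1 / p := by linarith
  unfold FoneZ
  rw [tsum_sign_mul_cexp hz h1 h2, quadrantSum_comm 1 z (1 - 1 / p), quadrantSum_neg_one_eq hz h1.le,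
    quadrantSum_neg_one_eq hz h3, quadrantSum_one_eq hz h1.le h3,
    quadrantSum_one_eq hz h1.le zero_le_one, quadrantSum_one_eq hz h3 zero_le_one]
  simp only [Fin.sum_univ_six, Sfull, epsF, Matrix.cons_val]
  rw [tsum_Qf_zero_fst hz h3,
    show (1 : ℝ) - 1 / p - 1 / p = 1 - 2 / p by ring,
    show (1 : ℝ) + 1 / p - (1 - 1 / p) = 2 / p by ring,
    show (1 : ℝ) + 1 / p - 1 = 1 / p by ring,
    show (1 : ℝ) - (1 - 1 / p) = 1 / p by ring,
    show (1 : ℝ) + (1 - 1 / p) - 1 = 1 - 1 / p by ring]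
  push_cast
  ring

/-- The phases `e^{2πi (h/k) (x² + xy + y²)}` at points of `(1/p)ℤ²` only depend on the class
modulo `kp`. -/
theorem cexp_eisForm_periodic {p k : ℕ} (hp : p ≠ 0) (hk : k ≠ 0) (h u v m n : ℤ) :
    cexp (2 * π * I * ((h : ℂ) / k) *
        (eisForm 1 ((u : ℝ) / p + (k * p : ℕ) * m) ((v : ℝ) / p + (k * p : ℕ) * n) : ℝ)) =
      cexp (2 * π * I * ((h : ℂ) / k) * (eisForm 1 ((u : ℝ) / p) ((v : ℝ) / p) : ℝ)) := by
  rw [Complex.exp_eq_exp_iff_exists_int]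
  refine ⟨h * (2 * u * m + u * n + v * m + 2 * v * n
    + k * p ^ 2 * (m ^ 2 + m * n + n ^ 2)), ?_⟩
  have hp' : (p : ℂ) ≠ 0 := Nat.cast_ne_zero.2 hp
  have hk' : (k : ℂ) ≠ 0 := Nat.cast_ne_zero.2 hk
  unfold eisForm
  push_cast
  field_simp
  ring

theorem tsum_cexp_coset {s t x y : ℝ} {w e : ℂ} (ht : 0 < t) {N : ℕ} (hN : N ≠ 0)
    (he : ∀ j : ℕ × ℕ, cexp (w * (eisForm s (j.1 * N + x) (j.2 * N + y) : ℝ)) = e) :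
    ∑' j : ℕ × ℕ, cexp ((w - t) * (eisForm s (j.1 * N + x) (j.2 * N + y) : ℝ)) =
      e * (quadrantTheta s (N * √t) (x / N) (y / N) : ℝ) := by
  have hN' : (N : ℝ) ≠ 0 := Nat.cast_ne_zero.2 hN
  unfold quadrantTheta
  rw [Complex.ofReal_tsum, ← tsum_mul_left]
  refine tsum_congr fun j => ?_
  rw [sub_mul, sub_eq_add_neg, Complex.exp_add, he j, Complex.ofReal_exp]
  congr 2
  have : eisForm s (N * √t * j.1 + N * √t * (x / N)) (N * √t * j.2 + N * √t * (y / N)) =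
      t * eisForm s (j.1 * N + x) (j.2 * N + y) := by
    rw [show N * √t * j.1 + N * √t * (x / N) = √t * (j.1 * N + x) by field_simp,
      show N * √t * j.2 + N * √t * (y / N) = √t * (j.2 * N + y) by field_simp, eisForm_smul,
      Real.sq_sqrt ht.le]
  rw [this]
  push_cast; ring

theorem quadrantSum_eq_sum_residues {s a b : ℝ} (hs : |s| ≤ 1) {z : ℂ} (hz : z.re < 0)
    (ha : 0 ≤ a) (hb : 0 ≤ b) (N : ℕ) [NeZero N] (σ₁ σ₂ : Fin N ≃ Fin N) :
    quadrantSum s z a b = ∑ r : Fin N × Fin N, ∑' j : ℕ × ℕ,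
      cexp (z * (eisForm s (j.1 * N + ((σ₁ r.1 : ℕ) + a)) (j.2 * N + ((σ₂ r.2 : ℕ) + b)) : ℝ)) := by
  unfold quadrantSum
  rw [tsum_nat_prod_residues (summable_quadrantSum hz hs ha hb) N,
    ← (Equiv.prodCongr σ₁ σ₂).sum_comp]
  refine Finset.sum_congr rfl fun r _ => tsum_congr fun j => ?_
  simp [add_assoc]

theorem Fone_radial_limit_exists (p : ℕ) (hp : 2 ≤ p) (h : ℤ) (k : ℕ) (hk : 0 < k)
    (hhk : Int.gcd h k = 1) :
    ∃ L : ℂ, Tendsto (fun t : ℝ => FoneZ p (2 * Real.pi * Complex.I * ((h : ℂ) / k) - t))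
      (𝓝[>] (0 : ℝ)) (𝓝 L) := by
  have hp0 : p ≠ 0 := by omega
  have hp' : (2 : ℝ) ≤ p := by exact_mod_cast hp
  have hc0 : (0 : ℝ) ≤ 1 / p := by positivity
  have hc1 : (1 : ℝ) / p ≤ 1 := by rw [div_le_one (by linarith)]; linarith
  have hc2 : (0 : ℝ) ≤ 1 - 1 / p := by linarith
  set N : ℕ := k * p with hN
  have hN0 : N ≠ 0 := Nat.mul_ne_zero hk.ne' hp0
  have : NeZero N := ⟨hN0⟩
  have hNpos : (0 : ℝ) < N := by positivity
  set w : ℂ := 2 * Real.pi * Complex.I * ((h : ℂ) / k) with hw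
  let x : Fin N → ℝ := fun i => (i : ℕ) + 1 / p
  let y : Fin N → ℝ := fun i => (i : ℕ) + (1 - 1 / p)
  let e : Fin N × Fin N → ℂ := fun r => cexp (w * (eisForm 1 (x r.1) (y r.2) : ℝ))
  have hper : ∀ (r : Fin N × Fin N) (m n : ℤ),
      cexp (w * (eisForm 1 (x r.1 + N * m) (y r.2 + N * n) : ℝ)) = e r := by
    intro r m n
    have h1 : x r.1 = (((r.1 : ℕ) * p + 1 : ℤ) : ℝ) / p := by
      simp only [x]; push_cast; field_simp
    have h2 : y r.2 = ((((r.2 : ℕ) + 1) * p - 1 : ℤ) : ℝ) / p := by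
      simp only [y]; push_cast; field_simp; ring
    simp only [e, h1, h2]
    exact cexp_eisForm_periodic hp0 hk.ne' h _ _ m n
  have hrev : ∀ i : Fin N, ((Fin.revPerm i : ℕ) : ℝ) = N - 1 - (i : ℕ) := by
    intro i
    rw [Fin.revPerm_apply, Fin.val_rev, Nat.cast_sub (by omega)]
    push_cast; ring
  have hx1 : ∀ i : Fin N, ((Fin.revPerm i : ℕ) : ℝ) + (1 - 1 / p) = N - x i := by
    intro i; rw [hrev]; simp only [x]; ring
  have hy1 : ∀ i : Fin N, ((Fin.revPerm i : ℕ) : ℝ) + 1 / p = N - y i := by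
    intro i; rw [hrev]; simp only [y]; ring
  have hmem : ∀ i : Fin N, ((i : ℕ) : ℝ) + 1 ≤ N := by
    intro i; exact_mod_cast i.isLt
  have hxN : ∀ i, 0 ≤ x i / N ∧ x i / N ≤ 1 := by
    intro i
    refine ⟨by positivity, ?_⟩
    rw [div_le_one hNpos]
    linarith [hmem i]
  have hyN : ∀ i, 0 ≤ y i / N ∧ y i / N ≤ 1 := by
    intro i
    refine ⟨by positivity, ?_⟩
    rw [div_le_one hNpos]
    linarith [hmem i]
  have hsub : ∀ u : ℝ, (N - u) / N = 1 - u / N := fun u => by field_simp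
  choose L hL using fun r : Fin N × Fin N =>
    exists_tendsto_four_quadrants (hxN r.1).1 (hxN r.1).2 (hyN r.2).1 (hyN r.2).2
  have hτ : Tendsto (fun t : ℝ => N * √t) (𝓝[>] 0) (𝓝[>] 0) := by
    refine tendsto_nhdsWithin_iff.2 ⟨?_, ?_⟩
    · have : Tendsto (fun t : ℝ => N * √t) (𝓝 0) (𝓝 (N * √0)) :=
        (Real.continuous_sqrt.tendsto 0).const_mul _
      rw [Real.sqrt_zero, mul_zero] at this
      exact this.mono_left nhdsWithin_le_nhds
    · filter_upwards [self_mem_nhdsWithin] with t ht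
      exact mul_pos hNpos (Real.sqrt_pos.2 ht)
  refine ⟨∑ r, e r * (L r : ℝ), Tendsto.congr' ?_ (tendsto_finsetSum _ fun r _ =>
    (((Complex.continuous_ofReal.tendsto _).comp ((hL r).comp hτ)).const_mul (e r)))⟩
  filter_upwards [self_mem_nhdsWithin] with t ht
  have hz : (w - t).re < 0 := by
    have : w = ((2 * π * (h / k) : ℝ) : ℂ) * I := by rw [hw]; push_cast; ring
    rw [this, Complex.sub_re, Complex.re_ofReal_mul, Complex.I_re, Complex.ofReal_re]
    simpa using ht
  have q1 : ∀ r : Fin N × Fin N, ∑' j : ℕ × ℕ, cexp ((w - t) * (eisForm 1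
      (j.1 * N + x r.1) (j.2 * N + y r.2) : ℝ)) =
        e r * (quadrantTheta 1 (N * √t) (x r.1 / N) (y r.2 / N) : ℝ) := by
    refine fun r => tsum_cexp_coset ht hN0 fun j => ?_
    rw [← hper r j.1 j.2]
    congr 3
    unfold eisForm; push_cast; ring
  have q2 : ∀ r : Fin N × Fin N, ∑' j : ℕ × ℕ, cexp ((w - t) * (eisForm 1
      (j.1 * N + (N - x r.1)) (j.2 * N + (N - y r.2)) : ℝ)) =
        e r * (quadrantTheta 1 (N * √t) (1 - x r.1 / N) (1 - y r.2 / N) : ℝ) := by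
    intro r
    rw [← hsub, ← hsub]
    refine tsum_cexp_coset ht hN0 fun j => ?_
    rw [← hper r (-(j.1 + 1)) (-(j.2 + 1))]
    congr 3
    unfold eisForm; push_cast; ring
  have q3 : ∀ r : Fin N × Fin N, ∑' j : ℕ × ℕ, cexp ((w - t) * (eisForm (-1)
      (j.1 * N + x r.1) (j.2 * N + (N - y r.2)) : ℝ)) =
        e r * (quadrantTheta (-1) (N * √t) (x r.1 / N) (1 - y r.2 / N) : ℝ) := by
    intro r
    rw [← hsub]
    refine tsum_cexp_coset ht hN0 fun j => ?_
    rw [← hper r j.1 (-(j.2 + 1))]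
    congr 3
    unfold eisForm; push_cast; ring
  have q4 : ∀ r : Fin N × Fin N, ∑' j : ℕ × ℕ, cexp ((w - t) * (eisForm (-1)
      (j.1 * N + (N - x r.1)) (j.2 * N + y r.2) : ℝ)) =
        e r * (quadrantTheta (-1) (N * √t) (1 - x r.1 / N) (y r.2 / N) : ℝ) := by
    intro r
    rw [← hsub]
    refine tsum_cexp_coset ht hN0 fun j => ?_
    rw [← hper r (-(j.1 + 1)) j.2]
    congr 3
    unfold eisForm; push_cast; ring
  rw [FoneZ_eq_quadrantSum hp hz,
    quadrantSum_eq_sum_residues (by norm_num) hz hc0 hc2 N (Equiv.refl _) (Equiv.refl _),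
    quadrantSum_eq_sum_residues (by norm_num) hz hc2 hc0 N Fin.revPerm Fin.revPerm,
    quadrantSum_eq_sum_residues (by norm_num) hz hc0 hc0 N (Equiv.refl _) Fin.revPerm,
    quadrantSum_eq_sum_residues (by norm_num) hz hc2 hc2 N Fin.revPerm (Equiv.refl _)]
  simp only [hx1, hy1, Equiv.refl_apply]
  change _ = -(∑ r : Fin N × Fin N, ∑' j : ℕ × ℕ, cexp ((w - t) * (eisForm 1
      (j.1 * N + x r.1) (j.2 * N + y r.2) : ℝ))) - _ + 1 / 2 * (∑ r : Fin N × Fin N, ∑' j : ℕ × ℕ,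
      cexp ((w - t) * (eisForm (-1) (j.1 * N + x r.1) (j.2 * N + (N - y r.2)) : ℝ))) + 1 / 2 *
      (∑ r : Fin N × Fin N, ∑' j : ℕ × ℕ, cexp ((w - t) * (eisForm (-1)
      (j.1 * N + (N - x r.1)) (j.2 * N + y r.2) : ℝ)))
  simp only [q1, q2, q3, q4]
  rw [Finset.mul_sum, Finset.mul_sum, ← Finset.sum_neg_distrib, ← Finset.sum_sub_distrib,
    ← Finset.sum_add_distrib, ← Finset.sum_add_distrib]
  refine Finset.sum_congr rfl fun r _ => ?_
  simp only [Function.comp_apply]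
  push_cast
  ring

end
end

section
/- Fix an integer p ≥ 2. For every h ∈ ℤ and k ∈ ℕ with k > 0 and gcd(h,k) = 1, the radial limit lim_{t→0⁺} F₂(e^{2πi h/k − t}) exists, i.e. the function t ↦ Σ_{α∈𝒮} η(α) Σ_{n∈α+ℕ₀²} n₂ e^{(2πi h/k − t)·Q(n)} − (1/2) Σ_{m∈ℤ} |m+1/p| e^{(2πi h/k − t)·(m+1/p)²} tends to a finite complex limit as t → 0⁺. -/
open Complex MeasureTheory Real Filter Topology

noncomputable section

/-- `F₂` evaluated at `q = e^z`, i.e.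
`Σ_{α∈𝒮} η(α) Σ_{n∈α+ℕ₀²} n₂ e^{z·Q(n)} − (1/2) Σ_{m∈ℤ} |m+1/p| e^{z·(m+1/p)²}`. -/
def FtwoZ (p : ℕ) (z : ℂ) : ℂ :=
  (∑ i : Fin 6, (etaF i : ℂ) *
      ∑' n : ℕ × ℕ, (((Sfull p i).2 + n.2 : ℝ) : ℂ) *
        Complex.exp (z * (Qf ((Sfull p i).1 + n.1) ((Sfull p i).2 + n.2) : ℝ)))
    - (1 / 2) * ∑' m : ℤ,
        ((|(m : ℝ) + 1 / p| : ℝ) : ℂ) * Complex.exp (z * ((((m : ℝ) + 1 / p) ^ 2 : ℝ) : ℂ))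

/-- A function on `[0, 1]` with mean zero is bounded by any bound of its derivative. -/
lemma abs_le_of_integral_eq_zero {F G : ℝ → ℝ} {M : ℝ}
    (hF : ∀ x, HasDerivAt F (G x) x) (hG : ∀ x ∈ Set.Icc (0 : ℝ) 1, |G x| ≤ M)
    (h0 : ∫ x in (0 : ℝ)..1, F x = 0) {b : ℝ} (hb : b ∈ Set.Icc (0 : ℝ) 1) : |F b| ≤ M := by
  have hM : 0 ≤ M := (abs_nonneg _).trans (hG b hb)
  have hFc : Continuous F := continuous_iff_continuousAt.2 fun x => (hF x).continuousAt
  have h1 : ∫ c in (0 : ℝ)..1, (F b - F c) = F b := by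
    rw [intervalIntegral.integral_sub (by simp) (hFc.intervalIntegrable _ _), h0]
    simp
  have h2 := intervalIntegral.norm_integral_le_of_norm_le_const (a := 0) (b := 1) (C := M)
    (f := fun c => F b - F c) (by
      intro c hc
      rw [Set.uIoc_of_le zero_le_one] at hc
      have hc' : c ∈ Set.Icc (0 : ℝ) 1 := ⟨hc.1.le, hc.2⟩
      have := (convex_Icc (0 : ℝ) 1).norm_image_sub_le_of_norm_hasDerivWithin_le
        (fun x _ => (hF x).hasDerivWithinAt) hG hc' hb
      refine this.trans ?_
      have : ‖b - c‖ ≤ 1 := by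
        rw [Real.norm_eq_abs, abs_le]; constructor <;> linarith [hb.1, hb.2, hc'.1, hc'.2]
      nlinarith)
  rw [h1] at h2
  simpa using h2

lemma abs_sub_integral_le {φ φ' : ℝ → ℝ} (h : ∀ x, HasDerivAt φ (φ' x) x)
    (hc : Continuous φ') {b : ℝ} (hb : b ∈ Set.Icc (0 : ℝ) 1) :
    |φ b - ∫ x in (0 : ℝ)..1, φ x| ≤ ∫ x in (0 : ℝ)..1, |φ' x| := by
  have hφ : Continuous φ := continuous_iff_continuousAt.2 fun x => (h x).continuousAt
  have h1 : ∫ c in (0 : ℝ)..1, (φ b - φ c) = φ b - ∫ x in (0 : ℝ)..1, φ x := by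
    rw [intervalIntegral.integral_sub (by simp) (hφ.intervalIntegrable _ _)]
    simp
  have h2 := intervalIntegral.norm_integral_le_of_norm_le_const (a := 0) (b := 1)
    (C := ∫ x in (0 : ℝ)..1, |φ' x|) (f := fun c => φ b - φ c) (by
      intro c hc'
      rw [Set.uIoc_of_le zero_le_one] at hc'
      rw [← intervalIntegral.integral_eq_sub_of_hasDerivAt (fun x _ => h x)
        (hc.intervalIntegrable c b)]
      refine intervalIntegral.norm_integral_le_integral_norm_uIoc.trans ?_
      rw [intervalIntegral.integral_of_le zero_le_one]
      refine setIntegral_mono_set (hc.abs.integrableOn_Icc.mono_set Set.Ioc_subset_Icc_self)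
        (Eventually.of_forall fun x => abs_nonneg _) (LE.le.eventuallyLE ?_)
      intro x hx
      rw [Set.mem_uIoc] at hx
      rcases hx with hx | hx
      · exact ⟨hc'.1.trans hx.1, hx.2.trans hb.2⟩
      · exact ⟨lt_of_le_of_lt hb.1 hx.1, hx.2.trans hc'.2⟩)
  rw [h1] at h2
  simpa using h2

/-- Euler–Maclaurin formula of third order on the unit interval. -/
lemma euler_maclaurin_unit_interval {φ φ₁ φ₂ φ₃ φ₄ : ℝ → ℝ}
    (h₁ : ∀ x, HasDerivAt φ (φ₁ x) x) (h₂ : ∀ x, HasDerivAt φ₁ (φ₂ x) x)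
    (h₃ : ∀ x, HasDerivAt φ₂ (φ₃ x) x) (h₄ : ∀ x, HasDerivAt φ₃ (φ₄ x) x)
    (hc : Continuous φ₄) {b : ℝ} (hb : b ∈ Set.Icc (0 : ℝ) 1) :
    |φ b - (∫ x in (0 : ℝ)..1, φ x) - (b - 1 / 2) * (φ 1 - φ 0)
      - (b ^ 2 - b + 1 / 6) / 2 * (φ₁ 1 - φ₁ 0)
      - (b ^ 3 - 3 / 2 * b ^ 2 + b / 2) / 6 * (φ₂ 1 - φ₂ 0)| ≤ ∫ x in (0 : ℝ)..1, |φ₄ x| := by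
  have c₀ : Continuous φ := continuous_iff_continuousAt.2 fun x => (h₁ x).continuousAt
  have c₁ : Continuous φ₁ := continuous_iff_continuousAt.2 fun x => (h₂ x).continuousAt
  have c₂ : Continuous φ₂ := continuous_iff_continuousAt.2 fun x => (h₃ x).continuousAt
  have c₃ : Continuous φ₃ := continuous_iff_continuousAt.2 fun x => (h₄ x).continuousAt
  have i₁ : ∫ x in (0 : ℝ)..1, φ₁ x = φ 1 - φ 0 :=
    intervalIntegral.integral_eq_sub_of_hasDerivAt (fun x _ => h₁ x) (c₁.intervalIntegrable _ _)
  have i₂ : ∫ x in (0 : ℝ)..1, φ₂ x = φ₁ 1 - φ₁ 0 :=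
    intervalIntegral.integral_eq_sub_of_hasDerivAt (fun x _ => h₂ x) (c₂.intervalIntegrable _ _)
  have i₃ : ∫ x in (0 : ℝ)..1, φ₃ x = φ₂ 1 - φ₂ 0 :=
    intervalIntegral.integral_eq_sub_of_hasDerivAt (fun x _ => h₃ x) (c₃.intervalIntegrable _ _)
  have key : ∀ {ψ : ℝ → ℝ} (_ : Continuous ψ) (u v w : ℝ),
      ∫ x in (0 : ℝ)..1, (ψ x - (∫ y in (0 : ℝ)..1, ψ y) - (x - 1 / 2) * u
        - (x ^ 2 - x + 1 / 6) / 2 * v - (x ^ 3 - 3 / 2 * x ^ 2 + x / 2) / 6 * w) = 0 := by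
    intro ψ hψ u v w
    have hpoly : ∫ x in (0 : ℝ)..1, ((∫ y in (0 : ℝ)..1, ψ y) + (x - 1 / 2) * u
        + (x ^ 2 - x + 1 / 6) / 2 * v + (x ^ 3 - 3 / 2 * x ^ 2 + x / 2) / 6 * w)
        = ∫ y in (0 : ℝ)..1, ψ y := by
      have : ∀ x : ℝ, HasDerivAt (fun x : ℝ => (∫ y in (0 : ℝ)..1, ψ y) * x
          + (x ^ 2 / 2 - x / 2) * u + (x ^ 3 / 3 - x ^ 2 / 2 + x / 6) / 2 * v
          + (x ^ 4 / 4 - x ^ 3 / 2 + x ^ 2 / 4) / 6 * w)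
          ((∫ y in (0 : ℝ)..1, ψ y) + (x - 1 / 2) * u
        + (x ^ 2 - x + 1 / 6) / 2 * v + (x ^ 3 - 3 / 2 * x ^ 2 + x / 2) / 6 * w) x := by
        intro x
        have hx := hasDerivAt_id' x
        have := ((((hx.const_mul (∫ y in (0 : ℝ)..1, ψ y))).add
          ((((hx.pow 2).div_const 2).sub (hx.div_const 2)).mul_const u)).add
          ((((((hx.pow 3).div_const 3).sub ((hx.pow 2).div_const 2)).add
            (hx.div_const 6)).div_const 2).mul_const v)).add
          ((((((hx.pow 4).div_const 4).sub ((hx.pow 3).div_const 2)).add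
            ((hx.pow 2).div_const 4)).div_const 6).mul_const w)
        refine this.congr_deriv ?_
        push_cast
        ring
      rw [intervalIntegral.integral_eq_sub_of_hasDerivAt (fun x _ => this x)
        (Continuous.intervalIntegrable (by fun_prop) _ _)]
      ring
    calc _ = ∫ x in (0 : ℝ)..1, (ψ x - ((∫ y in (0 : ℝ)..1, ψ y) + (x - 1 / 2) * u
        + (x ^ 2 - x + 1 / 6) / 2 * v + (x ^ 3 - 3 / 2 * x ^ 2 + x / 2) / 6 * w)) := by
          refine intervalIntegral.integral_congr fun x _ => ?_
          ring
      _ = 0 := by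
          rw [intervalIntegral.integral_sub (hψ.intervalIntegrable _ _)
            (Continuous.intervalIntegrable (by fun_prop) _ _), hpoly, sub_self]
  have e₀ : ∀ x ∈ Set.Icc (0 : ℝ) 1,
      |φ₃ x - ∫ y in (0 : ℝ)..1, φ₃ y| ≤ ∫ x in (0 : ℝ)..1, |φ₄ x| :=
    fun x hx => abs_sub_integral_le h₄ hc hx
  have e₁ : ∀ x ∈ Set.Icc (0 : ℝ) 1,
      |φ₂ x - (∫ y in (0 : ℝ)..1, φ₂ y) - (x - 1 / 2) * (φ₂ 1 - φ₂ 0)|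
        ≤ ∫ x in (0 : ℝ)..1, |φ₄ x| := by
    intro x hx
    refine abs_le_of_integral_eq_zero (G := fun x => φ₃ x - ∫ y in (0 : ℝ)..1, φ₃ y)
      (F := fun x => φ₂ x - (∫ y in (0 : ℝ)..1, φ₂ y) - (x - 1 / 2) * (φ₂ 1 - φ₂ 0))
      (fun x => ?_) e₀ ?_ hx
    · have hx := hasDerivAt_id' x
      refine HasDerivAt.congr_deriv (((h₃ x).sub_const (∫ y in (0 : ℝ)..1, φ₂ y)).sub
        ((hx.sub_const (1 / 2)).mul_const (φ₂ 1 - φ₂ 0))) ?_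
      rw [i₃]; ring
    · simpa using key c₂ (φ₂ 1 - φ₂ 0) 0 0
  have e₂ : ∀ x ∈ Set.Icc (0 : ℝ) 1,
      |φ₁ x - (∫ y in (0 : ℝ)..1, φ₁ y) - (x - 1 / 2) * (φ₁ 1 - φ₁ 0)
        - (x ^ 2 - x + 1 / 6) / 2 * (φ₂ 1 - φ₂ 0)|
        ≤ ∫ x in (0 : ℝ)..1, |φ₄ x| := by
    intro x hx
    refine abs_le_of_integral_eq_zero (F := fun x => φ₁ x - (∫ y in (0 : ℝ)..1, φ₁ y)
        - (x - 1 / 2) * (φ₁ 1 - φ₁ 0) - (x ^ 2 - x + 1 / 6) / 2 * (φ₂ 1 - φ₂ 0))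
      (fun x => ?_) e₁ ?_ hx
    · have hx := hasDerivAt_id' x
      refine HasDerivAt.congr_deriv ((((h₂ x).sub_const (∫ y in (0 : ℝ)..1, φ₁ y)).sub
        ((hx.sub_const (1 / 2)).mul_const (φ₁ 1 - φ₁ 0))).sub
        (((((hx.pow 2).sub hx).add_const (1 / 6)).div_const 2).mul_const (φ₂ 1 - φ₂ 0))) ?_
      rw [i₂]; push_cast; ring
    · simpa using key c₁ (φ₁ 1 - φ₁ 0) (φ₂ 1 - φ₂ 0) 0
  refine abs_le_of_integral_eq_zero (F := fun b => φ b - (∫ x in (0 : ℝ)..1, φ x)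
      - (b - 1 / 2) * (φ 1 - φ 0) - (b ^ 2 - b + 1 / 6) / 2 * (φ₁ 1 - φ₁ 0)
      - (b ^ 3 - 3 / 2 * b ^ 2 + b / 2) / 6 * (φ₂ 1 - φ₂ 0)) (fun x => ?_) e₂ (key c₀ _ _ _) hb
  have hx := hasDerivAt_id' x
  refine HasDerivAt.congr_deriv (((((h₁ x).sub_const (∫ y in (0 : ℝ)..1, φ y)).sub
    ((hx.sub_const (1 / 2)).mul_const (φ 1 - φ 0))).sub
    (((((hx.pow 2).sub hx).add_const (1 / 6)).div_const 2).mul_const (φ₁ 1 - φ₁ 0))).sub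
    (((((hx.pow 3).sub ((hx.pow 2).const_mul (3 / 2))).add
      (hx.div_const 2)).div_const 6).mul_const (φ₂ 1 - φ₂ 0))) ?_
  rw [i₁]; push_cast; ring

lemma sum_intervalIntegral_shift {ψ : ℝ → ℝ} (hψ : Continuous ψ) (M : ℕ) :
    ∑ n ∈ Finset.range M, ∫ x in (0 : ℝ)..1, ψ (n + x) = ∫ x in (0 : ℝ)..M, ψ x := by
  have := intervalIntegral.sum_integral_adjacent_intervals (f := ψ) (μ := volume)
    (a := fun n : ℕ => (n : ℝ)) (n := M) (fun k _ => hψ.intervalIntegrable _ _)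
  rw [Nat.cast_zero] at this
  rw [← this]
  refine Finset.sum_congr rfl fun n _ => ?_
  rw [intervalIntegral.integral_comp_add_left (fun x => ψ x)]
  simp

lemma intervalIntegral_le_integral_Ioi {ψ : ℝ → ℝ} (hi : IntegrableOn ψ (Set.Ioi 0)) (M : ℕ) :
    ∫ x in (0 : ℝ)..M, |ψ x| ≤ ∫ x in Set.Ioi (0 : ℝ), |ψ x| := by
  rw [intervalIntegral.integral_of_le (Nat.cast_nonneg M)]
  exact setIntegral_mono_set hi.abs (Eventually.of_forall fun x => abs_nonneg _)
    (LE.le.eventuallyLE fun x hx => hx.1)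

lemma HasDerivAt.comp_const_add_left {f f' : ℝ → ℝ} (h : ∀ x, HasDerivAt f (f' x) x) (c : ℝ) :
    ∀ x, HasDerivAt (fun x => f (c + x)) (f' (c + x)) x := fun x => by
  simpa using (h (c + x)).comp_const_add c x

lemma summable_shift_of_integrableOn {φ φ' : ℝ → ℝ} (h : ∀ x, HasDerivAt φ (φ' x) x)
    (hc : Continuous φ') (hi : IntegrableOn φ (Set.Ioi 0)) (hi' : IntegrableOn φ' (Set.Ioi 0))
    {b : ℝ} (hb : b ∈ Set.Icc (0 : ℝ) 1) : Summable fun n : ℕ => φ (n + b) := by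
  have hφ : Continuous φ := continuous_iff_continuousAt.2 fun x => (h x).continuousAt
  have hle : ∀ n : ℕ, |φ (n + b)| ≤
      (∫ x in (0 : ℝ)..1, |φ (n + x)|) + ∫ x in (0 : ℝ)..1, |φ' (n + x)| := by
    intro n
    have h1 := abs_sub_integral_le (HasDerivAt.comp_const_add_left h n) (by fun_prop) hb
    have h2 := intervalIntegral.abs_integral_le_integral_abs (f := fun x : ℝ => φ (n + x))
      (μ := volume) (zero_le_one (α := ℝ))
    have h3 := abs_sub_abs_le_abs_sub (φ (n + b)) (∫ x in (0 : ℝ)..1, φ (n + x))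
    linarith
  refine Summable.of_abs (summable_of_sum_range_le (fun n => abs_nonneg _)
    (c := (∫ x in Set.Ioi (0 : ℝ), |φ x|) + ∫ x in Set.Ioi (0 : ℝ), |φ' x|) fun M => ?_)
  refine (Finset.sum_le_sum fun n _ => hle n).trans ?_
  rw [Finset.sum_add_distrib, sum_intervalIntegral_shift hφ.abs,
    sum_intervalIntegral_shift hc.abs]
  exact add_le_add (intervalIntegral_le_integral_Ioi hi M) (intervalIntegral_le_integral_Ioi hi' M)

/-- Euler–Maclaurin formula of third order on the half line. -/
lemma euler_maclaurin_half_line {φ φ₁ φ₂ φ₃ φ₄ : ℝ → ℝ}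
    (h₁ : ∀ x, HasDerivAt φ (φ₁ x) x) (h₂ : ∀ x, HasDerivAt φ₁ (φ₂ x) x)
    (h₃ : ∀ x, HasDerivAt φ₂ (φ₃ x) x) (h₄ : ∀ x, HasDerivAt φ₃ (φ₄ x) x)
    (hc : Continuous φ₄) (i₀ : IntegrableOn φ (Set.Ioi 0)) (i₁ : IntegrableOn φ₁ (Set.Ioi 0))
    (i₂ : IntegrableOn φ₂ (Set.Ioi 0)) (i₃ : IntegrableOn φ₃ (Set.Ioi 0))
    (i₄ : IntegrableOn φ₄ (Set.Ioi 0)) {b : ℝ} (hb : b ∈ Set.Icc (0 : ℝ) 1) :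
    |∑' n : ℕ, φ (n + b) - ((∫ x in Set.Ioi (0 : ℝ), φ x) - (b - 1 / 2) * φ 0
      - (b ^ 2 - b + 1 / 6) / 2 * φ₁ 0 - (b ^ 3 - 3 / 2 * b ^ 2 + b / 2) / 6 * φ₂ 0)|
      ≤ ∫ x in Set.Ioi (0 : ℝ), |φ₄ x| := by
  have c₀ : Continuous φ := continuous_iff_continuousAt.2 fun x => (h₁ x).continuousAt
  have c₁ : Continuous φ₁ := continuous_iff_continuousAt.2 fun x => (h₂ x).continuousAt
  have hs := (summable_shift_of_integrableOn h₁ c₁ i₀ i₁ hb).hasSum.tendsto_sum_nat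
  have t₀ := (tendsto_zero_of_hasDerivAt_of_integrableOn_Ioi (fun x _ => h₁ x) i₁ i₀).comp
    tendsto_natCast_atTop_atTop
  have t₁ := (tendsto_zero_of_hasDerivAt_of_integrableOn_Ioi (fun x _ => h₂ x) i₂ i₁).comp
    tendsto_natCast_atTop_atTop
  have t₂ := (tendsto_zero_of_hasDerivAt_of_integrableOn_Ioi (fun x _ => h₃ x) i₃ i₂).comp
    tendsto_natCast_atTop_atTop
  have tI := intervalIntegral_tendsto_integral_Ioi (0 : ℝ) i₀ tendsto_natCast_atTop_atTop
  have main : ∀ M : ℕ, |∑ n ∈ Finset.range M, φ (n + b) - (∫ x in (0 : ℝ)..M, φ x)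
      - (b - 1 / 2) * (φ M - φ 0) - (b ^ 2 - b + 1 / 6) / 2 * (φ₁ M - φ₁ 0)
      - (b ^ 3 - 3 / 2 * b ^ 2 + b / 2) / 6 * (φ₂ M - φ₂ 0)|
      ≤ ∫ x in Set.Ioi (0 : ℝ), |φ₄ x| := by
    intro M
    have cell := fun n : ℕ => euler_maclaurin_unit_interval
      (HasDerivAt.comp_const_add_left h₁ n) (HasDerivAt.comp_const_add_left h₂ n)
      (HasDerivAt.comp_const_add_left h₃ n) (HasDerivAt.comp_const_add_left h₄ n)
      (by fun_prop) hb
    have tele : ∀ ψ : ℝ → ℝ, ψ M - ψ 0 = ∑ n ∈ Finset.range M, (ψ (n + 1) - ψ (n + 0)) := by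
      intro ψ
      have := Finset.sum_range_sub (fun n : ℕ => ψ n) M
      simpa using this.symm
    rw [tele φ, tele φ₁, tele φ₂, ← sum_intervalIntegral_shift c₀, Finset.mul_sum,
      Finset.mul_sum, Finset.mul_sum, ← Finset.sum_sub_distrib, ← Finset.sum_sub_distrib,
      ← Finset.sum_sub_distrib, ← Finset.sum_sub_distrib]
    refine (Finset.abs_sum_le_sum_abs _ _).trans ((Finset.sum_le_sum fun n _ => cell n).trans ?_)
    rw [sum_intervalIntegral_shift hc.abs]
    exact intervalIntegral_le_integral_Ioi i₄ M
  have lim := ((((hs.sub tI).sub ((t₀.sub_const (φ 0)).const_mul (b - 1 / 2))).sub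
    ((t₁.sub_const (φ₁ 0)).const_mul ((b ^ 2 - b + 1 / 6) / 2))).sub
    ((t₂.sub_const (φ₂ 0)).const_mul ((b ^ 3 - 3 / 2 * b ^ 2 + b / 2) / 6))).abs
  refine le_of_eq_of_le (congrArg abs ?_) (le_of_tendsto' lim main)
  ring

/-- Euler–Maclaurin formula of third order on the half line, with step `s`. -/
lemma euler_maclaurin_step {φ φ₁ φ₂ φ₃ φ₄ : ℝ → ℝ}
    (h₁ : ∀ x, HasDerivAt φ (φ₁ x) x) (h₂ : ∀ x, HasDerivAt φ₁ (φ₂ x) x)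
    (h₃ : ∀ x, HasDerivAt φ₂ (φ₃ x) x) (h₄ : ∀ x, HasDerivAt φ₃ (φ₄ x) x)
    (hc : Continuous φ₄) (i₀ : IntegrableOn φ (Set.Ioi 0)) (i₁ : IntegrableOn φ₁ (Set.Ioi 0))
    (i₂ : IntegrableOn φ₂ (Set.Ioi 0)) (i₃ : IntegrableOn φ₃ (Set.Ioi 0))
    (i₄ : IntegrableOn φ₄ (Set.Ioi 0)) {b : ℝ} (hb : b ∈ Set.Icc (0 : ℝ) 1)
    {s : ℝ} (hs : 0 < s) :
    Summable (fun n : ℕ => φ (s * (n + b))) ∧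
    |∑' n : ℕ, φ (s * (n + b)) - (s⁻¹ * (∫ x in Set.Ioi (0 : ℝ), φ x) - (b - 1 / 2) * φ 0
      - s * ((b ^ 2 - b + 1 / 6) / 2 * φ₁ 0)
      - s ^ 2 * ((b ^ 3 - 3 / 2 * b ^ 2 + b / 2) / 6 * φ₂ 0))|
      ≤ s ^ 3 * ∫ x in Set.Ioi (0 : ℝ), |φ₄ x| := by
  have hd : ∀ {f f' : ℝ → ℝ} (_ : ∀ x, HasDerivAt f (f' x) x) (k : ℕ),
      ∀ x, HasDerivAt (fun x => s ^ k * f (s * x)) (s ^ (k + 1) * f' (s * x)) x := by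
    intro f f' h k x
    have := ((h (s * x)).comp x ((hasDerivAt_id' x).const_mul s)).const_mul (s ^ k)
    refine this.congr_deriv ?_
    ring
  have hi : ∀ {f : ℝ → ℝ} (_ : IntegrableOn f (Set.Ioi 0)) (k : ℕ),
      IntegrableOn (fun x => s ^ k * f (s * x)) (Set.Ioi 0) := by
    intro f h k
    refine Integrable.const_mul ?_ _
    exact (integrableOn_Ioi_comp_mul_left_iff f 0 hs).2 (by simpa using h)
  have c₁ : Continuous φ₁ := continuous_iff_continuousAt.2 fun x => (h₂ x).continuousAt
  refine ⟨?_, ?_⟩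
  · simpa using summable_shift_of_integrableOn (hd h₁ 0) (by fun_prop) (hi i₀ 0) (hi i₁ 1) hb
  · have := euler_maclaurin_half_line (hd h₁ 0) (hd h₂ 1) (hd h₃ 2) (hd h₄ 3) (by fun_prop)
      (hi i₀ 0) (hi i₁ 1) (hi i₂ 2) (hi i₃ 3) (hi i₄ 4) hb
    have e0 : ∫ x in Set.Ioi (0 : ℝ), s ^ 0 * φ (s * x) = s⁻¹ * ∫ x in Set.Ioi (0 : ℝ), φ x := by
      simpa using integral_comp_mul_left_Ioi φ 0 hs
    have e4 : ∫ x in Set.Ioi (0 : ℝ), |s ^ (3 + 1) * φ₄ (s * x)|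
        = s ^ 3 * ∫ x in Set.Ioi (0 : ℝ), |φ₄ x| := by
      have := integral_comp_mul_left_Ioi (fun x => |φ₄ x|) 0 hs
      simp only [abs_mul, abs_of_pos (pow_pos hs (3 + 1)), integral_const_mul, this, mul_zero,
        smul_eq_mul]
      field_simp
    rw [e0, e4] at this
    refine le_of_eq_of_le (congrArg abs ?_) this
    simp only [pow_zero, one_mul, mul_zero]
    ring

/-- One-step consequence of the Euler–Maclaurin formula for a space of functions stable under
differentiation. -/
lemma euler_maclaurin_of_submodule (V : Submodule ℝ (ℝ → ℝ))
    (hd : ∀ φ ∈ V, ∃ ψ ∈ V, ∀ x, HasDerivAt φ (ψ x) x)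
    (hi : ∀ φ ∈ V, IntegrableOn φ (Set.Ioi 0)) {φ : ℝ → ℝ} (hφ : φ ∈ V) :
    ∃ d₁ d₂ C : ℝ, ∀ b ∈ Set.Icc (0 : ℝ) 1, ∀ s : ℝ, 0 < s →
      Summable (fun n : ℕ => φ (s * (n + b))) ∧
      |∑' n : ℕ, φ (s * (n + b)) - (s⁻¹ * (∫ x in Set.Ioi (0 : ℝ), φ x) - (b - 1 / 2) * φ 0
        - s * ((b ^ 2 - b + 1 / 6) / 2 * d₁)
        - s ^ 2 * ((b ^ 3 - 3 / 2 * b ^ 2 + b / 2) / 6 * d₂))| ≤ s ^ 3 * C := by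
  obtain ⟨φ₁, m₁, h₁⟩ := hd φ hφ
  obtain ⟨φ₂, m₂, h₂⟩ := hd φ₁ m₁
  obtain ⟨φ₃, m₃, h₃⟩ := hd φ₂ m₂
  obtain ⟨φ₄, m₄, h₄⟩ := hd φ₃ m₃
  obtain ⟨φ₅, m₅, h₅⟩ := hd φ₄ m₄
  exact ⟨φ₁ 0, φ₂ 0, _, fun b hb s hs => euler_maclaurin_step h₁ h₂ h₃ h₄
    (continuous_iff_continuousAt.2 fun x => (h₅ x).continuousAt) (hi _ hφ) (hi _ m₁) (hi _ m₂)
    (hi _ m₃) (hi _ m₄) hb hs⟩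

/-- A second order version of the Euler–Maclaurin formula, uniform in the step. -/
lemma euler_maclaurin_crude_of_submodule (V : Submodule ℝ (ℝ → ℝ))
    (hd : ∀ φ ∈ V, ∃ ψ ∈ V, ∀ x, HasDerivAt φ (ψ x) x)
    (hi : ∀ φ ∈ V, IntegrableOn φ (Set.Ioi 0)) {φ : ℝ → ℝ} (hφ : φ ∈ V) :
    ∃ C : ℝ, ∀ b ∈ Set.Icc (0 : ℝ) 1, ∀ s ∈ Set.Ioc (0 : ℝ) 1,
      |∑' n : ℕ, φ (s * (n + b)) - (s⁻¹ * (∫ x in Set.Ioi (0 : ℝ), φ x) - (b - 1 / 2) * φ 0)|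
        ≤ s * C := by
  obtain ⟨d₁, d₂, C, h⟩ := euler_maclaurin_of_submodule V hd hi hφ
  refine ⟨|d₁| + |d₂| + |C|, fun b hb s hs => ?_⟩
  have h1 := (h b hb s hs.1).2
  have e1 : |(b ^ 2 - b + 1 / 6) / 2| ≤ 1 := by
    rw [abs_le]; constructor <;> nlinarith [hb.1, hb.2]
  have e2 : |(b ^ 3 - 3 / 2 * b ^ 2 + b / 2) / 6| ≤ 1 := by
    have : b ^ 2 ≤ 1 := by nlinarith [hb.1, hb.2]
    have : b ^ 3 ≤ 1 := by nlinarith [hb.1, hb.2]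
    have : 0 ≤ b ^ 3 := pow_nonneg hb.1 3
    rw [abs_le]; constructor <;> nlinarith [hb.1, hb.2]
  have e3 : |s * ((b ^ 2 - b + 1 / 6) / 2 * d₁)| ≤ s * |d₁| := by
    rw [abs_mul, abs_mul, abs_of_pos hs.1]
    exact mul_le_mul_of_nonneg_left (mul_le_of_le_one_left (abs_nonneg _) e1) hs.1.le
  have s2 : s ^ 2 ≤ s := by nlinarith [hs.1, hs.2]
  have s3 : s ^ 3 ≤ s := by nlinarith [hs.1, hs.2]
  have e4 : |s ^ 2 * ((b ^ 3 - 3 / 2 * b ^ 2 + b / 2) / 6 * d₂)| ≤ s * |d₂| := by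
    rw [abs_mul, abs_mul, abs_of_pos (pow_pos hs.1 2)]
    exact mul_le_mul s2 (mul_le_of_le_one_left (abs_nonneg _) e2) (by positivity) hs.1.le
  have e5 : s ^ 3 * C ≤ s * |C| :=
    (mul_le_mul_of_nonneg_left (le_abs_self C) (pow_nonneg hs.1.le 3)).trans
      (mul_le_mul_of_nonneg_right s3 (abs_nonneg _))
  rw [abs_le] at *
  constructor <;> linarith [e3.1, e3.2, e4.1, e4.2, h1.1, h1.2]

/-- Polynomial growth in two variables. -/
def PolyBdd (v : ℝ → ℝ → ℝ) : Prop :=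
  ∃ (C : ℝ) (n : ℕ), ∀ x y, |v x y| ≤ C * (1 + x ^ 2 + y ^ 2) ^ n

lemma PolyBdd.const (c : ℝ) : PolyBdd fun _ _ => c :=
  ⟨|c|, 0, fun x y => by simp⟩

lemma PolyBdd.fst : PolyBdd fun x _ => x :=
  ⟨1, 1, fun x y => by rw [abs_le]; constructor <;> nlinarith [sq_nonneg (x - 1), sq_nonneg (x + 1)]⟩

lemma PolyBdd.snd : PolyBdd fun _ y => y :=
  ⟨1, 1, fun x y => by rw [abs_le]; constructor <;> nlinarith [sq_nonneg (y - 1), sq_nonneg (y + 1)]⟩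

lemma PolyBdd.mul {u v : ℝ → ℝ → ℝ} (hu : PolyBdd u) (hv : PolyBdd v) :
    PolyBdd fun x y => u x y * v x y := by
  obtain ⟨C, n, h⟩ := hu
  obtain ⟨D, m, h'⟩ := hv
  refine ⟨C * D, n + m, fun x y => ?_⟩
  rw [abs_mul, pow_add]
  calc _ ≤ _ := mul_le_mul (h x y) (h' x y) (abs_nonneg _) ((abs_nonneg _).trans (h x y))
    _ = _ := by ring

lemma PolyBdd.add {u v : ℝ → ℝ → ℝ} (hu : PolyBdd u) (hv : PolyBdd v) :
    PolyBdd fun x y => u x y + v x y := by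
  obtain ⟨C, n, h⟩ := hu
  obtain ⟨D, m, h'⟩ := hv
  refine ⟨|C| + |D|, n + m, fun x y => ?_⟩
  have h1 : 1 ≤ 1 + x ^ 2 + y ^ 2 := by nlinarith [sq_nonneg x, sq_nonneg y]
  have a1 : C * (1 + x ^ 2 + y ^ 2) ^ n ≤ |C| * (1 + x ^ 2 + y ^ 2) ^ (n + m) :=
    mul_le_mul (le_abs_self C) (pow_le_pow_right₀ h1 (by omega)) (by positivity) (abs_nonneg _)
  have a2 : D * (1 + x ^ 2 + y ^ 2) ^ m ≤ |D| * (1 + x ^ 2 + y ^ 2) ^ (n + m) :=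
    mul_le_mul (le_abs_self D) (pow_le_pow_right₀ h1 (by omega)) (by positivity) (abs_nonneg _)
  calc _ ≤ |u x y| + |v x y| := abs_add_le _ _
    _ ≤ _ := by rw [add_mul]; linarith [h x y, h' x y]

lemma PolyBdd.pow {u : ℝ → ℝ → ℝ} (hu : PolyBdd u) (n : ℕ) : PolyBdd fun x y => u x y ^ n := by
  induction n with
  | zero => simpa using PolyBdd.const 1
  | succ n ih => simpa only [pow_succ] using ih.mul hu

lemma pow_le_exp_mul {c : ℝ} (hc : 0 < c) (n : ℕ) :
    ∃ C : ℝ, ∀ r : ℝ, 0 ≤ r → r ^ n ≤ C * Real.exp (c * r) := by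
  refine ⟨n.factorial / c ^ n, fun r hr => ?_⟩
  have := Real.pow_div_factorial_le_exp (c * r) (by positivity) n
  rw [div_le_iff₀ (by positivity), mul_pow] at this
  rw [div_mul_eq_mul_div, le_div_iff₀ (by positivity)]
  linarith

lemma Qf_lower (x y : ℝ) : (x ^ 2 + y ^ 2) / 6 ≤ Qf x y := by
  unfold Qf; nlinarith [sq_nonneg (y + 9 / 5 * x)]

lemma PolyBdd.mul_exp_le {v : ℝ → ℝ → ℝ} (hv : PolyBdd v) :
    ∃ C, ∀ x y, |v x y * Real.exp (-Qf x y)|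
      ≤ C * Real.exp (-(1 / 12) * x ^ 2) * Real.exp (-(1 / 12) * y ^ 2) := by
  obtain ⟨D, n, h⟩ := hv
  obtain ⟨C, h'⟩ := pow_le_exp_mul (c := 1 / 12) (by norm_num) n
  refine ⟨|D| * C * Real.exp (1 / 12), fun x y => ?_⟩
  have h1 : 0 ≤ 1 + x ^ 2 + y ^ 2 := by positivity
  have h2 := h' _ h1
  rw [abs_mul, Real.abs_exp]
  calc _ ≤ |D| * (C * Real.exp (1 / 12 * (1 + x ^ 2 + y ^ 2)))
        * Real.exp (-((x ^ 2 + y ^ 2) / 6)) := by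
        refine mul_le_mul ((h x y).trans ?_) (Real.exp_le_exp.2 (neg_le_neg (Qf_lower x y)))
          (Real.exp_pos _).le (mul_nonneg (abs_nonneg _) ((pow_nonneg h1 n).trans h2))
        exact mul_le_mul (le_abs_self D) h2 (pow_nonneg h1 n) (abs_nonneg _)
    _ = |D| * C * Real.exp (1 / 12 * (1 + x ^ 2 + y ^ 2) + -((x ^ 2 + y ^ 2) / 6)) := by
        rw [Real.exp_add]; ring
    _ = |D| * C * Real.exp (1 / 12 + -(1 / 12) * x ^ 2 + -(1 / 12) * y ^ 2) := by ring_nf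
    _ = _ := by rw [Real.exp_add, Real.exp_add]; ring

lemma integrable_gauss : Integrable fun y : ℝ => Real.exp (-(1 / 12) * y ^ 2) :=
  integrable_exp_neg_mul_sq (by norm_num)

/-- The space of products of polynomials with the Gaussian `exp (-c x²)`. -/
def gaussSpace (c : ℝ) : Submodule ℝ (ℝ → ℝ) :=
  Submodule.span ℝ (Set.range fun (n : ℕ) (x : ℝ) => x ^ n * Real.exp (-c * x ^ 2))

lemma pow_mul_gauss_mem (c : ℝ) (n : ℕ) :
    (fun x : ℝ => x ^ n * Real.exp (-c * x ^ 2)) ∈ gaussSpace c :=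
  Submodule.subset_span ⟨n, rfl⟩

/-- If the generators have derivatives in the span, so does every element of the span. -/
lemma exists_hasDerivAt_of_mem_span {S : Set (ℝ → ℝ)}
    (h : ∀ φ ∈ S, ∃ ψ ∈ Submodule.span ℝ S, ∀ x, HasDerivAt φ (ψ x) x) :
    ∀ φ ∈ Submodule.span ℝ S, ∃ ψ ∈ Submodule.span ℝ S, ∀ x, HasDerivAt φ (ψ x) x := by
  intro φ hφ
  induction hφ using Submodule.span_induction with
  | mem φ hφ => exact h φ hφ
  | zero => exact ⟨0, zero_mem _, fun x => hasDerivAt_const x 0⟩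
  | add φ φ' _ _ ih ih' =>
    obtain ⟨ψ, hψ, hd⟩ := ih
    obtain ⟨ψ', hψ', hd'⟩ := ih'
    exact ⟨ψ + ψ', add_mem hψ hψ', fun x => (hd x).add (hd' x)⟩
  | smul c φ _ ih =>
    obtain ⟨ψ, hψ, hd⟩ := ih
    exact ⟨c • ψ, Submodule.smul_mem _ _ hψ, fun x => (hd x).const_smul c⟩

lemma integrableOn_of_mem_span {S : Set (ℝ → ℝ)} (h : ∀ φ ∈ S, IntegrableOn φ (Set.Ioi 0)) :
    ∀ φ ∈ Submodule.span ℝ S, IntegrableOn φ (Set.Ioi 0) := by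
  intro φ hφ
  induction hφ using Submodule.span_induction with
  | mem φ hφ => exact h φ hφ
  | zero => exact integrableOn_zero
  | add φ φ' _ _ ih ih' => exact Integrable.add ih ih'
  | smul c φ _ ih => exact Integrable.smul c ih

lemma gaussSpace_hasDerivAt (c : ℝ) :
    ∀ φ ∈ gaussSpace c, ∃ ψ ∈ gaussSpace c, ∀ x, HasDerivAt φ (ψ x) x := by
  refine exists_hasDerivAt_of_mem_span ?_
  rintro _ ⟨n, rfl⟩
  refine ⟨(n : ℝ) • (fun x : ℝ => x ^ (n - 1) * Real.exp (-c * x ^ 2))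
    + (-2 * c) • (fun x : ℝ => x ^ (n + 1) * Real.exp (-c * x ^ 2)),
    add_mem (Submodule.smul_mem _ _ (pow_mul_gauss_mem c _))
      (Submodule.smul_mem _ _ (pow_mul_gauss_mem c _)), fun x => ?_⟩
  refine ((hasDerivAt_pow n x).mul (((hasDerivAt_pow 2 x).const_mul (-c)).exp)).congr_deriv ?_
  simp only [Pi.add_apply, Pi.smul_apply, smul_eq_mul]
  push_cast
  ring

lemma gaussSpace_integrableOn {c : ℝ} (hc : 0 < c) :
    ∀ φ ∈ gaussSpace c, IntegrableOn φ (Set.Ioi 0) := by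
  refine integrableOn_of_mem_span ?_
  rintro _ ⟨n, rfl⟩
  have := integrable_rpow_mul_exp_neg_mul_sq hc (s := n) (by
    have : (0 : ℝ) ≤ n := n.cast_nonneg
    linarith)
  simp only [Real.rpow_natCast] at this
  exact this.integrableOn

/-- The moments `∫₀^∞ y^m exp (-Q(x,y)) dy`. -/
def moment (m : ℕ) (x : ℝ) : ℝ := ∫ y in Set.Ioi (0 : ℝ), y ^ m * Real.exp (-Qf x y)

lemma continuous_exp_Qf (x : ℝ) : Continuous fun y => Real.exp (-Qf x y) := by
  unfold Qf; fun_prop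

lemma hasDerivAt_exp_Qf_fst (x y : ℝ) :
    HasDerivAt (fun x => Real.exp (-Qf x y)) (-(6 * x + 3 * y) * Real.exp (-Qf x y)) x := by
  unfold Qf
  have h := hasDerivAt_id' x
  refine ((((((h.pow 2).const_mul 3).add ((h.const_mul 3).mul_const y)).add_const
    (y ^ 2)).neg).exp).congr_deriv ?_
  push_cast; simp only [Pi.add_apply, Pi.neg_apply, Pi.pow_apply]; ring

lemma hasDerivAt_exp_Qf_snd (x y : ℝ) :
    HasDerivAt (fun y => Real.exp (-Qf x y)) (-(3 * x + 2 * y) * Real.exp (-Qf x y)) y := by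
  unfold Qf
  have h := hasDerivAt_id' y
  refine ((((h.const_mul (3 * x)).const_add (3 * x ^ 2)).add (h.pow 2)).neg.exp).congr_deriv ?_
  push_cast; simp only [Pi.add_apply, Pi.neg_apply, Pi.pow_apply]; ring

lemma PolyBdd.integrableOn {v : ℝ → ℝ → ℝ} (hv : PolyBdd v) {x : ℝ}
    (hc : Continuous (v x)) :
    IntegrableOn (fun y => v x y * Real.exp (-Qf x y)) (Set.Ioi 0) := by
  obtain ⟨C, h⟩ := hv.mul_exp_le
  refine (Integrable.mono' (integrable_gauss.const_mul (C * Real.exp (-(1 / 12) * x ^ 2)))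
    (hc.mul (continuous_exp_Qf x)).aestronglyMeasurable
    (Eventually.of_forall fun y => h x y)).integrableOn

lemma polyBdd_snd_pow (m : ℕ) : PolyBdd fun _ y => y ^ m := PolyBdd.snd.pow m

lemma hasDerivAt_moment (m : ℕ) (x : ℝ) :
    HasDerivAt (moment m) (-6 * (x * moment m x) - 3 * moment (m + 1) x) x := by
  have hv : PolyBdd fun x y => y ^ m * -(6 * x + 3 * y) := by
    have := (polyBdd_snd_pow m).mul
      (((PolyBdd.const (-6)).mul PolyBdd.fst).add ((PolyBdd.const (-3)).mul PolyBdd.snd))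
    convert this using 3
    ring
  obtain ⟨C, h⟩ := hv.mul_exp_le
  have hC : 0 ≤ C := by
    have := (abs_nonneg _).trans (h 0 0)
    simpa using this
  have key := (hasDerivAt_integral_of_dominated_loc_of_deriv_le
    (μ := volume.restrict (Set.Ioi (0 : ℝ))) (x₀ := x) (s := Set.univ)
    (F := fun x y => y ^ m * Real.exp (-Qf x y))
    (F' := fun x y => y ^ m * -(6 * x + 3 * y) * Real.exp (-Qf x y))
    (bound := fun y => C * Real.exp (-(1 / 12) * y ^ 2)) Filter.univ_mem
    (Eventually.of_forall fun x =>
      ((continuous_pow m).mul (continuous_exp_Qf x)).aestronglyMeasurable)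
    ((polyBdd_snd_pow m).integrableOn (by fun_prop))
    (Continuous.aestronglyMeasurable
      ((by fun_prop : Continuous fun y => y ^ m * -(6 * x + 3 * y)).mul (continuous_exp_Qf x)))
    (Eventually.of_forall fun y x _ => ?_)
    ((integrable_gauss.const_mul C).integrableOn)
    (Eventually.of_forall fun y x _ => ?_)).2
  · refine key.congr_deriv ?_
    have i1 := (polyBdd_snd_pow m).integrableOn (x := x) (by fun_prop)
    have i2 := (polyBdd_snd_pow (m + 1)).integrableOn (x := x) (by fun_prop)
    unfold moment
    rw [← integral_const_mul, ← integral_const_mul, ← integral_const_mul,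
      ← integral_sub ((i1.const_mul x).const_mul (-6)) (i2.const_mul 3)]
    congr 1
    ext y
    ring
  · refine (h x y).trans ?_
    refine mul_le_mul_of_nonneg_right ?_ (Real.exp_pos _).le
    refine mul_le_of_le_one_right hC (Real.exp_le_one_iff.2 ?_)
    nlinarith [sq_nonneg x]
  · refine ((hasDerivAt_exp_Qf_fst x y).const_mul (y ^ m)).congr_deriv ?_
    ring

/-- The space spanned by products of monomials with moments. -/
def momentSpace : Submodule ℝ (ℝ → ℝ) :=
  Submodule.span ℝ (Set.range fun (i : ℕ × ℕ) (x : ℝ) => x ^ i.1 * moment i.2 x)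

lemma pow_mul_moment_mem (n m : ℕ) : (fun x : ℝ => x ^ n * moment m x) ∈ momentSpace :=
  Submodule.subset_span ⟨(n, m), rfl⟩

lemma momentSpace_hasDerivAt :
    ∀ φ ∈ momentSpace, ∃ ψ ∈ momentSpace, ∀ x, HasDerivAt φ (ψ x) x := by
  refine exists_hasDerivAt_of_mem_span ?_
  rintro _ ⟨⟨n, m⟩, rfl⟩
  refine ⟨(n : ℝ) • (fun x : ℝ => x ^ (n - 1) * moment m x)
    + (-6 : ℝ) • (fun x : ℝ => x ^ (n + 1) * moment m x)
    + (-3 : ℝ) • (fun x : ℝ => x ^ n * moment (m + 1) x),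
    add_mem (add_mem (Submodule.smul_mem _ _ (pow_mul_moment_mem _ _))
      (Submodule.smul_mem _ _ (pow_mul_moment_mem _ _)))
      (Submodule.smul_mem _ _ (pow_mul_moment_mem _ _)), fun x => ?_⟩
  refine ((hasDerivAt_pow n x).mul (hasDerivAt_moment m x)).congr_deriv ?_
  simp only [Pi.add_apply, Pi.smul_apply, smul_eq_mul]
  ring

lemma momentSpace_integrableOn : ∀ φ ∈ momentSpace, IntegrableOn φ (Set.Ioi 0) := by
  refine integrableOn_of_mem_span ?_
  rintro _ ⟨⟨n, m⟩, rfl⟩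
  have hc : Continuous fun x => x ^ n * moment m x :=
    (continuous_pow n).mul
      (continuous_iff_continuousAt.2 fun x => (hasDerivAt_moment m x).continuousAt)
  obtain ⟨C, h⟩ := ((PolyBdd.fst.pow n).mul (polyBdd_snd_pow m)).mul_exp_le
  refine (Integrable.mono' (integrable_gauss.const_mul
    (C * ∫ y in Set.Ioi (0 : ℝ), Real.exp (-(1 / 12) * y ^ 2))) hc.aestronglyMeasurable
    (Eventually.of_forall fun x => ?_)).integrableOn
  have e : x ^ n * moment m x
      = ∫ y in Set.Ioi (0 : ℝ), x ^ n * y ^ m * Real.exp (-Qf x y) := by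
    unfold moment
    rw [← integral_const_mul]
    congr 1; ext y; ring
  simp only [e]
  refine (norm_integral_le_of_norm_le
    (integrable_gauss.const_mul (C * Real.exp (-(1 / 12) * x ^ 2))).integrableOn
    (Eventually.of_forall fun y => h x y)).trans (le_of_eq ?_)
  rw [integral_const_mul]
  ring

lemma PolyBdd.exists_integral_abs_le {v : ℝ → ℝ → ℝ} (hv : PolyBdd v) :
    ∃ C, 0 ≤ C ∧ ∀ x, ∫ y in Set.Ioi (0 : ℝ), |v x y * Real.exp (-Qf x y)|
      ≤ C * Real.exp (-(1 / 12) * x ^ 2) := by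
  obtain ⟨C, h⟩ := hv.mul_exp_le
  have hC : 0 ≤ C := by
    have := (abs_nonneg _).trans (h 0 0)
    simpa using this
  refine ⟨C * ∫ y in Set.Ioi (0 : ℝ), Real.exp (-(1 / 12) * y ^ 2),
    mul_nonneg hC (integral_nonneg fun y => (Real.exp_pos _).le), fun x => ?_⟩
  calc _ ≤ ∫ y in Set.Ioi (0 : ℝ),
        C * Real.exp (-(1 / 12) * x ^ 2) * Real.exp (-(1 / 12) * y ^ 2) :=
        integral_mono_of_nonneg (Eventually.of_forall fun y => abs_nonneg _)
          (integrable_gauss.const_mul _).integrableOn (Eventually.of_forall fun y => h x y)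
    _ = _ := by rw [integral_const_mul]; ring

/-- Euler–Maclaurin expansion, uniform in `x`, of the sum of `y exp (-Q(x,y))` over a
progression in `y`. -/
lemma euler_maclaurin_inner :
    ∃ C, 0 ≤ C ∧ ∀ b ∈ Set.Icc (0 : ℝ) 1, ∀ s : ℝ, 0 < s → ∀ x : ℝ,
      |∑' n : ℕ, (s * (n + b)) * Real.exp (-Qf x (s * (n + b))) - (s⁻¹ * moment 1 x
        - s * ((b ^ 2 - b + 1 / 6) / 2) * Real.exp (-3 * x ^ 2)
        + s ^ 2 * (b ^ 3 - 3 / 2 * b ^ 2 + b / 2) * (x * Real.exp (-3 * x ^ 2)))|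
        ≤ s ^ 3 * (C * Real.exp (-(1 / 12) * x ^ 2)) := by
  have pw : PolyBdd fun x y => 3 * x + 2 * y :=
    ((PolyBdd.const 3).mul PolyBdd.fst).add ((PolyBdd.const 2).mul PolyBdd.snd)
  have p₁ : PolyBdd fun x y => 1 + -1 * (y * (3 * x + 2 * y)) :=
    (PolyBdd.const 1).add ((PolyBdd.const (-1)).mul (PolyBdd.snd.mul pw))
  have p₂ : PolyBdd fun x y => y * (3 * x + 2 * y) ^ 2 + -2 * (3 * x + 2 * y) + -2 * y :=
    ((PolyBdd.snd.mul (pw.pow 2)).add ((PolyBdd.const (-2)).mul pw)).add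
      ((PolyBdd.const (-2)).mul PolyBdd.snd)
  have p₃ : PolyBdd fun x y => -1 * (y * (3 * x + 2 * y) ^ 3) + 3 * (3 * x + 2 * y) ^ 2
      + 6 * (y * (3 * x + 2 * y)) + -6 :=
    ((((PolyBdd.const (-1)).mul (PolyBdd.snd.mul (pw.pow 3))).add
      ((PolyBdd.const 3).mul (pw.pow 2))).add ((PolyBdd.const 6).mul (PolyBdd.snd.mul pw))).add
      (PolyBdd.const (-6))
  have p₄ : PolyBdd fun x y => y * (3 * x + 2 * y) ^ 4 + -4 * (3 * x + 2 * y) ^ 3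
      + -12 * (y * (3 * x + 2 * y) ^ 2) + 24 * (3 * x + 2 * y) + 12 * y :=
    ((((PolyBdd.snd.mul (pw.pow 4)).add ((PolyBdd.const (-4)).mul (pw.pow 3))).add
      ((PolyBdd.const (-12)).mul (PolyBdd.snd.mul (pw.pow 2)))).add
      ((PolyBdd.const 24).mul pw)).add ((PolyBdd.const 12).mul PolyBdd.snd)
  obtain ⟨C, hC, h⟩ := p₄.exists_integral_abs_le
  refine ⟨C, hC, fun b hb s hs x => ?_⟩
  have hw : ∀ y, HasDerivAt (fun y => 3 * x + 2 * y) 2 y := fun y => by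
    simpa using ((hasDerivAt_id' y).const_mul 2).const_add (3 * x)
  have hE := hasDerivAt_exp_Qf_snd x
  have key := (euler_maclaurin_step
    (φ := fun y => y * Real.exp (-Qf x y))
    (φ₁ := fun y => (1 + -1 * (y * (3 * x + 2 * y))) * Real.exp (-Qf x y))
    (φ₂ := fun y => (y * (3 * x + 2 * y) ^ 2 + -2 * (3 * x + 2 * y) + -2 * y)
      * Real.exp (-Qf x y))
    (φ₃ := fun y => (-1 * (y * (3 * x + 2 * y) ^ 3) + 3 * (3 * x + 2 * y) ^ 2
      + 6 * (y * (3 * x + 2 * y)) + -6) * Real.exp (-Qf x y))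
    (φ₄ := fun y => (y * (3 * x + 2 * y) ^ 4 + -4 * (3 * x + 2 * y) ^ 3
      + -12 * (y * (3 * x + 2 * y) ^ 2) + 24 * (3 * x + 2 * y) + 12 * y) * Real.exp (-Qf x y))
    (fun y => ((hasDerivAt_id' y).mul (hE y)).congr_deriv (by ring))
    (fun y => (((((hasDerivAt_id' y).mul (hw y)).const_mul (-1)).const_add 1).mul
      (hE y)).congr_deriv (by simp only [Pi.mul_apply]; ring))
    (fun y => (((((hasDerivAt_id' y).mul ((hw y).pow 2)).add ((hw y).const_mul (-2))).add
      ((hasDerivAt_id' y).const_mul (-2))).mul (hE y)).congr_deriv (by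
        simp only [Pi.mul_apply, Pi.add_apply, Pi.pow_apply]; push_cast; ring))
    (fun y => (((((((hasDerivAt_id' y).mul ((hw y).pow 3)).const_mul (-1)).add
      (((hw y).pow 2).const_mul 3)).add (((hasDerivAt_id' y).mul (hw y)).const_mul 6)).add_const
      (-6)).mul (hE y)).congr_deriv (by
        simp only [Pi.mul_apply, Pi.add_apply, Pi.pow_apply]; push_cast; ring))
    ((by fun_prop : Continuous fun y => (y * (3 * x + 2 * y) ^ 4 + -4 * (3 * x + 2 * y) ^ 3
      + -12 * (y * (3 * x + 2 * y) ^ 2) + 24 * (3 * x + 2 * y) + 12 * y)).mul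
      (continuous_exp_Qf x))
    (PolyBdd.snd.integrableOn (by fun_prop)) (p₁.integrableOn (by fun_prop))
    (p₂.integrableOn (by fun_prop)) (p₃.integrableOn (by fun_prop))
    (p₄.integrableOn (by fun_prop)) hb hs).2
  refine le_trans (le_of_eq (congrArg abs ?_))
    (key.trans (mul_le_mul_of_nonneg_left (h x) (pow_pos hs 3).le))
  have hQ : Real.exp (-Qf x 0) = Real.exp (-3 * x ^ 2) := by unfold Qf; ring_nf
  simp only [hQ, moment, pow_one]
  ring

/-- The asymptotic expansion of the quadrant sums as the step tends to `0`. -/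
lemma quadrant_sum_tendsto :
    ∃ A C D : ℝ, ∀ b₁ ∈ Set.Icc (0 : ℝ) 1, ∀ b₂ ∈ Set.Icc (0 : ℝ) 1,
      ∃ L, Tendsto (fun s : ℝ =>
        (∑' n₁ : ℕ, ∑' n₂ : ℕ, (n₂ + b₂) * Real.exp (-(s ^ 2 * Qf (n₁ + b₁) (n₂ + b₂))))
        - (s⁻¹ ^ 3 * A - s⁻¹ ^ 2 * (b₁ - 1 / 2) * moment 1 0
          - s⁻¹ * ((b₁ ^ 2 - b₁ + 1 / 6) * C + (b₂ ^ 2 - b₂ + 1 / 6) * D)))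
        (𝓝[>] 0) (𝓝 L) := by
  obtain ⟨C₀, hC₀, inner⟩ := euler_maclaurin_inner
  obtain ⟨d₁, d₂, C₁, h₁⟩ := euler_maclaurin_of_submodule momentSpace momentSpace_hasDerivAt
    momentSpace_integrableOn (pow_mul_moment_mem 0 1)
  obtain ⟨C₂, h₂⟩ := euler_maclaurin_crude_of_submodule (gaussSpace 3) (gaussSpace_hasDerivAt 3)
    (gaussSpace_integrableOn (by norm_num)) (pow_mul_gauss_mem 3 0)
  obtain ⟨_, _, _, h₂'⟩ := euler_maclaurin_of_submodule (gaussSpace 3) (gaussSpace_hasDerivAt 3)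
    (gaussSpace_integrableOn (by norm_num)) (pow_mul_gauss_mem 3 0)
  obtain ⟨C₃, h₃⟩ := euler_maclaurin_crude_of_submodule (gaussSpace 3) (gaussSpace_hasDerivAt 3)
    (gaussSpace_integrableOn (by norm_num)) (pow_mul_gauss_mem 3 1)
  obtain ⟨_, _, _, h₃'⟩ := euler_maclaurin_of_submodule (gaussSpace 3) (gaussSpace_hasDerivAt 3)
    (gaussSpace_integrableOn (by norm_num)) (pow_mul_gauss_mem 3 1)
  obtain ⟨C₄, h₄⟩ := euler_maclaurin_crude_of_submodule (gaussSpace (1 / 12))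
    (gaussSpace_hasDerivAt _) (gaussSpace_integrableOn (by norm_num)) (pow_mul_gauss_mem _ 0)
  obtain ⟨_, _, _, h₄'⟩ := euler_maclaurin_of_submodule (gaussSpace (1 / 12))
    (gaussSpace_hasDerivAt _) (gaussSpace_integrableOn (by norm_num)) (pow_mul_gauss_mem _ 0)
  simp only [pow_zero, one_mul, pow_one] at h₁ h₂ h₂' h₃ h₃' h₄ h₄'
  set I₁ := ∫ x in Set.Ioi (0 : ℝ), moment 1 x
  set I₂ := ∫ x in Set.Ioi (0 : ℝ), Real.exp (-3 * x ^ 2)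
  set I₃ := ∫ x in Set.Ioi (0 : ℝ), x * Real.exp (-3 * x ^ 2)
  set I₄ := ∫ x in Set.Ioi (0 : ℝ), Real.exp (-(1 / 12) * x ^ 2)
  refine ⟨I₁, d₁ / 2, I₂ / 2, fun b₁ hb₁ b₂ hb₂ => ?_⟩
  set β₂ := (b₂ ^ 2 - b₂ + 1 / 6) / 2 with hβ₂
  set β₃ := b₂ ^ 3 - 3 / 2 * b₂ ^ 2 + b₂ / 2 with hβ₃
  set γ := (b₁ ^ 3 - 3 / 2 * b₁ ^ 2 + b₁ / 2) / 6 with hγ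
  refine ⟨-γ * d₂ + β₂ * (b₁ - 1 / 2) + β₃ * I₃, ?_⟩
  suffices hb : ∃ K, ∀ s ∈ Set.Ioc (0 : ℝ) 1,
      |(∑' n₁ : ℕ, ∑' n₂ : ℕ, (n₂ + b₂) * Real.exp (-(s ^ 2 * Qf (n₁ + b₁) (n₂ + b₂))))
        - (s⁻¹ ^ 3 * I₁ - s⁻¹ ^ 2 * (b₁ - 1 / 2) * moment 1 0
          - s⁻¹ * ((b₁ ^ 2 - b₁ + 1 / 6) * (d₁ / 2) + (b₂ ^ 2 - b₂ + 1 / 6) * (I₂ / 2)))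
        - (-γ * d₂ + β₂ * (b₁ - 1 / 2) + β₃ * I₃)| ≤ K * s by
    obtain ⟨K, hK⟩ := hb
    rw [tendsto_iff_norm_sub_tendsto_zero]
    have hlim : Tendsto (fun s : ℝ => K * s) (𝓝[>] 0) (𝓝 0) := by
      have : Tendsto (fun s : ℝ => K * s) (𝓝 0) (𝓝 (K * 0)) :=
        (continuous_const.mul continuous_id).tendsto 0
      rw [mul_zero] at this
      exact this.mono_left nhdsWithin_le_nhds
    refine squeeze_zero' (Eventually.of_forall fun s => norm_nonneg _) ?_ hlim
    filter_upwards [Ioc_mem_nhdsGT (zero_lt_one (α := ℝ))] with s hs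
    exact hK s hs
  refine ⟨C₁ + |β₂| * C₂ + |β₃| * C₃ + C₀ * (I₄ + 1 + |C₄|), fun s hs => ?_⟩
  have s0 := hs.1
  obtain ⟨S₁, e₁⟩ := h₁ b₁ hb₁ s s0
  have e₂ := h₂ b₁ hb₁ s hs
  have S₂ := (h₂' b₁ hb₁ s s0).1
  have e₃ := h₃ b₁ hb₁ s hs
  have S₃ := (h₃' b₁ hb₁ s s0).1
  have e₄ := h₄ b₁ hb₁ s hs
  have S₄ := (h₄' b₁ hb₁ s s0).1
  set T₁ := ∑' n : ℕ, moment 1 (s * (n + b₁))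
  set T₂ := ∑' n : ℕ, Real.exp (-3 * (s * (n + b₁)) ^ 2)
  set T₃ := ∑' n : ℕ, s * (n + b₁) * Real.exp (-3 * (s * (n + b₁)) ^ 2)
  set T₄ := ∑' n : ℕ, Real.exp (-(1 / 12) * (s * (n + b₁)) ^ 2)
  let P : ℕ → ℝ := fun n => s⁻¹ * moment 1 (s * (n + b₁))
    - s * β₂ * Real.exp (-3 * (s * (n + b₁)) ^ 2)
    + s ^ 2 * β₃ * (s * (n + b₁) * Real.exp (-3 * (s * (n + b₁)) ^ 2))
  let Φ : ℕ → ℝ := fun n => ∑' m : ℕ, (s * (m + b₂)) * Real.exp (-Qf (s * (n + b₁)) (s * (m + b₂)))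
  have hr : ∀ n, ‖Φ n - P n‖ ≤ s ^ 3 * C₀ * Real.exp (-(1 / 12) * (s * (n + b₁)) ^ 2) := fun n =>
    (inner b₂ hb₂ s s0 (s * (n + b₁))).trans_eq (by ring)
  have SP : HasSum P (s⁻¹ * T₁ - s * β₂ * T₂ + s ^ 2 * β₃ * T₃) :=
    ((S₁.hasSum.mul_left _).sub (S₂.hasSum.mul_left _)).add (S₃.hasSum.mul_left _)
  have Sr : Summable fun n => Φ n - P n := Summable.of_norm_bounded (S₄.mul_left _) hr
  have hR : ‖∑' n, (Φ n - P n)‖ ≤ s ^ 3 * C₀ * T₄ :=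
    tsum_of_norm_bounded (S₄.hasSum.mul_left _) hr
  set R := ∑' n, (Φ n - P n)
  have hΦ : ∑' n, Φ n = R + (s⁻¹ * T₁ - s * β₂ * T₂ + s ^ 2 * β₃ * T₃) := by
    rw [← SP.tsum_eq, ← Sr.tsum_add SP.summable]
    simp
  have hsum : ∑' n₁ : ℕ, ∑' n₂ : ℕ, (n₂ + b₂) * Real.exp (-(s ^ 2 * Qf (n₁ + b₁) (n₂ + b₂)))
      = s⁻¹ * ∑' n, Φ n := by
    rw [← tsum_mul_left]
    refine tsum_congr fun n => ?_
    rw [← tsum_mul_left]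
    refine tsum_congr fun m => ?_
    rw [show Qf (s * (n + b₁)) (s * (m + b₂)) = s ^ 2 * Qf (n + b₁) (m + b₂) by unfold Qf; ring]
    field_simp
  rw [hsum, hΦ]
  have hT₄ : s * T₄ ≤ I₄ + 1 + |C₄| := by
    have hI : s * (s⁻¹ * I₄) = I₄ := by field_simp
    have h5 := (abs_le.1 e₄).2
    have h6 : T₄ ≤ s⁻¹ * I₄ + 1 + s * |C₄| := by
      have : s * C₄ ≤ s * |C₄| := mul_le_mul_of_nonneg_left (le_abs_self _) s0.le
      have : -(b₁ - 1 / 2) * Real.exp (-(1 / 12) * 0 ^ 2) ≤ 1 := by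
        norm_num; linarith [hb₁.1]
      linarith
    calc s * T₄ ≤ s * (s⁻¹ * I₄ + 1 + s * |C₄|) := mul_le_mul_of_nonneg_left h6 s0.le
      _ = I₄ + s + s * s * |C₄| := by rw [mul_add, mul_add, hI]; ring
      _ ≤ I₄ + 1 + |C₄| := by
        have : s * s * |C₄| ≤ 1 * |C₄| :=
          mul_le_mul_of_nonneg_right (by nlinarith [hs.2]) (abs_nonneg _)
        linarith [hs.2]
  have f₁ : |s⁻¹ ^ 2 * (T₁ - (s⁻¹ * I₁ - (b₁ - 1 / 2) * moment 1 0
      - s * ((b₁ ^ 2 - b₁ + 1 / 6) / 2 * d₁) - s ^ 2 * (γ * d₂)))| ≤ C₁ * s := by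
    rw [abs_mul, abs_of_pos (by positivity)]
    calc _ ≤ s⁻¹ ^ 2 * (s ^ 3 * C₁) := mul_le_mul_of_nonneg_left e₁ (by positivity)
      _ = _ := by field_simp
  have f₂ : |β₂ * (T₂ - (s⁻¹ * I₂ - (b₁ - 1 / 2)))| ≤ |β₂| * C₂ * s := by
    rw [abs_mul, mul_assoc]
    refine mul_le_mul_of_nonneg_left ?_ (abs_nonneg _)
    simpa [mul_comm] using e₂
  have f₃ : |s * β₃ * (T₃ - s⁻¹ * I₃)| ≤ |β₃| * C₃ * s := by
    have h7 : |T₃ - s⁻¹ * I₃| ≤ s * C₃ := by simpa using e₃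
    have h8 : s * C₃ ≤ C₃ := by nlinarith [abs_nonneg (T₃ - s⁻¹ * I₃), hs.2]
    rw [abs_mul, abs_mul, abs_of_pos s0]
    calc _ ≤ s * |β₃| * C₃ := mul_le_mul_of_nonneg_left (h7.trans h8) (by positivity)
      _ = _ := by ring
  have f₄ : |s⁻¹ * R| ≤ C₀ * (I₄ + 1 + |C₄|) * s := by
    rw [abs_mul, abs_of_pos (inv_pos.2 s0)]
    calc _ ≤ s⁻¹ * (s ^ 3 * C₀ * T₄) := mul_le_mul_of_nonneg_left hR (inv_pos.2 s0).le
      _ = C₀ * (s * T₄) * s := by field_simp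
      _ ≤ _ := by
        have := mul_le_mul_of_nonneg_left hT₄ hC₀
        exact mul_le_mul_of_nonneg_right this s0.le
  have hid : s⁻¹ * (R + (s⁻¹ * T₁ - s * β₂ * T₂ + s ^ 2 * β₃ * T₃))
      - (s⁻¹ ^ 3 * I₁ - s⁻¹ ^ 2 * (b₁ - 1 / 2) * moment 1 0
          - s⁻¹ * ((b₁ ^ 2 - b₁ + 1 / 6) * (d₁ / 2) + (b₂ ^ 2 - b₂ + 1 / 6) * (I₂ / 2)))
        - (-γ * d₂ + β₂ * (b₁ - 1 / 2) + β₃ * I₃)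
      = s⁻¹ ^ 2 * (T₁ - (s⁻¹ * I₁ - (b₁ - 1 / 2) * moment 1 0
      - s * ((b₁ ^ 2 - b₁ + 1 / 6) / 2 * d₁) - s ^ 2 * (γ * d₂)))
      - β₂ * (T₂ - (s⁻¹ * I₂ - (b₁ - 1 / 2))) + s * β₃ * (T₃ - s⁻¹ * I₃) + s⁻¹ * R := by
    rw [hβ₂]
    field_simp
    ring
  rw [hid]
  rw [abs_le] at *
  constructor <;> linarith [f₁.1, f₁.2, f₂.1, f₂.2, f₃.1, f₃.2, f₄.1, f₄.2]

/-- The asymptotic expansion of one-dimensional partial theta sums as the step tends to `0`. -/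
lemma partial_theta_tendsto {b : ℝ} (hb : b ∈ Set.Icc (0 : ℝ) 1) :
    ∃ L, Tendsto (fun s : ℝ => (∑' n : ℕ, (n + b) * Real.exp (-(s ^ 2 * (n + b) ^ 2)))
      - s⁻¹ ^ 2 * moment 1 0) (𝓝[>] 0) (𝓝 L) := by
  obtain ⟨d₁, d₂, C, h⟩ := euler_maclaurin_of_submodule (gaussSpace 1) (gaussSpace_hasDerivAt 1)
    (gaussSpace_integrableOn (by norm_num)) (pow_mul_gauss_mem 1 1)
  have hI : ∫ x in Set.Ioi (0 : ℝ), x ^ 1 * Real.exp (-1 * x ^ 2) = moment 1 0 := by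
    unfold moment Qf; congr 1; ext x; ring_nf
  rw [hI] at h
  set β := (b ^ 2 - b + 1 / 6) / 2
  set γ := (b ^ 3 - 3 / 2 * b ^ 2 + b / 2) / 6
  refine ⟨-β * d₁, ?_⟩
  rw [tendsto_iff_norm_sub_tendsto_zero]
  have hlim : Tendsto (fun s : ℝ => s * |γ * d₂| + s ^ 2 * C) (𝓝[>] 0) (𝓝 0) := by
    have : Tendsto (fun s : ℝ => s * |γ * d₂| + s ^ 2 * C) (𝓝 0)
        (𝓝 (0 * |γ * d₂| + 0 ^ 2 * C)) := Continuous.tendsto (by fun_prop) 0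
    simp only [zero_mul, ne_eq, OfNat.ofNat_ne_zero, not_false_eq_true, zero_pow, add_zero] at this
    exact this.mono_left nhdsWithin_le_nhds
  refine squeeze_zero' (Eventually.of_forall fun s => norm_nonneg _) ?_ hlim
  filter_upwards [self_mem_nhdsWithin] with s hs
  have s0 : 0 < s := hs
  have e := (h b hb s s0).2
  have hT : ∑' n : ℕ, (n + b) * Real.exp (-(s ^ 2 * (n + b) ^ 2))
      = s⁻¹ * ∑' n : ℕ, (s * (n + b)) ^ 1 * Real.exp (-1 * (s * (n + b)) ^ 2) := by
    rw [← tsum_mul_left]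
    refine tsum_congr fun n => ?_
    rw [show -1 * (s * (n + b)) ^ 2 = -(s ^ 2 * (n + b) ^ 2) by ring]
    field_simp
  rw [hT]
  set T := ∑' n : ℕ, (s * (n + b)) ^ 1 * Real.exp (-1 * (s * (n + b)) ^ 2)
  have hid : s⁻¹ * T - s⁻¹ ^ 2 * moment 1 0 - -β * d₁
      = s⁻¹ * (T - (s⁻¹ * moment 1 0 - (b - 1 / 2) * (0 ^ 1 * Real.exp (-1 * 0 ^ 2))
        - s * (β * d₁) - s ^ 2 * (γ * d₂))) - s * (γ * d₂) := by
    field_simp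
    ring
  rw [hid]
  refine (norm_sub_le _ _).trans ?_
  rw [norm_mul, norm_mul, Real.norm_eq_abs, Real.norm_eq_abs, Real.norm_eq_abs,
    abs_of_pos (inv_pos.2 s0), abs_of_pos s0, Real.norm_eq_abs, add_comm]
  refine add_le_add le_rfl ((mul_le_mul_of_nonneg_left e (inv_pos.2 s0).le).trans_eq ?_)
  field_simp

lemma tsum_eq_sum_range_residues {f : ℕ → ℂ} (hf : Summable f) {N : ℕ} (hN : 0 < N) :
    ∑' n, f n = ∑ j ∈ Finset.range N, ∑' m, f (j + N * m) := by
  obtain ⟨M, rfl⟩ : ∃ M, N = M + 1 := ⟨N - 1, by omega⟩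
  rw [Nat.sumByResidueClasses hf (M + 1)]
  exact Fin.sum_univ_eq_sum_range (fun j => ∑' m, f (j + (M + 1) * m)) (M + 1)

lemma tsum_prod_eq_sum_range_residues {f : ℕ × ℕ → ℂ} (hf : Summable f) {N : ℕ} (hN : 0 < N) :
    ∑' n, f n = ∑ i ∈ Finset.range N, ∑ j ∈ Finset.range N,
      ∑' m, ∑' m', f (i + N * m, j + N * m') := by
  have hinj : ∀ j : ℕ, Function.Injective fun m : ℕ => j + N * m := fun j m m' h =>
    Nat.eq_of_mul_eq_mul_left hN (Nat.add_left_cancel h)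
  rw [hf.tsum_prod, tsum_eq_sum_range_residues hf.prod hN]
  refine Finset.sum_congr rfl fun i _ => ?_
  rw [← Summable.tsum_finsetSum]
  · exact tsum_congr fun m => tsum_eq_sum_range_residues (hf.prod_factor _) hN
  · intro j _
    exact (hf.comp_injective ((hinj i).prodMap (hinj j))).prod

lemma sum_range_shift_of_periodic {f : ℤ → ℂ} {N : ℕ} (hf : ∀ x, f (x + N) = f x) (j : ℤ) :
    ∑ l ∈ Finset.range N, f (l + j) = ∑ l ∈ Finset.range N, f l := by
  have step : ∀ j : ℤ, ∑ l ∈ Finset.range N, f (l + (j + 1)) = ∑ l ∈ Finset.range N, f (l + j) := by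
    intro j
    have h1 := Finset.sum_range_succ (fun l : ℕ => f (l + j)) N
    have h2 := Finset.sum_range_succ' (fun l : ℕ => f (l + j)) N
    rw [h1] at h2
    have e : f ((N : ℤ) + j) = f (((0 : ℕ) : ℤ) + j) := by
      rw [add_comm, hf]; simp
    rw [e] at h2
    rw [add_right_cancel h2]
    refine Finset.sum_congr rfl fun l _ => ?_
    push_cast
    ring_nf
  induction j using Int.induction_on with
  | zero => simp
  | succ n ih => rw [step, ih]
  | pred n ih => rw [← ih, ← step, sub_add_cancel]

/-- The root of unity `exp (2πi (h/k) Q(a/p, b/p))`. -/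
def rootQ (p : ℕ) (h : ℤ) (k : ℕ) (a b : ℤ) : ℂ :=
  Complex.exp (2 * Real.pi * Complex.I * ((h : ℂ) / k) * (Qf (a / p) (b / p) : ℝ))

section finiteSums

variable {p : ℕ} {h : ℤ} {k : ℕ}

lemma rootQ_add_mul (hp : 0 < p) (hk : 0 < k) (a b u v : ℤ) :
    rootQ p h k (a + k * p ^ 2 * u) (b + k * p ^ 2 * v) = rootQ p h k a b := by
  unfold rootQ
  rw [Complex.exp_eq_exp_iff_exists_int]
  refine ⟨h * (6 * a * u + 3 * k * p ^ 2 * u ^ 2 + 3 * (a * v + b * u + k * p ^ 2 * u * v)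
    + 2 * b * v + k * p ^ 2 * v ^ 2), ?_⟩
  have hp' : (p : ℂ) ≠ 0 := by exact_mod_cast hp.ne'
  have hk' : (k : ℂ) ≠ 0 := by exact_mod_cast hk.ne'
  unfold Qf
  push_cast
  field_simp
  ring

lemma rootQ_neg (a b : ℤ) : rootQ p h k (-a) (-b) = rootQ p h k a b := by
  unfold rootQ Qf
  push_cast
  ring_nf

lemma rootQ_reflect (a b : ℤ) : rootQ p h k (-a) (b + 3 * a) = rootQ p h k a b := by
  unfold rootQ Qf
  push_cast
  ring_nf

/-- The Gauss sum over one coset of the second variable. -/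
def cosetSum (p : ℕ) (h : ℤ) (k : ℕ) (a b : ℤ) : ℂ :=
  ∑ l ∈ Finset.range (k * p), rootQ p h k a (b + p * l)

lemma cosetSum_add_left (hp : 0 < p) (hk : 0 < k) (a b u : ℤ) :
    cosetSum p h k (a + k * p ^ 2 * u) b = cosetSum p h k a b := by
  unfold cosetSum
  refine Finset.sum_congr rfl fun l _ => ?_
  simpa using rootQ_add_mul hp hk a (b + p * l) u 0

lemma cosetSum_add_right (hp : 0 < p) (hk : 0 < k) (a b j : ℤ) :
    cosetSum p h k a (b + p * j) = cosetSum p h k a b := by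
  unfold cosetSum
  rw [← sum_range_shift_of_periodic (f := fun l => rootQ p h k a (b + p * l)) (fun x => ?_) j]
  · refine Finset.sum_congr rfl fun l _ => ?_
    ring_nf
  · have := rootQ_add_mul (h := h) hp hk a (b + p * x) 0 1
    push_cast
    rw [← this]
    ring_nf

lemma cosetSum_reflect (a b : ℤ) : cosetSum p h k (-a) (b + 3 * a) = cosetSum p h k a b := by
  unfold cosetSum
  refine Finset.sum_congr rfl fun l _ => ?_
  rw [← rootQ_reflect a]
  ring_nf

lemma cosetSum_neg (hp : 0 < p) (hk : 0 < k) (a b : ℤ) :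
    cosetSum p h k (-a) (-b) = cosetSum p h k a b := by
  have : cosetSum p h k (-a) (-b) = cosetSum p h k (-a) (-b + p * (1 - (k * p : ℕ))) :=
    (cosetSum_add_right hp hk _ _ _).symm
  rw [this]
  unfold cosetSum
  rw [← Finset.sum_range_reflect]
  refine Finset.sum_congr rfl fun l hl => ?_
  have hl := Finset.mem_range.1 hl
  rw [← rootQ_neg a]
  congr 1
  rw [Nat.sub_sub, Nat.cast_sub (by omega)]
  push_cast
  ring

/-- The contributions of `α` and `1 - α` combine. -/
lemma sum_rootQ_mul_sub (hp : 0 < p) (hk : 0 < k) {w : ℝ → ℝ → ℂ} {κ : ℂ}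
    (hw : ∀ x y, w x y - w (1 - x) (1 - y) = -2 * κ * (x - 1 / 2 : ℝ)) (a b : ℤ) :
    (∑ i ∈ Finset.range (k * p), ∑ j ∈ Finset.range (k * p), rootQ p h k (a + p * i) (b + p * j)
        * w ((a / p + i) / (k * p : ℕ)) ((b / p + j) / (k * p : ℕ)))
      - (∑ i ∈ Finset.range (k * p), ∑ j ∈ Finset.range (k * p),
        rootQ p h k ((p - a) + p * i) ((p - b) + p * j)
        * w (((p - a : ℤ) / p + i) / (k * p : ℕ)) (((p - b : ℤ) / p + j) / (k * p : ℕ)))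
      = -2 * κ * ∑ i ∈ Finset.range (k * p),
        (((a / p + i) / (k * p : ℕ) - 1 / 2 : ℝ) : ℂ) * cosetSum p h k (a + p * i) b := by
  have hp' : (p : ℝ) ≠ 0 := by exact_mod_cast hp.ne'
  have hk' : (k : ℝ) ≠ 0 := by exact_mod_cast hk.ne'
  have harg : ∀ (c : ℤ) (i : ℕ), i < k * p →
      (((p - c : ℤ) : ℝ) / p + (k * p - 1 - i : ℕ)) / (k * p : ℕ)
        = 1 - (c / p + i) / (k * p : ℕ) := by
    intro c i hi
    rw [Nat.sub_sub, Nat.cast_sub (by omega)]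
    push_cast
    field_simp
    ring
  have hnum : ∀ (c : ℤ) (i : ℕ), i < k * p →
      (p - c : ℤ) + p * (k * p - 1 - i : ℕ) = -(c + p * i) + k * p ^ 2 * 1 := by
    intro c i hi
    rw [Nat.sub_sub, Nat.cast_sub (by omega)]
    push_cast
    ring
  have hrefl : (∑ i ∈ Finset.range (k * p), ∑ j ∈ Finset.range (k * p),
        rootQ p h k ((p - a) + p * i) ((p - b) + p * j)
        * w (((p - a : ℤ) / p + i) / (k * p : ℕ)) (((p - b : ℤ) / p + j) / (k * p : ℕ)))
      = ∑ i ∈ Finset.range (k * p), ∑ j ∈ Finset.range (k * p),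
        rootQ p h k (a + p * i) (b + p * j)
        * w (1 - (a / p + i) / (k * p : ℕ)) (1 - (b / p + j) / (k * p : ℕ)) := by
    rw [← Finset.sum_range_reflect]
    refine Finset.sum_congr rfl fun i hi => ?_
    have hi := Finset.mem_range.1 hi
    rw [← Finset.sum_range_reflect]
    refine Finset.sum_congr rfl fun j hj => ?_
    have hj := Finset.mem_range.1 hj
    rw [harg a i hi, harg b j hj, hnum a i hi, hnum b j hj, rootQ_add_mul hp hk, rootQ_neg]
  rw [hrefl, ← Finset.sum_sub_distrib, Finset.mul_sum]
  refine Finset.sum_congr rfl fun i _ => ?_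
  rw [← Finset.sum_sub_distrib, cosetSum, Finset.mul_sum, Finset.mul_sum]
  refine Finset.sum_congr rfl fun j _ => ?_
  rw [← mul_sub, hw]
  ring

lemma sum_cosetSum_add_sum_cosetSum (hp : 0 < p) (hk : 0 < k) :
    ∑ i ∈ Finset.range (k * p), (((((p - 1 : ℤ) : ℝ) / p + i) / (k * p : ℕ) - 1 / 2 : ℝ) : ℂ)
        * cosetSum p h k ((p - 1) + p * i) 2
      + ∑ i ∈ Finset.range (k * p), (((((1 : ℤ) : ℝ) / p + i) / (k * p : ℕ) - 1 / 2 : ℝ) : ℂ)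
        * cosetSum p h k (1 + p * i) (p - 1) = 0 := by
  have hp' : (p : ℝ) ≠ 0 := by exact_mod_cast hp.ne'
  have hk' : (k : ℝ) ≠ 0 := by exact_mod_cast hk.ne'
  rw [← Finset.sum_range_reflect, ← Finset.sum_add_distrib]
  refine Finset.sum_eq_zero fun i hi => ?_
  have hi := Finset.mem_range.1 hi
  have e1 : ((p : ℤ) - 1) + p * (k * p - 1 - i : ℕ) = -(1 + p * i) + k * p ^ 2 * 1 := by
    rw [Nat.sub_sub, Nat.cast_sub (by omega)]
    push_cast
    ring
  have e2 : cosetSum p h k (-(1 + p * i)) 2 = cosetSum p h k (1 + p * i) (p - 1) := by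
    rw [← cosetSum_reflect (1 + p * i), ← cosetSum_add_right hp hk _ 2 (1 + 3 * i)]
    ring_nf
  have e3 : ((p - 1 : ℤ) : ℝ) / p + (k * p - 1 - i : ℕ) = (k * p : ℕ) - (((1 : ℤ) : ℝ) / p + i) := by
    rw [Nat.sub_sub, Nat.cast_sub (by omega)]
    push_cast
    field_simp
    ring
  have hN : ((k * p : ℕ) : ℝ) ≠ 0 := by push_cast; positivity
  rw [e1, cosetSum_add_left hp hk, e2, e3, sub_div, div_self hN, ← add_mul, ← Complex.ofReal_add]
  ring_nf
  simp

lemma sum_cosetSum_self (hp : 0 < p) (hk : 0 < k) :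
    ∑ i ∈ Finset.range (k * p), (((((0 : ℤ) : ℝ) / p + i) / (k * p : ℕ) - 1 / 2 : ℝ) : ℂ)
        * cosetSum p h k (0 + p * i) (p - 1) = -(1 / 2) * cosetSum p h k 0 (p - 1) := by
  have hN : 0 < k * p := Nat.mul_pos hk hp
  have hpN : ((k * p : ℕ) : ℤ) * p = k * p ^ 2 * 1 := by push_cast; ring
  generalize hM : k * p = N at *
  obtain ⟨M, rfl⟩ : ∃ M, N = M + 1 := ⟨N - 1, by omega⟩
  have hN' : ((M + 1 : ℕ) : ℝ) ≠ 0 := by positivity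
  rw [Finset.sum_range_succ']
  set S := ∑ i ∈ Finset.range M, (((((0 : ℤ) : ℝ) / p + (i + 1 : ℕ)) / (M + 1 : ℕ) - 1 / 2 : ℝ) : ℂ)
        * cosetSum p h k (0 + p * (i + 1 : ℕ)) (p - 1) with hS
  have hneg : S = -S := by
    conv_lhs => rw [hS, ← Finset.sum_range_reflect]
    rw [hS, ← Finset.sum_neg_distrib]
    refine Finset.sum_congr rfl fun i hi => ?_
    have hi := Finset.mem_range.1 hi
    have e0 : M - 1 - i + 1 = M - i := by omega
    have e1 : (0 : ℤ) + p * (M - i : ℕ) = -(0 + p * (i + 1 : ℕ)) + k * p ^ 2 * 1 := by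
      rw [← hpN, Nat.cast_sub (by omega)]
      push_cast
      ring
    have e2 : cosetSum p h k (-(0 + p * (i + 1 : ℕ))) (p - 1)
        = cosetSum p h k (0 + p * (i + 1 : ℕ)) (p - 1) := by
      rw [← cosetSum_reflect (0 + p * (i + 1 : ℕ)),
        ← cosetSum_add_right hp hk _ ((p : ℤ) - 1) (3 * (i + 1 : ℕ))]
      ring_nf
    have e3 : (((0 : ℤ) : ℝ) / p + (M - i : ℕ)) / (M + 1 : ℕ) - 1 / 2
        = -((((0 : ℤ) : ℝ) / p + (i + 1 : ℕ)) / (M + 1 : ℕ) - 1 / 2) := by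
      rw [Nat.cast_sub (by omega)]
      field_simp
      push_cast
      ring
    rw [e0, e1, cosetSum_add_left hp hk, e2, e3]
    push_cast
    ring
  have hS0 : S = 0 := self_eq_neg.1 hneg
  rw [hS0]
  simp

end finiteSums

section decomposition

variable {p : ℕ} {h : ℤ} {k : ℕ}

lemma summable_pow_mul_gauss {t : ℝ} (ht : 0 < t) {x : ℝ} (hx : x ∈ Set.Icc (0 : ℝ) 1) (n : ℕ) :
    Summable fun m : ℕ => (x + m) ^ n * Real.exp (-t * (x + m) ^ 2) := by
  obtain ⟨_, _, _, H⟩ := euler_maclaurin_of_submodule (gaussSpace t) (gaussSpace_hasDerivAt t)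
    (gaussSpace_integrableOn ht) (pow_mul_gauss_mem t n)
  have := (H x hx 1 one_pos).1
  simpa only [one_mul, add_comm] using this

lemma norm_ofReal_mul_cexp {y : ℝ} (hy : 0 ≤ y) (z : ℂ) (r : ℝ) :
    ‖(y : ℂ) * Complex.exp (z * (r : ℂ))‖ = y * Real.exp (z.re * r) := by
  rw [norm_mul, Complex.norm_exp, Complex.norm_real, Real.norm_of_nonneg hy,
    Complex.re_mul_ofReal]

lemma summable_quadrant {x y : ℝ} (hx : x ∈ Set.Icc (0 : ℝ) 1) (hy : y ∈ Set.Icc (0 : ℝ) 1)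
    {z : ℂ} (hz : z.re < 0) :
    Summable fun n : ℕ × ℕ => ((y + n.2 : ℝ) : ℂ) *
      Complex.exp (z * (Qf (x + n.1) (y + n.2) : ℝ)) := by
  have ht : 0 < -z.re := by linarith
  refine Summable.of_norm_bounded ((summable_pow_mul_gauss ht hx 0).mul_of_nonneg
    (summable_pow_mul_gauss ht hy 1) (fun m => ?_) (fun m => ?_)) fun n => ?_
  · positivity
  · have := hy.1
    simp only [Pi.zero_apply]
    positivity
  · have hx0 : 0 ≤ x + n.1 := add_nonneg hx.1 n.1.cast_nonneg
    have hy0 : 0 ≤ y + n.2 := add_nonneg hy.1 n.2.cast_nonneg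
    rw [norm_ofReal_mul_cexp hy0, pow_zero, one_mul, pow_one, mul_left_comm, ← Real.exp_add]
    refine mul_le_mul_of_nonneg_left (Real.exp_le_exp.2 ?_) hy0
    unfold Qf
    nlinarith [mul_nonneg ht.le (mul_nonneg hx0 hy0), mul_nonneg ht.le (sq_nonneg (x + n.1))]

lemma summable_theta {y : ℝ} (hy : y ∈ Set.Icc (0 : ℝ) 1) {z : ℂ} (hz : z.re < 0) :
    Summable fun n : ℕ => ((y + n : ℝ) : ℂ) * Complex.exp (z * (((y + n) ^ 2 : ℝ) : ℂ)) := by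
  refine Summable.of_norm_bounded (summable_pow_mul_gauss (neg_pos.2 hz) hy 1) fun n => ?_
  rw [norm_ofReal_mul_cexp (add_nonneg hy.1 n.cast_nonneg), pow_one, neg_neg]

lemma mul_cexp_Qf_eq (hp : 0 < p) (hk : 0 < k) {t : ℝ} (ht : 0 < t) (a b : ℤ) (i j m m' : ℕ) :
    ((b / p + (j + k * p * m' : ℕ) : ℝ) : ℂ) *
      Complex.exp ((2 * Real.pi * Complex.I * ((h : ℂ) / k) - t) *
        (Qf (a / p + (i + k * p * m : ℕ)) (b / p + (j + k * p * m' : ℕ)) : ℝ))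
      = (k * p : ℕ) * (rootQ p h k (a + p * i) (b + p * j) *
        (((m' + (b / p + j) / (k * p : ℕ)) * Real.exp (-(((k * p : ℕ) * √t) ^ 2 *
          Qf (m + (a / p + i) / (k * p : ℕ)) (m' + (b / p + j) / (k * p : ℕ)))) : ℝ) : ℂ)) := by
  have hp' : (p : ℝ) ≠ 0 := by exact_mod_cast hp.ne'
  have hk' : (k : ℝ) ≠ 0 := by exact_mod_cast hk.ne'
  have e1 : ∀ (c : ℤ) (l n : ℕ), (c / p + (l + k * p * n : ℕ) : ℝ)
      = (k * p : ℕ) * (n + (c / p + l) / (k * p : ℕ)) := by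
    intro c l n
    push_cast
    field_simp
    ring
  have e2 : ∀ (c : ℤ) (l n : ℕ), (c / p + (l + k * p * n : ℕ) : ℝ)
      = ((c + p * l + k * p ^ 2 * n : ℤ) : ℝ) / p := by
    intro c l n
    push_cast
    field_simp
    ring
  have e3 : ∀ N x y : ℝ, Qf (N * x) (N * y) = N ^ 2 * Qf x y := by
    intro N x y; unfold Qf; ring
  rw [← rootQ_add_mul hp hk _ _ (m : ℤ) (m' : ℤ), rootQ, ← e2, ← e2, sub_mul, sub_eq_add_neg,
    Complex.exp_add, mul_pow, Real.sq_sqrt ht.le, Complex.ofReal_mul _ (Real.exp _),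
    Complex.ofReal_exp]
  have e4 : ((-(((k * p : ℕ) : ℝ) ^ 2 * t * Qf (m + (a / p + i) / (k * p : ℕ))
      (m' + (b / p + j) / (k * p : ℕ))) : ℝ) : ℂ)
      = -(t * (Qf (a / p + (i + k * p * m : ℕ)) (b / p + (j + k * p * m' : ℕ)) : ℝ)) := by
    rw [e1, e1, e3]
    push_cast
    ring
  rw [e4]
  have e5 : ((b / p + (j + k * p * m' : ℕ) : ℝ) : ℂ)
      = (k * p : ℕ) * ((m' + (b / p + j) / (k * p : ℕ) : ℝ) : ℂ) := by
    rw [e1, Complex.ofReal_mul, Complex.ofReal_natCast]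
  rw [e5]
  ring

lemma re_two_pi_I_mul_sub (h : ℤ) (k : ℕ) (t : ℝ) :
    (2 * Real.pi * Complex.I * ((h : ℂ) / k) - t).re = -t := by
  have : (2 * Real.pi * Complex.I * ((h : ℂ) / k) : ℂ)
      = ((2 * Real.pi * (h / k) : ℝ) : ℂ) * Complex.I := by push_cast; ring
  rw [this, Complex.sub_re, Complex.re_ofReal_mul, Complex.I_re, mul_zero, Complex.ofReal_re,
    zero_sub]

lemma div_mem_Icc {a : ℤ} (ha : 0 ≤ a) (hap : a ≤ p) : (a / p : ℝ) ∈ Set.Icc (0 : ℝ) 1 := by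
  have h1 : (0 : ℝ) ≤ a := by exact_mod_cast ha
  have h2 : (a : ℝ) ≤ p := by exact_mod_cast hap
  exact ⟨by positivity, div_le_one_of_le₀ h2 (Nat.cast_nonneg p)⟩

lemma div_add_div_mem_Icc {x : ℝ} (hx : x ∈ Set.Icc (0 : ℝ) 1) {N i : ℕ} (hi : i < N) :
    (x + i) / N ∈ Set.Icc (0 : ℝ) 1 := by
  have h1 : (i : ℝ) + 1 ≤ N := by exact_mod_cast hi
  have h2 : (0 : ℝ) ≤ i := i.cast_nonneg
  exact ⟨div_nonneg (by linarith [hx.1]) (by linarith),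
    div_le_one_of_le₀ (by linarith [hx.2]) (by linarith)⟩

lemma quadrant_eq_sum (hp : 0 < p) (hk : 0 < k) {a b : ℤ} (ha : 0 ≤ a) (hap : a ≤ p)
    (hb : 0 ≤ b) (hbp : b ≤ p) {t : ℝ} (ht : 0 < t) :
    ∑' n : ℕ × ℕ, ((b / p + n.2 : ℝ) : ℂ) *
      Complex.exp ((2 * Real.pi * Complex.I * ((h : ℂ) / k) - t) *
        (Qf (a / p + n.1) (b / p + n.2) : ℝ))
      = (k * p : ℕ) * ∑ i ∈ Finset.range (k * p), ∑ j ∈ Finset.range (k * p),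
        rootQ p h k (a + p * i) (b + p * j) *
        ((∑' n₁ : ℕ, ∑' n₂ : ℕ, (n₂ + (b / p + j) / (k * p : ℕ)) *
          Real.exp (-(((k * p : ℕ) * √t) ^ 2 *
            Qf (n₁ + (a / p + i) / (k * p : ℕ)) (n₂ + (b / p + j) / (k * p : ℕ)))) : ℝ) : ℂ) := by
  rw [tsum_prod_eq_sum_range_residues (summable_quadrant (div_mem_Icc ha hap)
    (div_mem_Icc hb hbp) (by rw [re_two_pi_I_mul_sub]; linarith)) (Nat.mul_pos hk hp)]
  rw [Finset.mul_sum]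
  refine Finset.sum_congr rfl fun i _ => ?_
  rw [Finset.mul_sum]
  refine Finset.sum_congr rfl fun j _ => ?_
  simp only [mul_cexp_Qf_eq hp hk ht, tsum_mul_left, Complex.ofReal_tsum]

lemma theta_eq_sum (hp : 0 < p) (hk : 0 < k) {b : ℤ}
    (hb : 0 ≤ b) (hbp : b ≤ p) {t : ℝ} (ht : 0 < t) :
    ∑' n : ℕ, ((b / p + n : ℝ) : ℂ) *
      Complex.exp ((2 * Real.pi * Complex.I * ((h : ℂ) / k) - t) * (((b / p + n) ^ 2 : ℝ) : ℂ))
      = (k * p : ℕ) * ∑ j ∈ Finset.range (k * p), rootQ p h k 0 (b + p * j) *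
        ((∑' n : ℕ, (n + (b / p + j) / (k * p : ℕ)) *
          Real.exp (-(((k * p : ℕ) * √t) ^ 2 * (n + (b / p + j) / (k * p : ℕ)) ^ 2)) : ℝ) : ℂ) := by
  rw [tsum_eq_sum_range_residues (summable_theta (div_mem_Icc hb hbp)
    (by rw [re_two_pi_I_mul_sub]; linarith)) (Nat.mul_pos hk hp)]
  rw [Finset.mul_sum]
  refine Finset.sum_congr rfl fun j _ => ?_
  have key := fun m' : ℕ => mul_cexp_Qf_eq (h := h) hp hk ht 0 b 0 j 0 m'
  have hQ : ∀ y : ℝ, Qf 0 y = y ^ 2 := by intro y; simp [Qf]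
  simp only [Int.cast_zero, zero_div, Nat.cast_zero, mul_zero, add_zero, hQ] at key
  simp only [key, tsum_mul_left, Complex.ofReal_tsum]

lemma tsum_int_eq (hp : 2 ≤ p) {t : ℝ} (ht : 0 < t) :
    ∑' m : ℤ, ((|(m : ℝ) + 1 / p| : ℝ) : ℂ) *
      Complex.exp ((2 * Real.pi * Complex.I * ((h : ℂ) / k) - t) *
        ((((m : ℝ) + 1 / p) ^ 2 : ℝ) : ℂ))
      = ∑' n : ℕ, ((((1 : ℤ) : ℝ) / p + n : ℝ) : ℂ) *
          Complex.exp ((2 * Real.pi * Complex.I * ((h : ℂ) / k) - t) *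
            (((((1 : ℤ) : ℝ) / p + n) ^ 2 : ℝ) : ℂ))
        + ∑' n : ℕ, ((((p - 1 : ℤ) : ℝ) / p + n : ℝ) : ℂ) *
          Complex.exp ((2 * Real.pi * Complex.I * ((h : ℂ) / k) - t) *
            (((((p - 1 : ℤ) : ℝ) / p + n) ^ 2 : ℝ) : ℂ)) := by
  have hp0 : (p : ℝ) ≠ 0 := by positivity
  have hz : (2 * Real.pi * Complex.I * ((h : ℂ) / k) - t).re < 0 := by
    rw [re_two_pi_I_mul_sub]; linarith
  have h1 := summable_theta (div_mem_Icc (p := p) (a := 1) (by omega) (by omega)) hz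
  have h2 := summable_theta (div_mem_Icc (p := p) (a := p - 1) (by omega) (by omega)) hz
  have e1 : ∀ n : ℕ, |((n : ℤ) : ℝ) + 1 / p| = ((1 : ℤ) : ℝ) / p + n := by
    intro n
    rw [Int.cast_natCast, abs_of_nonneg (by positivity)]
    push_cast
    ring
  have e2 : ∀ n : ℕ, ((-((n : ℤ) + 1) : ℤ) : ℝ) + 1 / p = -(((p - 1 : ℤ) : ℝ) / p + n) := by
    intro n
    push_cast
    field_simp
    ring
  have e3 : ∀ n : ℕ, |((-((n : ℤ) + 1) : ℤ) : ℝ) + 1 / p| = ((p - 1 : ℤ) : ℝ) / p + n := by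
    intro n
    rw [e2, abs_neg, abs_of_nonneg (add_nonneg (div_mem_Icc (by omega) (by omega)).1
      n.cast_nonneg)]
  rw [tsum_of_nat_of_neg_add_one]
  · congr 1
    · refine tsum_congr fun n => ?_
      rw [← sq_abs, e1]
    · refine tsum_congr fun n => ?_
      rw [e3, e2, neg_sq]
  · refine h1.congr fun n => ?_
    rw [← sq_abs (((n : ℤ) : ℝ) + 1 / p), e1]
  · refine h2.congr fun n => ?_
    rw [e3, e2, neg_sq]

/-- The terms of the expansion of the quadrant sums that are singular as `s → 0`. -/
def singularPart (A C D s x y : ℝ) : ℝ :=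
  s⁻¹ ^ 3 * A - s⁻¹ ^ 2 * (x - 1 / 2) * moment 1 0
    - s⁻¹ * ((x ^ 2 - x + 1 / 6) * C + (y ^ 2 - y + 1 / 6) * D)

lemma tendsto_nat_mul_sqrt {N : ℕ} (hN : 0 < N) :
    Tendsto (fun t : ℝ => N * √t) (𝓝[>] 0) (𝓝[>] 0) := by
  refine tendsto_nhdsWithin_iff.2 ⟨?_, ?_⟩
  · have : Tendsto (fun t : ℝ => N * √t) (𝓝 0) (𝓝 (N * √0)) :=
      Continuous.tendsto (by fun_prop) 0
    rw [Real.sqrt_zero, mul_zero] at this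
    exact this.mono_left nhdsWithin_le_nhds
  · filter_upwards [self_mem_nhdsWithin] with t ht
    have := Real.sqrt_pos.2 ht
    exact mul_pos (by exact_mod_cast hN) this

lemma quadrant_tendsto (hp : 0 < p) (hk : 0 < k) :
    ∃ A C D : ℝ, ∀ a b : ℤ, 0 ≤ a → a ≤ p → 0 ≤ b → b ≤ p → ∃ L : ℂ,
      Tendsto (fun t : ℝ => ∑' n : ℕ × ℕ, ((b / p + n.2 : ℝ) : ℂ) *
        Complex.exp ((2 * Real.pi * Complex.I * ((h : ℂ) / k) - t) *
          (Qf (a / p + n.1) (b / p + n.2) : ℝ))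
        - (k * p : ℕ) * ∑ i ∈ Finset.range (k * p), ∑ j ∈ Finset.range (k * p),
          rootQ p h k (a + p * i) (b + p * j) *
          (singularPart A C D ((k * p : ℕ) * √t)
            ((a / p + i) / (k * p : ℕ)) ((b / p + j) / (k * p : ℕ)) : ℂ)) (𝓝[>] 0) (𝓝 L) := by
  obtain ⟨A, C, D, H⟩ := quadrant_sum_tendsto
  refine ⟨A, C, D, fun a b ha hap hb hbp => ?_⟩
  choose! L hL using H
  have hN : 0 < k * p := Nat.mul_pos hk hp
  refine ⟨_, Tendsto.congr' ?_ ((tendsto_finsetSum (Finset.range (k * p)) fun i hi =>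
    tendsto_finsetSum (Finset.range (k * p)) fun j hj =>
      ((Complex.continuous_ofReal.tendsto _).comp
        ((hL _ (div_add_div_mem_Icc (div_mem_Icc ha hap) (Finset.mem_range.1 hi)) _
          (div_add_div_mem_Icc (div_mem_Icc hb hbp) (Finset.mem_range.1 hj))).comp
            (tendsto_nat_mul_sqrt hN))).const_mul
        (rootQ p h k (a + p * i) (b + p * j))).const_mul ((k * p : ℕ) : ℂ))⟩
  filter_upwards [self_mem_nhdsWithin] with t ht
  rw [quadrant_eq_sum hp hk ha hap hb hbp ht, ← mul_sub, ← Finset.sum_sub_distrib]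
  congr 1
  refine Finset.sum_congr rfl fun i _ => ?_
  rw [← Finset.sum_sub_distrib]
  refine Finset.sum_congr rfl fun j _ => ?_
  rw [← mul_sub, ← Complex.ofReal_sub]
  rfl

lemma theta_tendsto (hp : 0 < p) (hk : 0 < k) {b : ℤ} (hb : 0 ≤ b) (hbp : b ≤ p) :
    ∃ L : ℂ, Tendsto (fun t : ℝ => ∑' n : ℕ, ((b / p + n : ℝ) : ℂ) *
        Complex.exp ((2 * Real.pi * Complex.I * ((h : ℂ) / k) - t) * (((b / p + n) ^ 2 : ℝ) : ℂ))
      - (k * p : ℕ) * ((((((k * p : ℕ) : ℝ) * √t)⁻¹ ^ 2 * moment 1 0 : ℝ) : ℂ)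
        * cosetSum p h k 0 b)) (𝓝[>] 0) (𝓝 L) := by
  have H := fun c hc => partial_theta_tendsto (b := c) hc
  choose! L hL using H
  have hN : 0 < k * p := Nat.mul_pos hk hp
  refine ⟨_, Tendsto.congr' ?_ ((tendsto_finsetSum (Finset.range (k * p)) fun j hj =>
      ((Complex.continuous_ofReal.tendsto _).comp
        ((hL _ (div_add_div_mem_Icc (div_mem_Icc hb hbp) (Finset.mem_range.1 hj))).comp
            (tendsto_nat_mul_sqrt hN))).const_mul
        (rootQ p h k 0 (b + p * j))).const_mul ((k * p : ℕ) : ℂ))⟩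
  filter_upwards [self_mem_nhdsWithin] with t ht
  rw [theta_eq_sum hp hk hb hbp ht, ← mul_sub]
  congr 1
  rw [cosetSum, Finset.mul_sum, ← Finset.sum_sub_distrib]
  refine Finset.sum_congr rfl fun j _ => ?_
  rw [mul_comm _ (rootQ _ _ _ _ _), ← mul_sub, ← Complex.ofReal_sub]
  rfl

end decomposition

/-- For `p ≥ 2` and `h/k` in lowest terms, the radial limit
`lim_{t→0⁺} F₂(e^{2πi h/k − t})` exists. -/
theorem Ftwo_radial_limit_exists (p : ℕ) (hp : 2 ≤ p) (h : ℤ) (k : ℕ) (hk : 0 < k)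
    (hhk : Int.gcd h k = 1) :
    ∃ L : ℂ, Tendsto (fun t : ℝ => FtwoZ p (2 * Real.pi * Complex.I * ((h : ℂ) / k) - t))
      (𝓝[>] (0 : ℝ)) (𝓝 L) := by
  have hp0 : 0 < p := by omega
  have hpR : (p : ℝ) ≠ 0 := by positivity
  obtain ⟨A, C, D, H⟩ := quadrant_tendsto (h := h) hp0 hk
  obtain ⟨L₀, h₀⟩ := H (p - 1) 2 (by omega) (by omega) (by omega) (by omega)
  obtain ⟨L₁, h₁⟩ := H (p - (p - 1)) (p - 2) (by omega) (by omega) (by omega) (by omega)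
  obtain ⟨L₂, h₂⟩ := H (p - 0) (p - (p - 1)) (by omega) (by omega) (by omega) (by omega)
  obtain ⟨L₃, h₃⟩ := H 0 (p - 1) (by omega) (by omega) (by omega) (by omega)
  obtain ⟨L₄, h₄⟩ := H 1 (p - 1) (by omega) (by omega) (by omega) (by omega)
  obtain ⟨L₅, h₅⟩ := H (p - 1) (p - (p - 1)) (by omega) (by omega) (by omega) (by omega)
  obtain ⟨M₁, g₁⟩ := theta_tendsto (h := h) hp0 hk (b := 1) (by omega) (by omega)
  obtain ⟨M₂, g₂⟩ := theta_tendsto (h := h) hp0 hk (b := p - 1) (by omega) (by omega)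
  refine ⟨_, Tendsto.congr' ?_
    (((((((h₀.sub h₁).sub h₂).add h₃).add h₄).sub h₅).sub ((g₁.add g₂).const_mul (1 / 2))))⟩
  filter_upwards [self_mem_nhdsWithin] with t ht
  have ht : 0 < t := ht
  set s := ((k * p : ℕ) : ℝ) * √t
  set κ : ℂ := ((s⁻¹ ^ 2 * moment 1 0 : ℝ) : ℂ) with hκ
  have hw : ∀ x y : ℝ, (fun x y : ℝ => (singularPart A C D s x y : ℂ)) x y
      - (fun x y : ℝ => (singularPart A C D s x y : ℂ)) (1 - x) (1 - y)
      = -2 * κ * (x - 1 / 2 : ℝ) := by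
    intro x y
    simp only [singularPart, hκ]
    push_cast
    ring
  have k₀ := sum_rootQ_mul_sub (h := h) hp0 hk hw (p - 1) 2
  have k₃ := sum_rootQ_mul_sub (h := h) hp0 hk hw 0 (p - 1)
  have k₄ := sum_rootQ_mul_sub (h := h) hp0 hk hw 1 (p - 1)
  have x₀ := sum_cosetSum_add_sum_cosetSum (h := h) hp0 hk
  have x₃ := sum_cosetSum_self (h := h) hp0 hk
  have hG : cosetSum p h k 0 1 = cosetSum p h k 0 (p - 1) := by
    have h1 := cosetSum_neg (h := h) hp0 hk 0 1
    have h2 := cosetSum_add_right (h := h) hp0 hk 0 (-1) 1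
    rw [← h1, neg_zero, ← h2]
    congr 1
    ring
  have c₀ : Sfull p 0 = (((p - 1 : ℤ) : ℝ) / p, ((2 : ℤ) : ℝ) / p) := by
    simp [Sfull]; field_simp
  have c₁ : Sfull p 1 = (((p - (p - 1) : ℤ) : ℝ) / p, ((p - 2 : ℤ) : ℝ) / p) := by
    simp [Sfull]; field_simp
  have c₂ : Sfull p 2 = (((p - 0 : ℤ) : ℝ) / p, ((p - (p - 1) : ℤ) : ℝ) / p) := by
    simp [Sfull, hpR]
  have c₃ : Sfull p 3 = (((0 : ℤ) : ℝ) / p, ((p - 1 : ℤ) : ℝ) / p) := by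
    simp [Sfull]; field_simp
  have c₄ : Sfull p 4 = (((1 : ℤ) : ℝ) / p, ((p - 1 : ℤ) : ℝ) / p) := by
    simp [Sfull]; field_simp
  have c₅ : Sfull p 5 = (((p - 1 : ℤ) : ℝ) / p, ((p - (p - 1) : ℤ) : ℝ) / p) := by
    simp [Sfull]; field_simp
  have η₀ : etaF 0 = 1 := rfl
  have η₁ : etaF 1 = -1 := rfl
  have η₂ : etaF 2 = -1 := rfl
  have η₃ : etaF 3 = 1 := rfl
  have η₄ : etaF 4 = 1 := rfl
  have η₅ : etaF 5 = -1 := rfl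
  rw [FtwoZ, tsum_int_eq hp ht, Fin.sum_univ_six, c₀, c₁, c₂, c₃, c₄, c₅, η₀, η₁, η₂, η₃, η₄, η₅,
    Complex.ofReal_neg, Complex.ofReal_one]
  beta_reduce at k₀ k₃ k₄
  linear_combination -((k * p : ℕ) : ℂ) * (k₀ + k₃ + k₄) + 2 * (k * p : ℕ) * κ * (x₀ + x₃)
    + 1 / 2 * (k * p : ℕ) * κ * hG

end
end

section
/- Let κ ∈ ℝ and u₁, u₂, u₃, u₄ ∈ ℝ. (i) If u₃ ≠ 0, then lim_{ε→0⁺} E₂(εκ; u₁, εu₂ + ε⁻¹u₃) = sgn(u₃)·E(u₁). (ii) If u₃ ≠ 0 and u₄ + κu₃ ≠ 0, then lim_{ε→0⁺} E₂(κ; εu₁ + ε⁻¹u₃, εu₂ + ε⁻¹u₄) = sgn(u₃)·sgn(u₄ + κu₃). -/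
open Complex MeasureTheory Real Filter Topology

noncomputable section

/-- `E(u) := 2∫₀ᵘ e^{−πw²} dw`. -/
def Efun (u : ℝ) : ℝ := 2 * ∫ w in (0:ℝ)..u, Real.exp (-Real.pi * w ^ 2)

/-- `E₂(κ; u₁, u₂) := ∫_{ℝ²} sgn(w₁) sgn(w₂ + κw₁) e^{−π((w₁−u₁)² + (w₂−u₂)²)} dw₁ dw₂`. -/
def E2 (κ u₁ u₂ : ℝ) : ℝ :=
  ∫ w : ℝ × ℝ, Real.sign w.1 * Real.sign (w.2 + κ * w.1) *
    Real.exp (-Real.pi * ((w.1 - u₁) ^ 2 + (w.2 - u₂) ^ 2))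

theorem Real.measurable_sign : Measurable Real.sign :=
  Measurable.ite measurableSet_Iio measurable_const
    (Measurable.ite measurableSet_Ioi measurable_const measurable_const)

theorem Real.abs_sign_le_one (x : ℝ) : |Real.sign x| ≤ 1 := by
  rcases Real.sign_apply_eq x with h | h | h <;> simp [h]

/-- A function asymptotic to `ε⁻¹ * u` as `ε → 0⁺` eventually has the sign of `u`. -/
theorem eventually_sign_eq {c : ℝ → ℝ} {u : ℝ} (hu : u ≠ 0)
    (h : Tendsto (fun ε => ε * c ε) (𝓝[>] 0) (𝓝 u)) :
    ∀ᶠ ε in 𝓝[>] (0 : ℝ), Real.sign (c ε) = Real.sign u := by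
  rcases hu.lt_or_gt with hu | hu
  · filter_upwards [h.eventually (gt_mem_nhds hu), self_mem_nhdsWithin] with ε h₁ (h₂ : 0 < ε)
    rw [Real.sign_of_neg hu, Real.sign_of_neg (by simpa using neg_of_mul_neg_right h₁ h₂.le)]
  · filter_upwards [h.eventually (lt_mem_nhds hu), self_mem_nhdsWithin] with ε h₁ (h₂ : 0 < ε)
    rw [Real.sign_of_pos hu, Real.sign_of_pos (pos_of_mul_pos_right h₁ h₂.le)]

theorem integrable_gaussian_pi : Integrable fun x : ℝ => Real.exp (-Real.pi * x ^ 2) :=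
  integrable_exp_neg_mul_sq Real.pi_pos

theorem integral_gaussian_pi : ∫ x : ℝ, Real.exp (-Real.pi * x ^ 2) = 1 := by
  rw [integral_gaussian, div_self Real.pi_ne_zero, Real.sqrt_one]

theorem integral_sign_add_mul_gaussian (u : ℝ) :
    ∫ x : ℝ, Real.sign (x + u) * Real.exp (-Real.pi * x ^ 2) = Efun u := by
  have hf := integrable_gaussian_pi
  have hint : Integrable fun x : ℝ => Real.sign (x + u) * Real.exp (-Real.pi * x ^ 2) :=
    hf.bdd_mul (c := 1)
      (Real.measurable_sign.comp (measurable_id.add_const u)).aestronglyMeasurable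
      (ae_of_all _ fun x => Real.abs_sign_le_one _)
  have hpos : ∫ x in Set.Ioi (-u), Real.sign (x + u) * Real.exp (-Real.pi * x ^ 2) =
      ∫ x in Set.Iic u, Real.exp (-Real.pi * x ^ 2) := by
    rw [← neg_neg u, ← integral_comp_neg_Ioi, neg_neg]
    refine setIntegral_congr_fun measurableSet_Ioi fun x (hx : -u < x) => ?_
    simp only [neg_sq]
    rw [Real.sign_of_pos (by linarith), one_mul]
  have hneg : ∫ x in Set.Iic (-u), Real.sign (x + u) * Real.exp (-Real.pi * x ^ 2) =
      -∫ x in Set.Iic (-u), Real.exp (-Real.pi * x ^ 2) := by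
    rw [integral_Iic_eq_integral_Iio, integral_Iic_eq_integral_Iio, ← integral_neg]
    refine setIntegral_congr_fun measurableSet_Iio fun x (hx : x < -u) => ?_
    rw [Real.sign_of_neg (by linarith), neg_one_mul]
  have heven : ∫ x in (-u)..0, Real.exp (-Real.pi * x ^ 2) =
      ∫ x in (0 : ℝ)..u, Real.exp (-Real.pi * x ^ 2) := by
    have h := intervalIntegral.integral_comp_neg (a := 0) (b := u)
      fun x : ℝ => Real.exp (-Real.pi * x ^ 2)
    simpa [neg_sq] using h.symm
  rw [← intervalIntegral.integral_Iic_add_Ioi hint.integrableOn hint.integrableOn (b := -u),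
    hpos, hneg, neg_add_eq_sub,
    intervalIntegral.integral_Iic_sub_Iic hf.integrableOn hf.integrableOn,
    ← intervalIntegral.integral_add_adjacent_intervals hf.intervalIntegrable
      hf.intervalIntegrable (b := 0), heven, Efun, two_mul]

theorem E2_eq_integral_shift (κ a b : ℝ) :
    E2 κ a b = ∫ w : ℝ × ℝ, Real.sign (w.1 + a) * Real.sign (w.2 + b + κ * (w.1 + a)) *
      (Real.exp (-Real.pi * w.1 ^ 2) * Real.exp (-Real.pi * w.2 ^ 2)) := by
  rw [E2, ← integral_add_right_eq_self _ ((a, b) : ℝ × ℝ)]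
  refine integral_congr_ae (ae_of_all _ fun w => ?_)
  simp only [Prod.fst_add, Prod.snd_add, add_sub_cancel_right, mul_add, Real.exp_add]

/-- If the two signs in the shifted integrand stabilise pointwise, then `E2` converges to the
integral of the limiting integrand. -/
theorem tendsto_E2_of_eventually_sign {l : Filter ℝ} [l.IsCountablyGenerated]
    {κ a b : ℝ → ℝ} {s t : ℝ × ℝ → ℝ}
    (hs : ∀ w : ℝ × ℝ, ∀ᶠ ε in l, Real.sign (w.1 + a ε) = s w)
    (ht : ∀ w : ℝ × ℝ, ∀ᶠ ε in l, Real.sign (w.2 + b ε + κ ε * (w.1 + a ε)) = t w) :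
    Tendsto (fun ε => E2 (κ ε) (a ε) (b ε)) l
      (𝓝 (∫ w : ℝ × ℝ, s w * t w *
        (Real.exp (-Real.pi * w.1 ^ 2) * Real.exp (-Real.pi * w.2 ^ 2)))) := by
  simp only [E2_eq_integral_shift]
  refine tendsto_integral_filter_of_dominated_convergence
    (fun w : ℝ × ℝ => Real.exp (-Real.pi * w.1 ^ 2) * Real.exp (-Real.pi * w.2 ^ 2))
    (Eventually.of_forall fun ε => ?_) (Eventually.of_forall fun ε => ae_of_all _ fun w => ?_)
    (integrable_gaussian_pi.mul_prod integrable_gaussian_pi) (ae_of_all _ fun w => ?_)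
  · refine Measurable.aestronglyMeasurable (.mul (.mul ?_ ?_) (by fun_prop))
    · exact Real.measurable_sign.comp (by fun_prop)
    · exact Real.measurable_sign.comp (by fun_prop)
  · rw [norm_mul, norm_mul, Real.norm_of_nonneg (by positivity :
      0 ≤ Real.exp (-Real.pi * w.1 ^ 2) * Real.exp (-Real.pi * w.2 ^ 2))]
    exact mul_le_of_le_one_left (by positivity)
      (mul_le_one₀ (Real.abs_sign_le_one _) (norm_nonneg _) (Real.abs_sign_le_one _))
  · refine tendsto_const_nhds.congr' ?_
    filter_upwards [hs w, ht w] with ε h₁ h₂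
    rw [h₁, h₂]

/-- Limits of the double error function `E₂` (Lemma 2.1 of the paper):
if `u₃ ≠ 0` then `lim_{ε→0⁺} E₂(εκ; u₁, εu₂+ε⁻¹u₃) = sgn(u₃)E(u₁)`, and if moreover
`u₄ + κu₃ ≠ 0` then `lim_{ε→0⁺} E₂(κ; εu₁+ε⁻¹u₃, εu₂+ε⁻¹u₄) = sgn(u₃)sgn(u₄+κu₃)`. -/
theorem E2_limits (κ u₁ u₂ u₃ u₄ : ℝ) (hu₃ : u₃ ≠ 0) :
    Tendsto (fun ε : ℝ => E2 (ε * κ) u₁ (ε * u₂ + ε⁻¹ * u₃)) (𝓝[>] (0 : ℝ))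
      (𝓝 (Real.sign u₃ * Efun u₁)) ∧
    (u₄ + κ * u₃ ≠ 0 →
      Tendsto (fun ε : ℝ => E2 κ (ε * u₁ + ε⁻¹ * u₃) (ε * u₂ + ε⁻¹ * u₄)) (𝓝[>] (0 : ℝ))
        (𝓝 (Real.sign u₃ * Real.sign (u₄ + κ * u₃)))) := by
  have key : ∀ p q r : ℝ, Tendsto (fun ε : ℝ => r + ε * p + ε ^ 2 * q) (𝓝[>] 0) (𝓝 r) := by
    intro p q r
    have h : ContinuousAt (fun ε : ℝ => r + ε * p + ε ^ 2 * q) 0 := by fun_prop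
    simpa using h.tendsto.mono_left nhdsWithin_le_nhds
  refine ⟨?_, fun hu₄ => ?_⟩
  · have h := tendsto_E2_of_eventually_sign (l := 𝓝[>] 0) (κ := fun ε => ε * κ)
      (a := fun _ => u₁) (b := fun ε => ε * u₂ + ε⁻¹ * u₃)
      (s := fun w => Real.sign (w.1 + u₁)) (t := fun _ => Real.sign u₃)
      (fun w => Eventually.of_forall fun _ => rfl) fun w => by
        refine eventually_sign_eq hu₃ ((key w.2 (u₂ + κ * (w.1 + u₁)) u₃).congr' ?_)
        filter_upwards [self_mem_nhdsWithin] with ε (hε : 0 < ε)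
        field_simp
        ring
    convert h using 2
    rw [← integral_sign_add_mul_gaussian, ← mul_one (∫ x : ℝ, _), ← integral_gaussian_pi,
      ← integral_prod_mul, ← integral_const_mul]
    refine integral_congr_ae (ae_of_all _ fun w => ?_)
    simp only []
    ring
  · have h := tendsto_E2_of_eventually_sign (l := 𝓝[>] 0) (κ := fun _ => κ)
      (a := fun ε => ε * u₁ + ε⁻¹ * u₃) (b := fun ε => ε * u₂ + ε⁻¹ * u₄)
      (s := fun _ => Real.sign u₃) (t := fun _ => Real.sign (u₄ + κ * u₃))
      (fun w => by
        refine eventually_sign_eq hu₃ ((key w.1 u₁ u₃).congr' ?_)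
        filter_upwards [self_mem_nhdsWithin] with ε (hε : 0 < ε)
        field_simp
        ring)
      fun w => by
        refine eventually_sign_eq hu₄
          ((key (w.2 + κ * w.1) (u₂ + κ * u₁) (u₄ + κ * u₃)).congr' ?_)
        filter_upwards [self_mem_nhdsWithin] with ε (hε : 0 < ε)
        field_simp
        ring
    convert h using 2
    rw [integral_const_mul, Measure.volume_eq_prod,
      integral_prod_mul (fun x : ℝ => Real.exp (-Real.pi * x ^ 2))
        (fun x : ℝ => Real.exp (-Real.pi * x ^ 2)), integral_gaussian_pi, mul_one, mul_one]

end
end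

section
/- Let k₁, k₂ ∈ ℝ and let f₁, f₂ : ℍ → ℂ be continuous functions for which there exist constants C, A, δ > 0 with |f_j(x + iy)| ≤ C y^{−A} e^{−δy} for all x ∈ ℝ, y > 0 and j = 1, 2. Then for every τ ∈ ℍ the shuffle relation holds: I_{f₁,f₂}(τ) + I_{f₂,f₁}(τ) = I_{f₁}(τ) · I_{f₂}(τ), where in I_{f₂,f₁} the roles of (f₁,k₁) and (f₂,k₂) are interchanged. -/
open Complex MeasureTheory Real Filter Topology

noncomputable section

/-- The point `−τ̄ + is` on the vertical ray from `−τ̄` to `i∞`. -/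
def vray (τ : ℂ) (s : ℝ) : ℂ := -(starRingEnd ℂ) τ + Complex.I * s

/-- The single Eichler integral
`I_f(τ) = ∫_{−τ̄}^{i∞} f(w)(−i(w+τ))^{k−2} dw` along the upward vertical ray
`w = −τ̄ + is`, `s ∈ (0,∞)` (so `dw = i ds`). -/
def Isingle (k : ℝ) (f : ℂ → ℂ) (τ : ℂ) : ℂ :=
  Complex.I * ∫ s in Set.Ioi (0:ℝ),
    f (vray τ s) * (-Complex.I * (vray τ s + τ)) ^ ((k : ℂ) - 2)

/-- The double Eichler integral
`I_{f₁,f₂}(τ) = ∫_{−τ̄}^{i∞}∫_{w₁}^{i∞} f₁(w₁)f₂(w₂)(−i(w₁+τ))^{k₁−2}(−i(w₂+τ))^{k₂−2} dw₂ dw₁`,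
with `w₁ = −τ̄ + is₁` and `w₂ = w₁ + is₂`, `s₁, s₂ ∈ (0,∞)` (so `dw₂ dw₁ = i·i ds₂ ds₁`). -/
def Idouble (k₁ k₂ : ℝ) (f₁ f₂ : ℂ → ℂ) (τ : ℂ) : ℂ :=
  Complex.I * Complex.I * ∫ s₁ in Set.Ioi (0:ℝ), ∫ s₂ in Set.Ioi (0:ℝ),
    f₁ (vray τ s₁) * f₂ (vray τ s₁ + Complex.I * s₂) *
      (-Complex.I * (vray τ s₁ + τ)) ^ ((k₁ : ℂ) - 2) *
      (-Complex.I * (vray τ s₁ + Complex.I * s₂ + τ)) ^ ((k₂ : ℂ) - 2)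

open Set in
/-- Translating the half-line: `∫_0^∞ g(s+t) dt` as a truncated integral over `(0,∞)`. -/
lemma integral_Ioi_comp_add_left (g : ℝ → ℂ) {s : ℝ} (hs : 0 < s) :
    ∫ t in Ioi (0:ℝ), g (s + t) = ∫ u in Ioi (0:ℝ), (Ioi s).indicator g u := by
  rw [setIntegral_indicator measurableSet_Ioi,
    Set.inter_eq_self_of_subset_right (Ioi_subset_Ioi hs.le)]
  simpa using (measurePreserving_add_left volume s).setIntegral_preimage_emb
    (measurableEmbedding_addLeft s) g (Ioi s)

open Set in
/-- The shuffle relation for iterated integrals of integrable functions on `(0,∞)`. -/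
lemma integral_Ioi_shuffle {g₁ g₂ : ℝ → ℂ} (h₁ : IntegrableOn g₁ (Ioi 0))
    (h₂ : IntegrableOn g₂ (Ioi 0)) :
    (∫ s in Ioi (0:ℝ), ∫ t in Ioi (0:ℝ), g₁ s * g₂ (s + t)) +
      (∫ s in Ioi (0:ℝ), ∫ t in Ioi (0:ℝ), g₂ s * g₁ (s + t)) =
      (∫ s in Ioi (0:ℝ), g₁ s) * ∫ s in Ioi (0:ℝ), g₂ s := by
  set μ := (volume : Measure ℝ).restrict (Ioi 0)
  let F : ℝ × ℝ → ℂ := fun p ↦ g₁ p.1 * g₂ p.2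
  have hF : Integrable F (μ.prod μ) := Integrable.mul_prod h₁ h₂
  have hS : MeasurableSet {p : ℝ × ℝ | p.1 < p.2} := measurableSet_lt measurable_fst measurable_snd
  have e₁ : (∫ s in Ioi (0:ℝ), ∫ t in Ioi (0:ℝ), g₁ s * g₂ (s + t)) =
      ∫ p in {p : ℝ × ℝ | p.1 < p.2}, F p ∂(μ.prod μ) := by
    rw [← integral_indicator hS, integral_prod _ (hF.indicator hS)]
    refine setIntegral_congr_fun measurableSet_Ioi fun s hs ↦ ?_
    simp only [integral_const_mul]
    rw [integral_Ioi_comp_add_left g₂ hs, ← integral_const_mul]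
    refine integral_congr_ae (.of_forall fun u ↦ ?_)
    by_cases hu : s < u <;> simp [F, indicator, hu]
  have e₂ : (∫ s in Ioi (0:ℝ), ∫ t in Ioi (0:ℝ), g₂ s * g₁ (s + t)) =
      ∫ p in {p : ℝ × ℝ | p.1 < p.2}ᶜ, F p ∂(μ.prod μ) := by
    rw [← integral_indicator hS.compl, integral_prod_symm _ (hF.indicator hS.compl)]
    refine setIntegral_congr_fun measurableSet_Ioi fun s hs ↦ ?_
    simp only [integral_const_mul]
    rw [integral_Ioi_comp_add_left g₁ hs, ← integral_const_mul]
    refine integral_congr_ae ?_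
    have hne : ∀ᵐ u ∂μ, u ≠ s := ae_restrict_of_ae (Measure.ae_ne volume s)
    filter_upwards [hne] with u hu
    rcases lt_or_gt_of_ne hu with h | h <;> simp [F, indicator, h, not_lt.mpr h.le, mul_comm]
  rw [e₁, e₂, integral_add_compl hS hF]
  exact integral_prod_mul g₁ g₂

lemma vray_eq (τ : ℂ) (s : ℝ) :
    vray τ s = ((-τ.re : ℝ) : ℂ) + ((τ.im + s : ℝ) : ℂ) * Complex.I := by
  apply Complex.ext <;> simp [vray]

lemma neg_I_mul_vray_add (τ : ℂ) (s : ℝ) :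
    -Complex.I * (vray τ s + τ) = ((2 * τ.im + s : ℝ) : ℂ) := by
  apply Complex.ext
  · simp [vray]; ring
  · simp [vray]

lemma vray_add (τ : ℂ) (s t : ℝ) : vray τ s + Complex.I * t = vray τ (s + t) := by
  simp only [vray]; push_cast; ring

/-- A continuous function on `[a,∞)` with exponential decay is integrable on `(a,∞)`. -/
lemma integrableOn_Ioi_of_isBigO_exp_neg {E : Type*} [NormedAddCommGroup E] {f : ℝ → E} {a b : ℝ}
    (hb : 0 < b) (hf : ContinuousOn f (Set.Ici a))
    (ho : f =O[atTop] fun x ↦ Real.exp (-b * x)) : IntegrableOn f (Set.Ioi a) :=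
  ((hf.locallyIntegrableOn measurableSet_Ici).integrableOn_of_isBigO_atTop ho
    ⟨Set.Ioi b, Ioi_mem_atTop b, exp_neg_integrableOn_Ioi b hb⟩).mono_set Set.Ioi_subset_Ici_self

/-- The integrand of `Isingle` is integrable on `(0,∞)`. -/
lemma integrableOn_Isingle_integrand (k : ℝ) {f : ℂ → ℂ} {C A δ : ℝ} (hA : 0 < A) (hδ : 0 < δ)
    (hC : 0 < C) (hcont : ContinuousOn f {z : ℂ | 0 < z.im})
    (hf : ∀ x y : ℝ, 0 < y → ‖f (x + y * Complex.I)‖ ≤ C * y ^ (-A) * Real.exp (-δ * y))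
    {τ : ℂ} (hτ : 0 < τ.im) :
    IntegrableOn (fun s : ℝ ↦ f (vray τ s) * (-Complex.I * (vray τ s + τ)) ^ ((k : ℂ) - 2))
      (Set.Ioi 0) := by
  simp only [neg_I_mul_vray_add]
  refine integrableOn_Ioi_of_isBigO_exp_neg (half_pos hδ) ?_ ?_
  · refine ContinuousOn.mul (hcont.comp (by unfold vray; fun_prop) ?_) ?_
    · intro s hs
      have : (0:ℝ) ≤ s := hs
      simp only [vray_eq, Set.mem_ofPred_eq]
      simp; positivity
    · refine ContinuousOn.cpow_const (by fun_prop) fun s hs ↦ ?_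
      have : (0:ℝ) ≤ s := hs
      exact Complex.ofReal_mem_slitPlane.mpr (by positivity)
  · have hpow : (fun s : ℝ ↦ (2 * τ.im + s) ^ (k - 2)) =O[atTop] fun s : ℝ ↦ Real.exp (δ / 2 * s) := by
      have h := (isLittleO_rpow_exp_pos_mul_atTop (k - 2) (half_pos hδ)).isBigO.comp_tendsto
        (tendsto_atTop_add_const_left atTop (2 * τ.im) tendsto_id)
      refine h.trans (Asymptotics.IsBigO.of_bound (Real.exp (δ / 2 * (2 * τ.im))) ?_)
      refine .of_forall fun s ↦ ?_
      simp [mul_add, Real.exp_add]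
    have hval : (fun s : ℝ ↦ f (vray τ s)) =O[atTop] fun s : ℝ ↦ Real.exp (-δ * s) := by
      refine Asymptotics.IsBigO.of_bound (C * τ.im ^ (-A)) ?_
      filter_upwards [eventually_ge_atTop 0] with s hs
      rw [vray_eq, Real.norm_of_nonneg (Real.exp_pos _).le]
      refine (hf _ _ (by positivity)).trans ?_
      have h : (τ.im + s) ^ (-A) ≤ τ.im ^ (-A) :=
        Real.rpow_le_rpow_of_nonpos hτ (by linarith) (by linarith)
      have h' : Real.exp (-δ * (τ.im + s)) ≤ Real.exp (-δ * s) :=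
        Real.exp_le_exp.mpr (by nlinarith [mul_pos hδ hτ])
      gcongr
    have hcpow : (fun s : ℝ ↦ ((2 * τ.im + s : ℝ) : ℂ) ^ ((k : ℂ) - 2)) =O[atTop]
        fun s : ℝ ↦ Real.exp (δ / 2 * s) := by
      refine Asymptotics.IsBigO.trans (Asymptotics.IsBigO.of_bound 1 ?_) hpow
      filter_upwards [eventually_ge_atTop 0] with s hs
      rw [Complex.norm_cpow_eq_rpow_re_of_pos (by positivity), one_mul]
      simpa using le_abs_self _
    refine (hval.mul hcpow).congr_right fun s ↦ ?_
    rw [← Real.exp_add]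
    ring_nf

lemma Idouble_eq (k₁ k₂ : ℝ) (f₁ f₂ : ℂ → ℂ) (τ : ℂ) :
    Idouble k₁ k₂ f₁ f₂ τ = Complex.I * Complex.I *
      ∫ s in Set.Ioi (0:ℝ), ∫ t in Set.Ioi (0:ℝ),
        (f₁ (vray τ s) * (-Complex.I * (vray τ s + τ)) ^ ((k₁ : ℂ) - 2)) *
        (f₂ (vray τ (s + t)) * (-Complex.I * (vray τ (s + t) + τ)) ^ ((k₂ : ℂ) - 2)) := by
  simp only [Idouble, vray_add]
  congr! 5
  ring

/-- The shuffle relation for double Eichler integrals: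
`I_{f₁,f₂}(τ) + I_{f₂,f₁}(τ) = I_{f₁}(τ)·I_{f₂}(τ)`. -/
theorem Idouble_shuffle (k₁ k₂ : ℝ) (f₁ f₂ : ℂ → ℂ)
    (hcont₁ : ContinuousOn f₁ {z : ℂ | 0 < z.im})
    (hcont₂ : ContinuousOn f₂ {z : ℂ | 0 < z.im})
    (hbound : ∃ C A δ : ℝ, 0 < C ∧ 0 < A ∧ 0 < δ ∧
      (∀ x y : ℝ, 0 < y → ‖f₁ (x + y * Complex.I)‖ ≤ C * y ^ (-A) * Real.exp (-δ * y)) ∧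
      (∀ x y : ℝ, 0 < y → ‖f₂ (x + y * Complex.I)‖ ≤ C * y ^ (-A) * Real.exp (-δ * y)))
    (τ : ℂ) (hτ : 0 < τ.im) :
    Idouble k₁ k₂ f₁ f₂ τ + Idouble k₂ k₁ f₂ f₁ τ = Isingle k₁ f₁ τ * Isingle k₂ f₂ τ := by
  obtain ⟨C, A, δ, hC, hA, hδ, hf₁, hf₂⟩ := hbound
  rw [Idouble_eq, Idouble_eq, ← mul_add,
    integral_Ioi_shuffle (integrableOn_Isingle_integrand k₁ hA hδ hC hcont₁ hf₁ hτ)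
      (integrableOn_Isingle_integrand k₂ hA hδ hC hcont₂ hf₂ hτ)]
  simp only [Isingle]
  ring

end
end
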